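/- arXiv:1009.1862 — 4 statements merged into one kernel-verified Lean document; each statement's English description precedes it below -/
import Mathlib

section
/- Let Γ ⊆ G be finite groups, let V = {f : Γ\G → ℂ} be the representation of G induced from the trivial representation of Γ, and for φ : G → ℂ let R(φ) = Σ_{g∈G} φ(g) π_ind(g). Then the character of the induced representation is given by the Frobenius character formula: Tr(R(φ)) = Σ_γ a_γ · O_γ(φ), where γ runs over a set of representatives of the Γ-conjugacy classes of Γ, a_γ is the number of elements of the quotient of centralizers Γ_γ\G_γ (with Γ_γ and G_γ the centralizers of γ in Γ and in G), and O_γ(φ) = Σ_{G_γ x ∈ G_γ\G} φ(x⁻¹ γ x) is the orbital integral of φ over the G-conjugacy class of γ. -/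
open scoped Classical

/-- Right translation by `g` on the right coset space `Γ\G`. -/
def rightTranslate {G : Type*} [Group G] (Γ : Subgroup G) (g : G) :
    Quotient (QuotientGroup.rightRel Γ) → Quotient (QuotientGroup.rightRel Γ) :=
  Quotient.map' (· * g) (fun a b h => by
    rw [QuotientGroup.rightRel_apply] at h ⊢
    simpa [mul_inv_rev, mul_assoc] using h)

/-- The operator `R(φ) = ∑_{g ∈ G} φ(g) π_ind(g)` on the representation
`V = {f : Γ\G → ℂ}` induced from the trivial representation of `Γ`, where
`(π_ind(g) f)(Γx) = f(Γxg)`. -/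
noncomputable def inducedOp {G : Type*} [Group G] [Fintype G] (Γ : Subgroup G)
    (φ : G → ℂ) :
    (Quotient (QuotientGroup.rightRel Γ) → ℂ) →ₗ[ℂ]
      (Quotient (QuotientGroup.rightRel Γ) → ℂ) :=
  ∑ g : G, φ g • LinearMap.funLeft ℂ ℂ (rightTranslate Γ g)

section FrobeniusCharacter

open scoped Finset

variable {G : Type*} [Group G]

theorem trace_funLeft {α : Type*} [Fintype α] (f : α → α) :
    LinearMap.trace ℂ (α → ℂ) (LinearMap.funLeft ℂ ℂ f) = ∑ a, if f a = a then (1 : ℂ) else 0 := by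
  rw [LinearMap.trace_eq_matrix_trace ℂ (Pi.basisFun ℂ α)]
  simp only [Matrix.trace, Matrix.diag, LinearMap.toMatrix_apply, Pi.basisFun_repr,
    Pi.basisFun_apply, LinearMap.funLeft_apply, Pi.single_apply]

theorem card_rightRel_fiber [Fintype G] (H : Subgroup G)
    (q : Quotient (QuotientGroup.rightRel H)) :
    #{x : G | (Quotient.mk'' x : Quotient (QuotientGroup.rightRel H)) = q} = Nat.card H := by
  rw [Nat.card_eq_fintype_card, ← Finset.card_univ]
  symm
  refine Finset.card_bij (fun h _ => (h : G) * q.out) ?_ ?_ ?_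
  · intro h _
    rw [Finset.mem_filter_univ]
    conv_rhs => rw [← Quotient.out_eq' q]
    rw [Quotient.eq'', QuotientGroup.rightRel_apply]
    simp
  · intro a _ b _ hab
    exact Subtype.ext (mul_right_cancel hab)
  · intro x hx
    rw [Finset.mem_filter_univ] at hx
    rw [← Quotient.out_eq' q, eq_comm, Quotient.eq'', QuotientGroup.rightRel_apply] at hx
    exact ⟨⟨_, hx⟩, Finset.mem_univ _, by simp⟩

theorem card_mul_sum_rightRel_mk [Fintype G] (H : Subgroup G)
    (f : Quotient (QuotientGroup.rightRel H) → ℂ) :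
    (Nat.card H : ℂ) * ∑ q, f q = ∑ x : G, f (Quotient.mk'' x) := by
  rw [← Finset.sum_fiberwise Finset.univ
    (fun x : G => (Quotient.mk'' x : Quotient (QuotientGroup.rightRel H))), Finset.mul_sum]
  refine Finset.sum_congr rfl fun q _ => ?_
  rw [Finset.sum_congr rfl (g := fun _ => f q) fun x hx => by
    rw [(Finset.mem_filter_univ x).mp hx], Finset.sum_const, card_rightRel_fiber, nsmul_eq_mul]

theorem card_mul_sum_rightRel_out [Fintype G] (H : Subgroup G) (f : G → ℂ)
    (hf : ∀ h ∈ H, ∀ x, f (h * x) = f x) :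
    (Nat.card H : ℂ) * ∑ q : Quotient (QuotientGroup.rightRel H), f q.out = ∑ x, f x := by
  rw [card_mul_sum_rightRel_mk H fun q => f q.out]
  refine Finset.sum_congr rfl fun x _ => ?_
  have h := Quotient.eq''.mp
    (Quotient.out_eq' (Quotient.mk'' x : Quotient (QuotientGroup.rightRel H)))
  rw [QuotientGroup.rightRel_apply] at h
  rw [← hf _ h, inv_mul_cancel_right]

theorem card_centralizer_mul_orbitalIntegral [Fintype G] (g : G) (φ : G → ℂ) :
    (Nat.card (Subgroup.centralizer {g}) : ℂ) *
        ∑ q : Quotient (QuotientGroup.rightRel (Subgroup.centralizer {g})),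
          φ ((q.out : G)⁻¹ * g * q.out) = ∑ x, φ (x⁻¹ * g * x) := by
  refine card_mul_sum_rightRel_out _ (fun x => φ (x⁻¹ * g * x)) fun h hh x => ?_
  rw [Subgroup.mem_centralizer_singleton_iff] at hh
  have hconj : h⁻¹ * g * h = g := by rw [mul_assoc, ← hh, inv_mul_cancel_left]
  have hx : (h * x)⁻¹ * g * (h * x) = x⁻¹ * (h⁻¹ * g * h) * x := by group
  rw [hx, hconj]

theorem card_rightRel_mul_card [Fintype G] (H : Subgroup G) :
    Nat.card (Quotient (QuotientGroup.rightRel H)) * Nat.card H = Nat.card G := by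
  rw [Nat.card_congr (QuotientGroup.quotientRightRelEquivQuotientLeftRel H),
    ← Subgroup.card_eq_card_quotient_mul_card_subgroup]

theorem card_conjClass_mul_card_centralizer [Fintype G] (g : G) :
    #{x : G | ConjClasses.mk x = ConjClasses.mk g} * Nat.card (Subgroup.centralizer {g}) =
      Nat.card G := by
  have h := MulAction.card_orbit_mul_card_stabilizer_eq_card_group (ConjAct G) g
  simp only [← Nat.card_eq_fintype_card, ConjAct.stabilizer_eq_centralizer] at h
  rw [← Fintype.card_subtype, ← Nat.card_eq_fintype_card]
  refine Eq.trans ?_ h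
  congr 1
  refine Nat.card_congr (Equiv.subtypeEquivRight fun x => ?_)
  rw [ConjAct.mem_orbit_conjAct, ConjClasses.mk_eq_mk_iff_isConj]

theorem card_subgroupOf_centralizer (Γ : Subgroup G) (γ : Γ) :
    Nat.card (Γ.subgroupOf (Subgroup.centralizer {(γ : G)})) =
      Nat.card (Subgroup.centralizer {γ}) :=
  Nat.card_congr
    { toFun := fun x => ⟨⟨x.1.1, x.2⟩, Subgroup.mem_centralizer_singleton_iff.mpr
        (Subtype.ext (Subgroup.mem_centralizer_singleton_iff.mp x.1.2))⟩
      invFun := fun x => ⟨⟨x.1.1, Subgroup.mem_centralizer_singleton_iff.mpr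
        (congrArg Subtype.val (Subgroup.mem_centralizer_singleton_iff.mp x.2))⟩, x.1.2⟩
      left_inv := fun _ => rfl
      right_inv := fun _ => rfl }

theorem card_mul_trace_inducedOp [Fintype G] (Γ : Subgroup G) (φ : G → ℂ) :
    (Nat.card Γ : ℂ) *
        LinearMap.trace ℂ (Quotient (QuotientGroup.rightRel Γ) → ℂ) (inducedOp Γ φ) =
      ∑ γ : Γ, ∑ x : G, φ (x⁻¹ * γ * x) := by
  have hfix (g x : G) : rightTranslate Γ g (Quotient.mk'' x) = Quotient.mk'' x ↔
      x * g * x⁻¹ ∈ Γ := by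
    rw [rightTranslate, Quotient.map'_mk'', eq_comm, Quotient.eq'', QuotientGroup.rightRel_apply]
  simp only [inducedOp, map_sum, map_smul, trace_funLeft, smul_eq_mul]
  rw [Finset.mul_sum, Finset.sum_comm]
  simp_rw [mul_left_comm (Nat.card Γ : ℂ), card_mul_sum_rightRel_mk Γ, hfix, Finset.mul_sum]
  rw [Finset.sum_comm]
  refine Finset.sum_congr rfl fun x _ => ?_
  simp only [mul_ite, mul_one, mul_zero]
  rw [← Finset.sum_filter]
  refine Finset.sum_bij' (fun g hg => (⟨x * g * x⁻¹, (Finset.mem_filter_univ g).mp hg⟩ : Γ))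
    (fun γ _ => x⁻¹ * γ * x) ?_ ?_ ?_ ?_ ?_ <;> intros <;> simp [mul_assoc]

theorem sum_eq_sum_conjClasses [Fintype G] [Fintype (ConjClasses G)] (F : G → ℂ)
    (hF : ∀ a b, IsConj a b → F a = F b) :
    ∑ g, F g = ∑ c : ConjClasses G, (#{x : G | ConjClasses.mk x = c} : ℂ) * F c.out := by
  rw [← Finset.sum_fiberwise Finset.univ (ConjClasses.mk : G → ConjClasses G)]
  refine Finset.sum_congr rfl fun c _ => ?_
  rw [Finset.sum_congr rfl (g := fun _ => F c.out), Finset.sum_const, nsmul_eq_mul]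
  intro x hx
  refine hF _ _ (ConjClasses.mk_eq_mk_iff_isConj.mp ?_)
  rw [(Finset.mem_filter_univ x).mp hx]
  exact (Quotient.out_eq c).symm

end FrobeniusCharacter

/-- Frobenius character formula for the representation induced from the
trivial representation of `Γ ⊆ G`:
`Tr(R(φ)) = ∑_γ a_γ · O_γ(φ)`, where `γ` runs over representatives of the
`Γ`-conjugacy classes of `Γ`, `a_γ = #(Γ_γ\G_γ)` is the number of elements of the
quotient of the centralizers, and `O_γ(φ) = ∑_{G_γ x ∈ G_γ\G} φ(x⁻¹ γ x)` is the
orbital integral. -/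
theorem frobenius_character_formula {G : Type*} [Group G] [Fintype G]
    (Γ : Subgroup G) (φ : G → ℂ) :
    LinearMap.trace ℂ (Quotient (QuotientGroup.rightRel Γ) → ℂ) (inducedOp Γ φ) =
      ∑ c : ConjClasses Γ,
        (Nat.card
            (Quotient (QuotientGroup.rightRel
              (Γ.subgroupOf (Subgroup.centralizer {((c.out : Γ) : G)})))) : ℂ) *
          ∑ q : Quotient (QuotientGroup.rightRel
              (Subgroup.centralizer {((c.out : Γ) : G)})),
            φ ((q.out : G)⁻¹ * ((c.out : Γ) : G) * q.out) := by
  have hΓ : (Nat.card Γ : ℂ) ≠ 0 := Nat.cast_ne_zero.mpr Nat.card_pos.ne'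
  apply mul_left_cancel₀ hΓ
  have hconj (a b : Γ) (hab : IsConj a b) :
      ∑ x : G, φ (x⁻¹ * a * x) = ∑ x : G, φ (x⁻¹ * b * x) := by
    obtain ⟨u, rfl⟩ := isConj_iff.mp hab
    refine Fintype.sum_equiv (Equiv.mulLeft (u : G)) _ _ fun x => ?_
    simp [mul_assoc]
  rw [card_mul_trace_inducedOp,
    sum_eq_sum_conjClasses (fun γ : Γ => ∑ x : G, φ (x⁻¹ * γ * x)) hconj, Finset.mul_sum]
  refine Finset.sum_congr rfl fun c _ => ?_
  have hc : ConjClasses.mk c.out = c := Quotient.out_eq c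
  have h₁ := card_conjClass_mul_card_centralizer c.out
  rw [hc, ← card_subgroupOf_centralizer] at h₁
  have h₂ := card_rightRel_mul_card
    (Γ.subgroupOf (Subgroup.centralizer {((c.out : Γ) : G)}))
  rw [← card_centralizer_mul_orbitalIntegral, ← h₁, ← h₂]
  push_cast
  ring
end

section
/- Hasse–Minkowski theorem: let Q(x₁, …, xₙ) = Σ_{i ≤ j} a_{ij} x_i x_j be a quadratic form with rational coefficients a_{ij} ∈ ℚ. Then the equation Q(x₁, …, xₙ) = 0 has a nonzero solution with coordinates in ℚ if and only if it has a nonzero solution with coordinates in the p-adic numbers ℚ_p for every prime p and a nonzero solution with coordinates in the real numbers ℝ. -/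
namespace HasseMinkowski

/-- The conic `x² = a y² + b z²` has a point over `K`, that is, the Hilbert symbol of `a`, `b`
over `K` is trivial. -/
def Hilbert (K : Type*) [Field K] (a b : K) : Prop :=
  ∃ x y z : K, (x ≠ 0 ∨ y ≠ 0 ∨ z ≠ 0) ∧ x ^ 2 = a * y ^ 2 + b * z ^ 2

/-- The diagonal form with coefficients `d` has a nonzero solution over `K`. -/
def DiagIsotropic (K : Type*) [Field K] {n : ℕ} (d : Fin n → ℤ) : Prop :=
  ∃ x : Fin n → K, x ≠ 0 ∧ ∑ i, (d i : K) * x i ^ 2 = 0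

section Field

variable {K : Type*} [Field K] {a b c : K}

theorem Hilbert.symm (h : Hilbert K a b) : Hilbert K b a := by
  obtain ⟨x, y, z, h0, h⟩ := h
  exact ⟨x, z, y, by tauto, by rw [h]; ring⟩

theorem Hilbert.of_isSquare (ha : IsSquare a) : Hilbert K a b := by
  obtain ⟨s, rfl⟩ := ha
  exact ⟨s, 1, 0, by simp, by ring⟩

theorem Hilbert.mul_sq {s : K} (hs : s ≠ 0) (h : Hilbert K a b) : Hilbert K a (b * s ^ 2) := by
  obtain ⟨x, y, z, h0, h⟩ := h
  refine ⟨x, y, z / s, by simpa [hs] using h0, ?_⟩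
  rw [h]; field_simp

theorem Hilbert.of_mul_sq {s : K} (hs : s ≠ 0) (h : Hilbert K a (b * s ^ 2)) : Hilbert K a b := by
  obtain ⟨x, y, z, h0, h⟩ := h
  refine ⟨x, y, z * s, by simpa [hs] using h0, ?_⟩
  rw [h]; ring

/-- Multiplying `b` by a nonzero norm `r² - a s²` preserves solvability. -/
theorem Hilbert.mul_norm {r s : K} (hc : r ^ 2 - a * s ^ 2 ≠ 0) (h : Hilbert K a b) :
    Hilbert K a (b * (r ^ 2 - a * s ^ 2)) := by
  obtain ⟨x, y, z, h0, h⟩ := h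
  by_cases hz : z = 0
  · subst hz
    have hy : y ≠ 0 := by
      rintro rfl
      have : x = 0 := by simpa using h
      simp_all
    refine .of_isSquare ⟨x / y, ?_⟩
    field_simp
    linear_combination -h
  · refine ⟨x * r + a * y * s, x * s + y * r, z * (r ^ 2 - a * s ^ 2) / (r ^ 2 - a * s ^ 2), ?_, ?_⟩
    · right; right
      field_simp
      exact hz
    · rw [mul_div_assoc, div_self hc]
      linear_combination (r ^ 2 - a * s ^ 2) * h

theorem Hilbert.neg_mul (ha : a ≠ 0) (h : Hilbert K a b) : Hilbert K a (-a * b) := by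
  have := h.mul_norm (r := 0) (s := 1) (by simpa using ha)
  convert this using 1; ring

/-- A nondegenerate ternary diagonal form and the associated conic. -/
theorem hilbert_iff_ternary (ha : a ≠ 0) :
    Hilbert K (-a * b) (-a * c) ↔
      ∃ x y z : K, (x ≠ 0 ∨ y ≠ 0 ∨ z ≠ 0) ∧ a * x ^ 2 + b * y ^ 2 + c * z ^ 2 = 0 := by
  constructor
  · rintro ⟨x, y, z, h0, h⟩
    refine ⟨x / a, y, z, by simpa [ha] using h0, ?_⟩
    field_simp
    linear_combination h
  · rintro ⟨x, y, z, h0, h⟩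
    refine ⟨a * x, y, z, by simpa [ha] using h0, ?_⟩
    linear_combination a * h

/-- A binary isotropic diagonal form is universal. -/
theorem binary_universal (h2 : (2 : K) ≠ 0) (ha : a ≠ 0) (hb : b ≠ 0) {x y : K}
    (h0 : x ≠ 0 ∨ y ≠ 0) (h : a * x ^ 2 + b * y ^ 2 = 0) (c : K) :
    ∃ u v : K, a * u ^ 2 + b * v ^ 2 = c := by
  have hx : x ≠ 0 := by
    rintro rfl
    have : y = 0 := by simpa [hb] using h
    simp_all
  refine ⟨1 + (c - a) / (2 * a * x) * x, (c - a) / (2 * a * x) * y, ?_⟩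
  field_simp
  linear_combination ((c - a) ^ 2) * h

/-- If `⟨a, b⟩ ⊥ d` is isotropic, then it has an isotropic vector with a nonzero component value
on `⟨a, b⟩`. -/
theorem exists_common_value (h2 : (2 : K) ≠ 0) {n : ℕ} {a b : ℤ} {d : Fin (n + 1) → ℤ}
    (ha : (a : K) ≠ 0) (hb : (b : K) ≠ 0) (hd : ∀ i, (d i : K) ≠ 0)
    (h : DiagIsotropic K (Fin.cons a (Fin.cons b d) : Fin (n + 3) → ℤ)) :
    ∃ (x y : K) (w : Fin (n + 1) → K), (a : K) * x ^ 2 + b * y ^ 2 ≠ 0 ∧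
      (a : K) * x ^ 2 + b * y ^ 2 + ∑ i, (d i : K) * w i ^ 2 = 0 := by
  obtain ⟨v, hv0, hv⟩ := h
  obtain ⟨x, v, rfl⟩ : ∃ x v', v = Fin.cons x v' := ⟨v 0, Fin.tail v, (Fin.cons_self_tail v).symm⟩
  obtain ⟨y, w, rfl⟩ : ∃ x v', v = Fin.cons x v' := ⟨v 0, Fin.tail v, (Fin.cons_self_tail v).symm⟩
  rw [Fin.sum_univ_succ, Fin.sum_univ_succ] at hv
  simp only [Fin.cons_zero, Fin.cons_succ] at hv
  by_cases h1 : (a : K) * x ^ 2 + b * y ^ 2 = 0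
  · by_cases hxy : x ≠ 0 ∨ y ≠ 0
    · obtain ⟨u, t, hut⟩ := binary_universal h2 ha hb hxy h1 (-(d 0 : K))
      refine ⟨u, t, Pi.single 0 1, by rw [hut]; exact neg_ne_zero.2 (hd 0), ?_⟩
      rw [hut, Finset.sum_eq_single 0] <;> simp +contextual
    · push Not at hxy
      obtain ⟨rfl, rfl⟩ := hxy
      have hw : w ≠ 0 := by
        rintro rfl
        apply hv0
        ext i
        refine Fin.cases rfl (fun i => ?_) i
        refine Fin.cases rfl (fun i => ?_) i
        simp
      obtain ⟨i, hi⟩ := Function.ne_iff.1 hw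
      have hi : w i ≠ 0 := hi
      have hdi := hd i
      have hv' : ∑ j, (d j : K) * w j ^ 2 = 0 := by simpa using hv
      refine ⟨1, 0, fun j => (Pi.single i 1 : Fin (n + 1) → K) j +
        (-a - d i) / (2 * d i * w i) * w j, by simpa using ha, ?_⟩
      have : ∀ μ : K, ∑ j, (d j : K) * ((Pi.single i 1 : Fin (n + 1) → K) j + μ * w j) ^ 2 =
          d i + 2 * μ * d i * w i := by
        intro μ
        have e : ∀ j, (d j : K) * ((Pi.single i 1 : Fin (n + 1) → K) j + μ * w j) ^ 2 =
          (Pi.single i (d i + 2 * μ * d i * w i : K) : Fin (n + 1) → K) j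
            + μ ^ 2 * (d j * w j ^ 2) := by
          intro j
          by_cases hj : j = i
          · subst hj; simp; ring
          · simp [hj]; ring
        simp_rw [e]
        rw [Finset.sum_add_distrib, ← Finset.mul_sum, hv']
        simp
      rw [this]
      field_simp
      ring
  · exact ⟨x, y, w, h1, by rw [← hv]; ring⟩

theorem diagIsotropic_fin_three {a b c : ℤ} (ha : (a : K) ≠ 0) :
    DiagIsotropic K (Fin.cons a (Fin.cons b (Fin.cons c Fin.elim0)) : Fin 3 → ℤ) ↔
      Hilbert K ((-a * b : ℤ) : K) ((-a * c : ℤ) : K) := by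
  push_cast
  rw [hilbert_iff_ternary ha]
  constructor
  · rintro ⟨v, hv0, hv⟩
    refine ⟨v 0, v 1, v 2, ?_, ?_⟩
    · by_contra! h
      apply hv0
      ext i
      fin_cases i <;> simp [h.1, h.2.1, h.2.2]
    · rw [← hv, Fin.sum_univ_three]
      rfl
  · rintro ⟨x, y, z, h0, h⟩
    refine ⟨![x, y, z], ?_, ?_⟩
    · intro h
      have e0 := congrFun h 0
      have e1 := congrFun h 1
      have e2 := congrFun h 2
      simp at e0 e1 e2
      simp_all
    · rw [Fin.sum_univ_three, ← h]
      rfl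

end Field

/-- In a complete field the numbers that differ from `t ≠ 0` by a nonzero square form a
neighbourhood of `t`. -/
theorem eventually_eq_mul_sq {K : Type*} [NontriviallyNormedField K] [CompleteSpace K]
    (h2 : (2 : K) ≠ 0) {t : K} (ht : t ≠ 0) :
    ∀ᶠ u in nhds t, ∃ s : K, s ≠ 0 ∧ u = t * s ^ 2 := by
  have h1 : HasStrictDerivAt (fun x : K => t * x ^ 2) (t * (2 * 1)) 1 := by
    simpa using ((hasStrictDerivAt_pow 2 (1 : K)).const_mul t)
  have hm := h1.map_nhds_eq (by simpa using ⟨ht, h2⟩)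
  simp only [one_pow, mul_one] at hm
  rw [← hm, Filter.eventually_map]
  filter_upwards [isOpen_ne.mem_nhds (one_ne_zero : (1 : K) ≠ 0)] with x hx
  exact ⟨x, hx, rfl⟩

open ZMod

section Padic

variable {p : ℕ} [hp : Fact p.Prime]

theorem exists_primitive_solution {a b : ℤ} (h : Hilbert ℚ_[p] a b) :
    ∃ x y z : ℤ_[p], (IsUnit x ∨ IsUnit y ∨ IsUnit z) ∧ x ^ 2 = a * y ^ 2 + b * z ^ 2 := by
  obtain ⟨x, y, z, h0, h⟩ := h
  have key : ∀ c : ℚ_[p], c ≠ 0 → ‖x‖ ≤ ‖c‖ → ‖y‖ ≤ ‖c‖ → ‖z‖ ≤ ‖c‖ →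
      (x = c ∨ y = c ∨ z = c) →
      ∃ x y z : ℤ_[p], (IsUnit x ∨ IsUnit y ∨ IsUnit z) ∧ x ^ 2 = a * y ^ 2 + b * z ^ 2 := by
    intro c hc hx hy hz h1
    have hle : ∀ t : ℚ_[p], ‖t‖ ≤ ‖c‖ → ∃ t' : ℤ_[p], (t' : ℚ_[p]) = t / c := fun t ht =>
      ⟨⟨t / c, by rw [norm_div]; exact div_le_one_of_le₀ ht (norm_nonneg _)⟩, rfl⟩
    have hu : ∀ (t : ℚ_[p]) (t' : ℤ_[p]), (t' : ℚ_[p]) = t / c → t = c → IsUnit t' := by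
      rintro t t' ht rfl
      rw [PadicInt.isUnit_iff, PadicInt.norm_def, ht]
      simp [div_self hc]
    obtain ⟨x', hx'⟩ := hle x hx
    obtain ⟨y', hy'⟩ := hle y hy
    obtain ⟨z', hz'⟩ := hle z hz
    refine ⟨x', y', z', ?_, ?_⟩
    · rcases h1 with h1 | h1 | h1
      · exact .inl (hu _ _ hx' h1)
      · exact .inr (.inl (hu _ _ hy' h1))
      · exact .inr (.inr (hu _ _ hz' h1))
    · apply PadicInt.ext
      push_cast
      rw [hx', hy', hz']
      field_simp
      exact h
  have hne : ∀ c t : ℚ_[p], ‖t‖ ≤ ‖c‖ → t ≠ 0 → c ≠ 0 := fun c t hct ht => by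
    rw [← norm_pos_iff] at ht ⊢; exact ht.trans_le hct
  have hmax : ∃ c, ‖x‖ ≤ ‖c‖ ∧ ‖y‖ ≤ ‖c‖ ∧ ‖z‖ ≤ ‖c‖ ∧ (x = c ∨ y = c ∨ z = c) := by
    rcases le_total ‖x‖ ‖y‖ with h1 | h1 <;> rcases le_total ‖y‖ ‖z‖ with h2 | h2 <;>
      rcases le_total ‖x‖ ‖z‖ with h3 | h3
    · exact ⟨z, h3, h2, le_rfl, by simp⟩
    · exact ⟨z, h1.trans h2, h2, le_rfl, by simp⟩
    · exact ⟨y, h1, le_rfl, h2, by simp⟩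
    · exact ⟨y, h1, le_rfl, h2, by simp⟩
    · exact ⟨z, h3, h2, le_rfl, by simp⟩
    · exact ⟨x, le_rfl, h1, h3, by simp⟩
    · exact ⟨z, h3, h1.trans h3, le_rfl, by simp⟩
    · exact ⟨x, le_rfl, h1, h3, by simp⟩
  obtain ⟨c, hx, hy, hz, hc⟩ := hmax
  refine key c ?_ hx hy hz hc
  rcases h0 with h0 | h0 | h0
  · exact hne c _ hx h0
  · exact hne c _ hy h0
  · exact hne c _ hz h0

theorem isUnit_intCast {u : ℤ} (hu : ¬ (p : ℤ) ∣ u) : IsUnit (u : ℤ_[p]) := by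
  rw [PadicInt.isUnit_iff]
  refine le_antisymm (PadicInt.norm_le_one _) ?_
  by_contra! h
  exact hu ((PadicInt.norm_int_lt_one_iff_dvd u).1 h)

theorem not_isUnit_iff_dvd {x : ℤ_[p]} : ¬ IsUnit x ↔ (p : ℤ_[p]) ∣ x := by
  rw [PadicInt.not_isUnit_iff, PadicInt.norm_lt_one_iff_dvd]

theorem exists_eq_add_mul_sq {u v : ℤ} (hv : ¬ (p : ℤ) ∣ v)
    (h : Hilbert ℚ_[p] u ((p * v : ℤ) : ℚ_[p])) : ∃ x z : ℤ_[p], x ^ 2 = u + p * v * z ^ 2 := by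
  obtain ⟨x, y, z, h0, h⟩ := exists_primitive_solution h
  push_cast at h
  have hpr : Prime (p : ℤ_[p]) := PadicInt.prime_p
  have hy : IsUnit y := by
    by_contra hy
    have hy' := not_isUnit_iff_dvd.1 hy
    have hx : (p : ℤ_[p]) ∣ x := by
      refine hpr.dvd_of_dvd_pow (n := 2) ?_
      rw [h]
      exact dvd_add (Dvd.dvd.mul_left (dvd_pow hy' two_ne_zero) _)
        (Dvd.dvd.mul_right (dvd_mul_right _ _) _)
    have hz : ¬ (p : ℤ_[p]) ∣ z := by
      intro hz
      rcases h0 with h0 | h0 | h0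
      · exact not_isUnit_iff_dvd.2 hx h0
      · exact hy h0
      · exact not_isUnit_iff_dvd.2 hz h0
    have hd : (p : ℤ_[p]) * p ∣ p * (v * z ^ 2) := by
      have : (p : ℤ_[p]) * (v * z ^ 2) = x ^ 2 - u * y ^ 2 := by rw [h]; ring
      rw [this, ← sq]
      exact dvd_sub (pow_dvd_pow_of_dvd hx 2) (Dvd.dvd.mul_left (pow_dvd_pow_of_dvd hy' 2) _)
    have hd' := (mul_dvd_mul_iff_left hpr.ne_zero).1 hd
    rcases hpr.dvd_or_dvd hd' with h1 | h1
    · exact not_isUnit_iff_dvd.2 h1 (isUnit_intCast hv)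
    · exact hz (hpr.dvd_of_dvd_pow h1)
  obtain ⟨y', hy'⟩ := hy.exists_right_inv
  refine ⟨x * y', z * y', ?_⟩
  rw [mul_pow, h]
  linear_combination (u : ℤ_[p]) * (y * y' + 1) * hy'

theorem isSquare_zmod_of_hilbert {u v : ℤ} (hv : ¬ (p : ℤ) ∣ v)
    (h : Hilbert ℚ_[p] u ((p * v : ℤ) : ℚ_[p])) : IsSquare (u : ZMod p) := by
  obtain ⟨x, z, h⟩ := exists_eq_add_mul_sq hv h
  refine ⟨PadicInt.toZMod x, ?_⟩
  have := congrArg PadicInt.toZMod h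
  simp only [map_pow, map_add, map_mul, map_natCast, map_intCast, CharP.cast_eq_zero] at this
  rw [← sq, this]; ring

/-- Hensel's lemma for squares of units at odd primes. -/
theorem isSquare_padicInt {w : ℤ_[p]} (hp2 : p ≠ 2) (hw : IsUnit w)
    (h : IsSquare (PadicInt.toZMod w)) : IsSquare w := by
  obtain ⟨s, hs⟩ := h
  obtain ⟨s, rfl⟩ : ∃ t : ℤ_[p], PadicInt.toZMod t = s := ⟨(s.val : ℤ_[p]), by simp⟩
  have hker : ∀ t : ℤ_[p], PadicInt.toZMod t = 0 ↔ ‖t‖ < 1 := fun t => by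
    rw [← RingHom.mem_ker, PadicInt.ker_toZMod, IsLocalRing.mem_maximalIdeal, PadicInt.mem_nonunits]
  have hun : ∀ t : ℤ_[p], PadicInt.toZMod t ≠ 0 → ‖t‖ = 1 := fun t ht => by
    rw [Ne, hker, not_lt] at ht
    exact le_antisymm (PadicInt.norm_le_one _) ht
  have hw0 : PadicInt.toZMod w ≠ 0 := (hw.map _).ne_zero
  have hs0 : PadicInt.toZMod s ≠ 0 := by
    intro h0; rw [h0] at hs; simp_all
  have h2 : (2 : ZMod p) ≠ 0 := by
    have : ((2 : ℕ) : ZMod p) ≠ 0 := by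
      rw [Ne, ZMod.natCast_eq_zero_iff, Nat.prime_dvd_prime_iff_eq hp.out Nat.prime_two]
      exact hp2
    exact_mod_cast this
  let F : Polynomial ℤ_[p] := Polynomial.X ^ 2 - Polynomial.C w
  have hd : ‖(F.derivative.aeval s : ℤ_[p])‖ = 1 := by
    apply hun
    simp only [F, Polynomial.derivative_sub, Polynomial.derivative_C, Polynomial.derivative_X_pow]
    simp [h2, hs0, map_ofNat]
  have hF : ‖(F.aeval s : ℤ_[p])‖ < 1 := by
    rw [← hker]
    simp [F, hs, sq]
  obtain ⟨z, hz, -⟩ := hensels_lemma (F := F) (a := s) (by rw [hd]; simpa using hF)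
  refine ⟨z, ?_⟩
  simp only [F, map_sub, map_pow, Polynomial.aeval_X, Polynomial.aeval_C] at hz
  simp only [Algebra.algebraMap_self, RingHom.id_apply] at hz
  linear_combination -hz

theorem isSquare_padic_intCast {u : ℤ} (hp2 : p ≠ 2) (hu : ¬ (p : ℤ) ∣ u)
    (h : IsSquare (u : ZMod p)) : IsSquare (u : ℚ_[p]) := by
  obtain ⟨s, hs⟩ := isSquare_padicInt hp2 (isUnit_intCast hu) (by simpa using h)
  exact ⟨s, by exact_mod_cast congrArg (Subtype.val) hs⟩

/-- The Hilbert symbol of two units at an odd prime is trivial. -/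
theorem hilbert_units {a b : ℤ} (hp2 : p ≠ 2) (ha : ¬ (p : ℤ) ∣ a) (hb : ¬ (p : ℤ) ∣ b) :
    Hilbert ℚ_[p] a b := by
  have ha0 : (a : ZMod p) ≠ 0 := by rwa [Ne, ZMod.intCast_zmod_eq_zero_iff_dvd]
  have hb0 : (b : ZMod p) ≠ 0 := by rwa [Ne, ZMod.intCast_zmod_eq_zero_iff_dvd]
  obtain ⟨x, y, hxy⟩ := FiniteField.exists_root_sum_quadratic
    (f := (Polynomial.X ^ 2 : Polynomial (ZMod p)))
    (g := Polynomial.C (-a : ZMod p) * Polynomial.X ^ 2 + Polynomial.C (0 : ZMod p) *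
      Polynomial.X + Polynomial.C (-b : ZMod p)) (by simp)
    (Polynomial.degree_quadratic (by simpa using ha0))
    (by rw [ZMod.card]; exact Nat.odd_iff.1 (hp.out.odd_of_ne_two hp2))
  simp at hxy
  have hpri : Prime (p : ℤ) := Nat.prime_iff_prime_int.1 hp.out
  by_cases hx : x = 0
  · have hsq : IsSquare ((-a * b : ℤ) : ZMod p) := ⟨a * y, by
      push_cast; subst hx; linear_combination (a : ZMod p) * hxy⟩
    obtain ⟨s, hs⟩ := isSquare_padic_intCast hp2 (fun h => by
      rcases hpri.dvd_or_dvd h with h | h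
      · exact ha ((dvd_neg).1 h)
      · exact hb h) hsq
    refine ⟨0, s, a, ?_, ?_⟩
    · right; right
      intro h
      apply ha
      rw [Int.cast_eq_zero] at h
      simp [h]
    · push_cast at hs
      linear_combination (a : ℚ_[p]) * hs
  · obtain ⟨y, rfl⟩ : ∃ t : ℤ_[p], PadicInt.toZMod t = y := ⟨(y.val : ℤ_[p]), by simp⟩
    have hsq : PadicInt.toZMod ((a : ℤ_[p]) * y ^ 2 + (b : ℤ_[p])) = x * x := by
      simp
      linear_combination -hxy
    have hun : IsUnit ((a : ℤ_[p]) * y ^ 2 + (b : ℤ_[p])) := by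
      by_contra hun
      have : ((a : ℤ_[p]) * y ^ 2 + (b : ℤ_[p])) ∈ RingHom.ker (PadicInt.toZMod (p := p)) := by
        rw [PadicInt.ker_toZMod, IsLocalRing.mem_maximalIdeal]; exact hun
      rw [RingHom.mem_ker, hsq] at this
      simp_all
    obtain ⟨s, hs⟩ := isSquare_padicInt hp2 hun ⟨x, hsq⟩
    refine ⟨s, y, 1, by simp, ?_⟩
    have := congrArg (Subtype.val) hs
    push_cast at this
    linear_combination -this

end Padic

/-- The quadratic character of `p`-adic units (modulo `8` if `p = 2`). -/
def unitChar (p : ℕ) (u : ℤ) : ℤ := if p = 2 then χ₈ u else jacobiSym u p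

/-- The Hilbert symbol of two `p`-adic units. -/
def unitSymbol (p : ℕ) (u v : ℤ) : ℤ :=
  if p = 2 ∧ (u : ZMod 4) = 3 ∧ (v : ZMod 4) = 3 then -1 else 1

/-- The Hilbert symbol of `p ^ α * u` and `p ^ β * v`. -/
def symbolAux (p α β : ℕ) (u v : ℤ) : ℤ :=
  unitSymbol p u v * unitChar p (-1) ^ (α * β) * unitChar p u ^ β * unitChar p v ^ α

/-- The prime-to-`p` part of an integer. -/
def unitPart (p : ℕ) (a : ℤ) : ℤ := a / (p : ℤ) ^ padicValInt p a

/-- The Hilbert symbol at `p`, by its explicit formula. -/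
def symbol (p : ℕ) (a b : ℤ) : ℤ :=
  symbolAux p (padicValInt p a) (padicValInt p b) (unitPart p a) (unitPart p b)

/-- The Hilbert symbol at the real place. -/
def realSymbol (a b : ℤ) : ℤ := if a < 0 ∧ b < 0 then -1 else 1

section Symbol

variable {p : ℕ} [hp : Fact p.Prime]

omit hp in
theorem eq_pow_mul_unitPart (a : ℤ) : a = (p : ℤ) ^ padicValInt p a * unitPart p a :=
  (Int.mul_ediv_cancel' (padicValInt_dvd a)).symm

theorem padicValInt_pow_mul {α : ℕ} {u : ℤ} (hu : ¬ (p : ℤ) ∣ u) :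
    padicValInt p ((p : ℤ) ^ α * u) = α := by
  have hp0 : (p : ℤ) ≠ 0 := by exact_mod_cast hp.out.ne_zero
  have hu0 : u ≠ 0 := by rintro rfl; exact hu (dvd_zero _)
  rw [padicValInt.mul (pow_ne_zero _ hp0) hu0, padicValInt.eq_zero_of_not_dvd hu, add_zero]
  rw [← Nat.cast_pow, padicValInt.of_nat, padicValNat.prime_pow]

theorem unitPart_pow_mul {α : ℕ} {u : ℤ} (hu : ¬ (p : ℤ) ∣ u) :
    unitPart p ((p : ℤ) ^ α * u) = u := by
  rw [unitPart, padicValInt_pow_mul hu]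
  exact Int.mul_ediv_cancel_left _ (pow_ne_zero _ (by exact_mod_cast hp.out.ne_zero))

theorem not_dvd_unitPart {a : ℤ} (ha : a ≠ 0) : ¬ (p : ℤ) ∣ unitPart p a := by
  intro h
  have := mul_dvd_mul_left ((p : ℤ) ^ padicValInt p a) h
  rw [← eq_pow_mul_unitPart, ← pow_succ, padicValInt_dvd_iff] at this
  rcases this with h | h
  · exact ha h
  · omega

theorem prime_int : Prime (p : ℤ) := Nat.prime_iff_prime_int.1 hp.out

theorem not_dvd_mul {u v : ℤ} (hu : ¬ (p : ℤ) ∣ u) (hv : ¬ (p : ℤ) ∣ v) : ¬ (p : ℤ) ∣ u * v :=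
  fun h => (prime_int.dvd_or_dvd h).elim hu hv

theorem unitPart_mul {a b : ℤ} (ha : a ≠ 0) (hb : b ≠ 0) :
    unitPart p (a * b) = unitPart p a * unitPart p b := by
  conv_lhs => rw [eq_pow_mul_unitPart (p := p) a, eq_pow_mul_unitPart (p := p) b]
  rw [mul_mul_mul_comm, ← pow_add]
  exact unitPart_pow_mul (not_dvd_mul (not_dvd_unitPart ha) (not_dvd_unitPart hb))

omit hp in
theorem unitChar_mul (u v : ℤ) : unitChar p (u * v) = unitChar p u * unitChar p v := by
  unfold unitChar
  split_ifs
  · push_cast; rw [map_mul]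
  · exact jacobiSym.mul_left _ _ _

theorem zmod_eight_cast {u : ℤ} (hu : ¬ (2 : ℤ) ∣ u) :
    (u : ZMod 8) = 1 ∨ (u : ZMod 8) = 3 ∨ (u : ZMod 8) = 5 ∨ (u : ZMod 8) = 7 := by
  have h : u % 8 = 1 ∨ u % 8 = 3 ∨ u % 8 = 5 ∨ u % 8 = 7 := by omega
  rw [← ZMod.intCast_mod u 8]
  rcases h with h | h | h | h <;> simp [h]

theorem zmod_four_cast {u : ℤ} (hu : ¬ (2 : ℤ) ∣ u) : (u : ZMod 4) = 1 ∨ (u : ZMod 4) = 3 := by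
  have h : u % 4 = 1 ∨ u % 4 = 3 := by omega
  rw [← ZMod.intCast_mod u 4]
  rcases h with h | h <;> simp [h]

theorem unitChar_sq {u : ℤ} (hu : ¬ (p : ℤ) ∣ u) : unitChar p u ^ 2 = 1 := by
  unfold unitChar
  split_ifs with h
  · subst h
    rcases zmod_eight_cast hu with h | h | h | h <;> rw [h] <;> decide
  · apply jacobiSym.sq_one
    rw [← Int.isCoprime_iff_gcd_eq_one]
    exact ((Prime.coprime_iff_not_dvd prime_int).2 hu).symm

omit hp in
theorem unitSymbol_symm (u v : ℤ) : unitSymbol p u v = unitSymbol p v u := by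
  unfold unitSymbol
  congr 1
  simp only [eq_iff_iff]; tauto

theorem unitSymbol_mul {u v w : ℤ} (hv : ¬ (p : ℤ) ∣ v) (hw : ¬ (p : ℤ) ∣ w) :
    unitSymbol p u (v * w) = unitSymbol p u v * unitSymbol p u w := by
  by_cases h : p = 2
  · subst h
    unfold unitSymbol
    push_cast
    rcases zmod_four_cast hv with h1 | h1 <;> rcases zmod_four_cast hw with h2 | h2 <;>
      rw [h1, h2] <;> by_cases h3 : (u : ZMod 4) = 3 <;> simp only [h3] <;> decide
  · simp [unitSymbol, h]

theorem unitSymbol_neg_mul {u v : ℤ} (hu : ¬ (p : ℤ) ∣ u) (hv : ¬ (p : ℤ) ∣ v) :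
    unitSymbol p (-u * v) u = unitSymbol p u v := by
  by_cases h : p = 2
  · subst h
    unfold unitSymbol
    push_cast
    rcases zmod_four_cast hu with h1 | h1 <;> rcases zmod_four_cast hv with h2 | h2 <;>
      rw [h1, h2] <;> decide
  · simp [unitSymbol, h]

theorem not_dvd_neg_one : ¬ (p : ℤ) ∣ -1 := by
  rw [dvd_neg]
  exact prime_int.not_dvd_one

theorem not_dvd_one : ¬ (p : ℤ) ∣ 1 := prime_int.not_dvd_one

theorem symbol_mul {a b c : ℤ} (hb : b ≠ 0) (hc : c ≠ 0) :
    symbol p a (b * c) = symbol p a b * symbol p a c := by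
  unfold symbol symbolAux
  rw [unitPart_mul hb hc, padicValInt.mul hb hc,
    unitSymbol_mul (not_dvd_unitPart hb) (not_dvd_unitPart hc), unitChar_mul]
  ring

omit hp in
theorem symbol_symm (a b : ℤ) : symbol p a b = symbol p b a := by
  unfold symbol symbolAux
  rw [unitSymbol_symm]
  ring

theorem symbol_pow_mul {α β : ℕ} {u v : ℤ} (hu : ¬ (p : ℤ) ∣ u) (hv : ¬ (p : ℤ) ∣ v) :
    symbol p ((p : ℤ) ^ α * u) ((p : ℤ) ^ β * v) = symbolAux p α β u v := by
  rw [symbol, padicValInt_pow_mul hu, padicValInt_pow_mul hv, unitPart_pow_mul hu,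
    unitPart_pow_mul hv]

theorem symbol_units {u v : ℤ} (hu : ¬ (p : ℤ) ∣ u) (hv : ¬ (p : ℤ) ∣ v) :
    symbol p u v = unitSymbol p u v := by
  have := symbol_pow_mul (α := 0) (β := 0) hu hv
  simpa [symbolAux] using this

theorem symbol_units_of_ne_two {u v : ℤ} (h2 : p ≠ 2) (hu : ¬ (p : ℤ) ∣ u)
    (hv : ¬ (p : ℤ) ∣ v) : symbol p u v = 1 := by
  rw [symbol_units hu hv]
  simp [unitSymbol, h2]

theorem symbol_prime {u v : ℤ} (hu : ¬ (p : ℤ) ∣ u) (hv : ¬ (p : ℤ) ∣ v) :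
    symbol p u (p * v) = unitSymbol p u v * unitChar p u := by
  have := symbol_pow_mul (α := 0) (β := 1) hu hv
  simpa [symbolAux] using this

theorem unitSymbol_eq_one_of_hilbert {u v : ℤ} (h : Hilbert ℚ_[p] u v) :
    unitSymbol p u v = 1 := by
  by_cases h2 : p = 2
  · subst h2
    obtain ⟨x, y, z, h0, h⟩ := exists_primitive_solution h
    let f : ℤ_[2] →+* ZMod 4 := PadicInt.toZModPow 2
    have h' := congrArg f h
    have h0' : IsUnit (f x) ∨ IsUnit (f y) ∨ IsUnit (f z) :=
      h0.imp (·.map f) (.imp (·.map f) (·.map f))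
    simp only [map_pow, map_add, map_mul, map_intCast] at h'
    unfold unitSymbol
    split_ifs with h3
    · exfalso
      rw [h3.2.1, h3.2.2] at h'
      generalize f x = X at h0' h'
      generalize f y = Y at h0' h'
      generalize f z = Z at h0' h'
      clear h0 h h3 f
      revert X Y Z
      decide
    · rfl
  · simp [unitSymbol, h2]

theorem unitSymbol_mul_unitChar_eq_one {u v : ℤ} (hu : ¬ (p : ℤ) ∣ u) (hv : ¬ (p : ℤ) ∣ v)
    (h : Hilbert ℚ_[p] u ((p * v : ℤ) : ℚ_[p])) : unitSymbol p u v * unitChar p u = 1 := by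
  by_cases h2 : p = 2
  · subst h2
    obtain ⟨x, z, h⟩ := exists_eq_add_mul_sq hv h
    let f : ℤ_[2] →+* ZMod 8 := PadicInt.toZModPow 3
    have h' := congrArg f h
    simp only [map_pow, map_add, map_mul, map_intCast, map_natCast] at h'
    have e : ∀ w : ℤ, (w : ZMod 4) = ZMod.castHom (show 4 ∣ 8 by norm_num) (ZMod 4) (w : ZMod 8) :=
      fun w => by simp
    unfold unitSymbol unitChar
    rw [e, e]
    simp only [true_and, if_true]
    generalize f x = X at h'
    generalize f z = Z at h'
    rcases zmod_eight_cast hu with h1 | h1 | h1 | h1 <;>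
      rcases zmod_eight_cast hv with h3 | h3 | h3 | h3 <;> rw [h1, h3] at h' ⊢ <;>
      clear * - h' <;> revert X Z <;> decide
  · have hs := isSquare_zmod_of_hilbert hv h
    have hu0 : (u : ZMod p) ≠ 0 := by rwa [Ne, ZMod.intCast_zmod_eq_zero_iff_dvd]
    simp only [unitSymbol, unitChar, h2, false_and, if_false, one_mul]
    rw [← jacobiSym.legendreSym.to_jacobiSym, legendreSym.eq_one_iff p hu0]
    exact hs

theorem symbolAux_add_two_mul {α β k l : ℕ} {u v : ℤ} (hu : ¬ (p : ℤ) ∣ u)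
    (hv : ¬ (p : ℤ) ∣ v) : symbolAux p (α + 2 * k) (β + 2 * l) u v = symbolAux p α β u v := by
  have e : ∀ {w : ℤ} (_ : ¬ (p : ℤ) ∣ w) (m n : ℕ), unitChar p w ^ (m + 2 * n) = unitChar p w ^ m :=
    fun hw m n => by rw [pow_add, pow_mul, unitChar_sq hw, one_pow, mul_one]
  unfold symbolAux
  rw [e hu, e hv, show (α + 2 * k) * (β + 2 * l) = α * β + 2 * (α * l + k * β + 2 * k * l) by ring,
    e not_dvd_neg_one]

theorem symbol_eq_one_of_hilbert {a b : ℤ} (ha : a ≠ 0) (hb : b ≠ 0)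
    (h : Hilbert ℚ_[p] a b) : symbol p a b = 1 := by
  have hp0 : (p : ℚ_[p]) ≠ 0 := by exact_mod_cast hp.out.ne_zero
  have hu := not_dvd_unitPart (p := p) ha
  have hv := not_dvd_unitPart (p := p) hb
  have ha' := eq_pow_mul_unitPart (p := p) a
  have hb' := eq_pow_mul_unitPart (p := p) b
  unfold symbol
  generalize unitPart p a = u at *
  generalize unitPart p b = v at *
  generalize padicValInt p a = α at *
  generalize padicValInt p b = β at *
  subst ha' hb'
  rw [← Nat.mod_add_div α 2, ← Nat.mod_add_div β 2, symbolAux_add_two_mul hu hv]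
  have h' : Hilbert ℚ_[p] (((p : ℤ) ^ (α % 2) * u : ℤ) : ℚ_[p])
      (((p : ℤ) ^ (β % 2) * v : ℤ) : ℚ_[p]) := by
    refine (Hilbert.of_mul_sq (pow_ne_zero (α / 2) hp0) (Hilbert.symm
      (Hilbert.of_mul_sq (pow_ne_zero (β / 2) hp0) ?_))).symm
    convert h using 1
    · conv_rhs => rw [← Nat.mod_add_div α 2]
      push_cast; ring
    · conv_rhs => rw [← Nat.mod_add_div β 2]
      push_cast; ring
  clear h
  rcases Nat.mod_two_eq_zero_or_one α with h1 | h1 <;>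
    rcases Nat.mod_two_eq_zero_or_one β with h2 | h2 <;>
    simp only [h1, h2, pow_zero, one_mul, pow_one] at h' ⊢
  · simpa [symbolAux] using unitSymbol_eq_one_of_hilbert h'
  · simpa [symbolAux] using unitSymbol_mul_unitChar_eq_one hu hv h'
  · simpa [symbolAux, unitSymbol_symm] using unitSymbol_mul_unitChar_eq_one hv hu h'.symm
  · have hpu : ((p * u : ℤ) : ℚ_[p]) ≠ 0 := by
      have : u ≠ 0 := by rintro rfl; exact hu (dvd_zero _)
      push_cast; exact mul_ne_zero hp0 (by exact_mod_cast this)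
    have h3 := h'.neg_mul hpu
    have h4 : Hilbert ℚ_[p] ((-u * v : ℤ) : ℚ_[p]) ((p * u : ℤ) : ℚ_[p]) := by
      refine (Hilbert.of_mul_sq hp0 ?_).symm
      convert h3 using 1
      push_cast; ring
    have hn : ¬ (p : ℤ) ∣ -u * v := not_dvd_mul (by rwa [dvd_neg]) hv
    have h5 := unitSymbol_mul_unitChar_eq_one hn hu h4
    rw [unitSymbol_neg_mul hu hv, neg_mul, ← neg_one_mul, unitChar_mul, unitChar_mul] at h5
    rw [← h5]
    simp [symbolAux]
    ring

end Symbol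

theorem realSymbol_eq_one_of_hilbert {a b : ℤ} (h : Hilbert ℝ a b) : realSymbol a b = 1 := by
  unfold realSymbol
  split_ifs with hab
  · exfalso
    obtain ⟨x, y, z, h0, h⟩ := h
    have ha : (a : ℝ) < 0 := by exact_mod_cast hab.1
    have hb : (b : ℝ) < 0 := by exact_mod_cast hab.2
    have hx : x ^ 2 = 0 := by nlinarith [sq_nonneg x, sq_nonneg y, sq_nonneg z]
    have hy : y ^ 2 = 0 := by nlinarith [sq_nonneg x, sq_nonneg y, sq_nonneg z]
    have hz : z ^ 2 = 0 := by nlinarith [sq_nonneg x, sq_nonneg y, sq_nonneg z]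
    simp_all
  · rfl

theorem realSymbol_symm (a b : ℤ) : realSymbol a b = realSymbol b a := by
  simp [realSymbol, and_comm]

theorem realSymbol_mul {a b c : ℤ} (hb : b ≠ 0) (hc : c ≠ 0) :
    realSymbol a (b * c) = realSymbol a b * realSymbol a c := by
  unfold realSymbol
  rcases hb.lt_or_gt with hb | hb <;> rcases hc.lt_or_gt with hc | hc <;>
    by_cases ha : a < 0 <;>
    simp [ha, mul_neg_iff, hb, hc, hb.le, hc.le, not_lt.2]

/-- The product of the Hilbert symbols at the real place, at `2` and at the primes of `S`. -/
def prodSymbol (S : Finset ℕ) (a b : ℤ) : ℤ :=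
  realSymbol a b * symbol 2 a b * ∏ p ∈ S, symbol p a b

section ProductFormula

variable {S : Finset ℕ}

theorem prodSymbol_symm (a b : ℤ) : prodSymbol S a b = prodSymbol S b a := by
  simp only [prodSymbol, realSymbol_symm a b, symbol_symm a b]

theorem prodSymbol_mul (hS : ∀ p ∈ S, p.Prime ∧ p ≠ 2) {a b c : ℤ} (hb : b ≠ 0) (hc : c ≠ 0) :
    prodSymbol S a (b * c) = prodSymbol S a b * prodSymbol S a c := by
  have := Finset.prod_congr rfl fun p hp => by
    have := Fact.mk (hS p hp).1
    exact symbol_mul (p := p) (a := a) hb hc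
  simp only [prodSymbol]
  rw [this, Finset.prod_mul_distrib, realSymbol_mul hb hc, symbol_mul hb hc]
  ring

/-- Induction on nonzero integers whose prime factors lie in a given set. -/
theorem int_induction {T : ℕ → Prop} {P : ℤ → Prop} (hneg : P (-1))
    (hprime : ∀ p : ℕ, p.Prime → T p → P p)
    (hmul : ∀ a b : ℤ, a ≠ 0 → b ≠ 0 → P a → P b → P (a * b)) {a : ℤ} (ha : a ≠ 0)
    (hT : ∀ p : ℕ, p.Prime → (p : ℤ) ∣ a → T p) : P a := by
  have h1 : P 1 := by simpa using hmul (-1) (-1) (by simp) (by simp) hneg hneg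
  have hnat : ∀ n : ℕ, n ≠ 0 → (∀ p : ℕ, p.Prime → p ∣ n → T p) → P n := by
    intro n
    induction n using induction_on_primes with
    | zero => simp
    | one => intro _ _; exact_mod_cast h1
    | prime_mul p n hp ih =>
      intro h0 hT
      push_cast
      have hn : n ≠ 0 := by rintro rfl; simp at h0
      exact hmul _ _ (by exact_mod_cast hp.ne_zero) (by exact_mod_cast hn)
        (hprime p hp (hT p hp (dvd_mul_right _ _)))
        (ih hn fun q hq hqn => hT q hq (Dvd.dvd.mul_left hqn _))
  have h2 := hnat a.natAbs (by simpa using ha) fun p hp hpa =>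
    hT p hp (Int.natCast_dvd.2 hpa)
  rcases Int.natAbs_eq a with h | h
  · rwa [h]
  · rw [h, ← neg_one_mul]
    exact hmul _ _ (by simp) (by simpa using ha) hneg h2

theorem not_dvd_prime {p q : ℕ} (hp : p.Prime) (hq : q.Prime) (h : p ≠ q) : ¬ (p : ℤ) ∣ q := by
  rw [Int.natCast_dvd_natCast, Nat.prime_dvd_prime_iff_eq hp hq]
  exact h

theorem odd_not_two_dvd {p : ℕ} (hp : p.Prime) (h : p ≠ 2) : ¬ ((2 : ℕ) : ℤ) ∣ p :=
  not_dvd_prime Nat.prime_two hp h.symm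

theorem two_unitSymbol_eq_one (u v : ℤ) (h : (u : ZMod 4) ≠ 3) : unitSymbol 2 u v = 1 := by
  simp [unitSymbol, h]

theorem unitSymbol_neg_one {p : ℕ} (hp : Odd p) (u : ℤ) (hu : (u : ZMod 4) = 3) :
    unitSymbol 2 u p = χ₄ p := by
  have : (p : ZMod 4) = 1 ∨ (p : ZMod 4) = 3 := by
    have := zmod_four_cast (u := p) (by
      rw [← even_iff_two_dvd, Int.not_even_iff_odd]; exact_mod_cast hp)
    exact_mod_cast this
  rcases this with h | h
  · simp [unitSymbol, h, hu]; decide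
  · simp [unitSymbol, h, hu]

theorem symbol_prime_one {p : ℕ} [hp : Fact p.Prime] {u : ℤ} (hu : ¬ (p : ℤ) ∣ u) :
    symbol p u p = unitChar p u := by
  have := symbol_prime hu (not_dvd_one (p := p))
  rw [mul_one] at this
  rw [this]
  have h1 : unitSymbol p u 1 = 1 := by
    rw [unitSymbol, if_neg]
    push_cast
    rintro ⟨-, -, h⟩
    revert h; decide
  rw [h1, one_mul]

theorem prodSymbol_neg_one (hS : ∀ p ∈ S, p.Prime ∧ p ≠ 2) {p : ℕ} (hp : p.Prime)
    (hpS : p = 2 ∨ p ∈ S) : prodSymbol S (-1) p = 1 := by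
  have := Fact.mk hp
  have hr : realSymbol (-1) p = 1 := by simp [realSymbol]
  rw [prodSymbol, hr, one_mul]
  have hother : ∀ q ∈ S, q ≠ p → symbol q (-1) p = 1 := fun q hq hqp => by
    have := Fact.mk (hS q hq).1
    exact symbol_units_of_ne_two (hS q hq).2 not_dvd_neg_one (not_dvd_prime (hS q hq).1 hp hqp)
  rcases eq_or_ne p 2 with rfl | h2
  · rw [Finset.prod_eq_one fun q hq => hother q hq (hS q hq).2, symbol_prime_one not_dvd_neg_one]
    decide
  · have hpS := hpS.resolve_left h2
    have hodd := hp.odd_of_ne_two h2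
    rw [Finset.prod_eq_single_of_mem p hpS hother, symbol_prime_one not_dvd_neg_one,
      symbol_units not_dvd_neg_one (odd_not_two_dvd hp h2),
      unitSymbol_neg_one hodd _ (by decide), unitChar, if_neg h2, jacobiSym.at_neg_one hodd]
    have : jacobiSym (-1) p ^ 2 = 1 := jacobiSym.sq_one (by simp)
    rwa [jacobiSym.at_neg_one hodd, sq] at this

theorem prodSymbol_two (hS : ∀ p ∈ S, p.Prime ∧ p ≠ 2) {p : ℕ} (hp : p.Prime) (h2 : p ≠ 2)
    (hpS : p ∈ S) : prodSymbol S p 2 = 1 := by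
  have := Fact.mk hp
  have hr : realSymbol p 2 = 1 := by simp [realSymbol]
  have hodd := hp.odd_of_ne_two h2
  have hd : ¬ (p : ℤ) ∣ (2 : ℕ) := not_dvd_prime hp Nat.prime_two h2
  have hother : ∀ q ∈ S, q ≠ p → symbol q p (2 : ℕ) = 1 := fun q hq hqp => by
    have := Fact.mk (hS q hq).1
    exact symbol_units_of_ne_two (hS q hq).2 (not_dvd_prime (hS q hq).1 hp hqp)
      (not_dvd_prime (hS q hq).1 Nat.prime_two (hS q hq).2)
  change prodSymbol S p (2 : ℕ) = 1
  rw [prodSymbol, Nat.cast_two, hr, one_mul, ← Nat.cast_two (R := ℤ),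
    Finset.prod_eq_single_of_mem p hpS hother,
    symbol_prime_one (odd_not_two_dvd hp h2), symbol_symm, symbol_prime_one hd, unitChar,
    if_pos rfl, unitChar, if_neg h2, Nat.cast_two, jacobiSym.at_two hodd, Int.cast_natCast]
  have : jacobiSym 2 p ^ 2 = 1 := jacobiSym.sq_one (by
    rw [← Int.isCoprime_iff_gcd_eq_one]
    exact ((Prime.coprime_iff_not_dvd prime_int).2 hd).symm)
  rwa [jacobiSym.at_two hodd, sq] at this

theorem prodSymbol_self (hS : ∀ p ∈ S, p.Prime ∧ p ≠ 2) {p : ℕ} (hp : p.Prime)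
    (hpS : p = 2 ∨ p ∈ S) : prodSymbol S p p = 1 := by
  have := Fact.mk hp
  have hp0 : (p : ℤ) ≠ 0 := by exact_mod_cast hp.ne_zero
  have h : prodSymbol S p p = prodSymbol S (-1) p * prodSymbol S p p := by
    rw [prodSymbol_neg_one hS hp hpS, one_mul]
  have hr : realSymbol p p = 1 := by simp [realSymbol]
  have hself : symbol p p p = unitChar p (-1) := by
    have := symbol_pow_mul (p := p) (α := 1) (β := 1) not_dvd_one not_dvd_one
    simp only [pow_one, mul_one] at this
    rw [this, symbolAux]
    have h1 : unitChar p 1 = 1 := by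
      unfold unitChar; split_ifs <;> simp
    have h3 : unitSymbol p 1 1 = 1 := by
      rw [unitSymbol, if_neg]
      rintro ⟨-, h, -⟩
      revert h; decide
    simp [h1, h3]
  have hother : ∀ q ∈ S, q ≠ p → symbol q p p = 1 := fun q hq hqp => by
    have := Fact.mk (hS q hq).1
    exact symbol_units_of_ne_two (hS q hq).2 (not_dvd_prime (hS q hq).1 hp hqp)
      (not_dvd_prime (hS q hq).1 hp hqp)
  rw [prodSymbol, hr, one_mul]
  rcases eq_or_ne p 2 with rfl | h2
  · rw [Finset.prod_eq_one fun q hq => hother q hq (hS q hq).2, hself]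
    decide
  · have hpS := hpS.resolve_left h2
    have hodd := hp.odd_of_ne_two h2
    have hn := odd_not_two_dvd hp h2
    have h4 : unitSymbol 2 p p = χ₄ p := by
      rcases zmod_four_cast hn with h | h
      · rw [two_unitSymbol_eq_one _ _ (by rw [h]; decide)]
        rw [Int.cast_natCast] at h
        rw [h]; decide
      · exact unitSymbol_neg_one hodd _ h
    rw [Finset.prod_eq_single_of_mem p hpS hother, hself, symbol_units hn hn, h4, unitChar,
      if_neg h2, jacobiSym.at_neg_one hodd]
    have : jacobiSym (-1) p ^ 2 = 1 := jacobiSym.sq_one (by simp)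
    rwa [jacobiSym.at_neg_one hodd, sq] at this

theorem prodSymbol_primes (hS : ∀ p ∈ S, p.Prime ∧ p ≠ 2) {p q : ℕ} (hp : p ∈ S) (hq : q ∈ S)
    (hpq : p ≠ q) : prodSymbol S p q = 1 := by
  obtain ⟨hp', hp2⟩ := hS p hp
  obtain ⟨hq', hq2⟩ := hS q hq
  have := Fact.mk hp'
  have := Fact.mk hq'
  have hr : realSymbol p q = 1 := by simp [realSymbol]
  have hother : ∀ r ∈ S, r ≠ p ∧ r ≠ q → symbol r p q = 1 := fun r hr hrpq => by
    have := Fact.mk (hS r hr).1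
    exact symbol_units_of_ne_two (hS r hr).2 (not_dvd_prime (hS r hr).1 hp' hrpq.1)
      (not_dvd_prime (hS r hr).1 hq' hrpq.2)
  have hs : symbol p (p : ℤ) q = unitChar p q := by
    rw [symbol_symm, symbol_prime_one (not_dvd_prime hp' hq' hpq)]
  rw [prodSymbol, hr, one_mul, Finset.prod_eq_mul_of_mem p q hp hq hpq hother, hs,
    symbol_prime_one (not_dvd_prime hq' hp' hpq.symm),
    symbol_units (odd_not_two_dvd hp' hp2) (odd_not_two_dvd hq' hq2), unitChar, if_neg hp2,
    unitChar, if_neg hq2]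
  have hop := hp'.odd_of_ne_two hp2
  have hoq := hq'.odd_of_ne_two hq2
  have hsq : jacobiSym q p ^ 2 = 1 := jacobiSym.sq_one (by
    rw [← Int.isCoprime_iff_gcd_eq_one]
    exact ((Prime.coprime_iff_not_dvd prime_int).2 (not_dvd_prime hp' hq' hpq)).symm)
  have hrec := jacobiSym.quadratic_reciprocity_if (a := p) (b := q) (Nat.odd_iff.1 hop)
    (Nat.odd_iff.1 hoq)
  have hsym : unitSymbol 2 p q = if p % 4 = 3 ∧ q % 4 = 3 then -1 else 1 := by
    have e : ∀ n : ℕ, ((n : ℤ) : ZMod 4) = 3 ↔ n % 4 = 3 := fun n => by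
      rw [Int.cast_natCast]
      exact ZMod.natCast_eq_natCast_iff' n 3 4
    simp only [unitSymbol, e, true_and]
  rw [hsym, ← hrec]
  split_ifs
  · linear_combination hsq
  · linear_combination hsq

/-- **Hilbert's product formula**. -/
theorem prodSymbol_eq_one (hS : ∀ p ∈ S, p.Prime ∧ p ≠ 2) {a b : ℤ} (ha : a ≠ 0) (hb : b ≠ 0)
    (haS : ∀ p : ℕ, p.Prime → (p : ℤ) ∣ a → p = 2 ∨ p ∈ S)
    (hbS : ∀ p : ℕ, p.Prime → (p : ℤ) ∣ b → p = 2 ∨ p ∈ S) : prodSymbol S a b = 1 := by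
  have hmul : ∀ c : ℤ, ∀ a b : ℤ, a ≠ 0 → b ≠ 0 → prodSymbol S c a = 1 → prodSymbol S c b = 1 →
      prodSymbol S c (a * b) = 1 := fun c a b ha hb h1 h2 => by
    rw [prodSymbol_mul hS ha hb, h1, h2, one_mul]
  refine int_induction (P := fun b => prodSymbol S a b = 1) ?_ ?_ (hmul a) hb hbS
  · rw [prodSymbol_symm]
    refine int_induction (P := fun a => prodSymbol S (-1) a = 1) ?_
      (fun p hp h => prodSymbol_neg_one hS hp h) (hmul _) ha haS
    rw [prodSymbol, Finset.prod_eq_one fun q hq => by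
      have := Fact.mk (hS q hq).1
      exact symbol_units_of_ne_two (hS q hq).2 not_dvd_neg_one not_dvd_neg_one,
      symbol_units not_dvd_neg_one not_dvd_neg_one]
    decide
  · intro p hp hpS
    rw [prodSymbol_symm]
    refine int_induction (P := fun a => prodSymbol S p a = 1) ?_ ?_ (hmul _) ha haS
    · rw [prodSymbol_symm]
      exact prodSymbol_neg_one hS hp hpS
    · intro q hq hqS
      by_cases hpq : p = q
      · subst hpq
        exact prodSymbol_self hS hp hpS
      · rcases hpS with rfl | hpS
        · rw [prodSymbol_symm]
          exact prodSymbol_two hS hq (Ne.symm hpq) (hqS.resolve_left (Ne.symm hpq))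
        · rcases hqS with rfl | hqS
          · exact prodSymbol_two hS hp hpq hpS
          · exact prodSymbol_primes hS hpS hqS hpq

end ProductFormula

/-- If a conic has points at the real place and at all primes but `q`, an odd prime dividing `b`
exactly once and not dividing `a`, then it has points at `q`. -/
theorem hilbert_of_forall_ne {a b : ℤ} {q : ℕ} [hq : Fact q.Prime] (hq2 : q ≠ 2) (ha : a ≠ 0)
    (hqa : ¬ (q : ℤ) ∣ a) (hqb : ¬ (q : ℤ) ∣ b)
    (hreal : Hilbert ℝ a ((q * b : ℤ) : ℝ))
    (h : ∀ (p : ℕ) [Fact p.Prime], p ≠ q → Hilbert ℚ_[p] a ((q * b : ℤ) : ℚ_[p])) :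
    Hilbert ℚ_[q] a ((q * b : ℤ) : ℚ_[q]) := by
  have hb : b ≠ 0 := by rintro rfl; exact hqb (dvd_zero _)
  have hb' : (q * b : ℤ) ≠ 0 := mul_ne_zero (by exact_mod_cast hq.out.ne_zero) hb
  let S : Finset ℕ := (a * (q * b)).natAbs.primeFactors.erase 2
  have hS : ∀ p ∈ S, p.Prime ∧ p ≠ 2 := fun p hp => by
    simp only [S, Finset.mem_erase, Nat.mem_primeFactors] at hp
    exact ⟨hp.2.1, hp.1⟩
  have hmem : ∀ p : ℕ, p.Prime → (p : ℤ) ∣ a * (q * b) → p = 2 ∨ p ∈ S := fun p hp hpa => by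
    simp only [S, Finset.mem_erase, Nat.mem_primeFactors]
    by_cases h2 : p = 2
    · exact .inl h2
    · exact .inr ⟨h2, hp, Int.natCast_dvd.1 hpa, by simpa using ⟨ha, hq.out.ne_zero, hb⟩⟩
  have hprod := prodSymbol_eq_one hS ha hb' (fun p hp hpa => hmem p hp (Dvd.dvd.mul_right hpa _))
    (fun p hp hpa => hmem p hp (Dvd.dvd.mul_left hpa _))
  have hqS : q ∈ S := (hmem q hq.out (Dvd.dvd.mul_left (dvd_mul_right _ _) _)).resolve_left hq2
  rw [prodSymbol, realSymbol_eq_one_of_hilbert hreal, symbol_eq_one_of_hilbert ha hb' (h 2 hq2.symm),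
    one_mul, one_mul, Finset.prod_eq_single_of_mem q hqS fun p hp hpq => by
      have := Fact.mk (hS p hp).1
      exact symbol_eq_one_of_hilbert ha hb' (h p hpq), symbol_prime hqa hqb] at hprod
  simp only [unitSymbol, hq2, false_and, if_false, one_mul, unitChar] at hprod
  exact .of_isSquare (isSquare_padic_intCast hq2 hqa (ZMod.isSquare_of_jacobiSym_eq_one hprod))

theorem exists_dvd_sq_sub {a : ℤ} {n : ℕ} (hn : Squarefree n)
    (h : ∀ p : ℕ, p.Prime → p ∣ n → IsSquare (a : ZMod p)) : ∃ t : ℤ, (n : ℤ) ∣ t ^ 2 - a := by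
  induction n using induction_on_primes with
  | zero => simp at hn
  | one => exact ⟨0, by simp⟩
  | prime_mul p n hp ih =>
    obtain ⟨t, ht⟩ := ih (hn.of_mul_right) fun q hq hqn => h q hq (Dvd.dvd.mul_left hqn _)
    obtain ⟨s, hs⟩ := h p hp (dvd_mul_right _ _)
    obtain ⟨s, rfl⟩ := ZMod.intCast_surjective s
    have hs' : (p : ℤ) ∣ s ^ 2 - a := by
      rw [← ZMod.intCast_zmod_eq_zero_iff_dvd]
      push_cast
      rw [hs]; ring
    have hco : IsCoprime (p : ℤ) n := Nat.isCoprime_iff_coprime.2 (Nat.squarefree_mul_iff.1 hn).1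
    obtain ⟨u, v, huv⟩ := hco
    refine ⟨t * (u * p) + s * (v * n), ?_⟩
    push_cast
    refine IsCoprime.mul_dvd ⟨u, v, huv⟩ ?_ ?_
    · have : (t * (u * p) + s * (v * n)) ^ 2 - a =
        p * (u * (t - s) * (t * (u * p) + s * (v * n) + s)) + (s ^ 2 - a) := by
        linear_combination (s * (t * (u * p) + s * (v * n) + s)) * huv
      rw [this]
      exact dvd_add (dvd_mul_right _ _) hs'
    · have : (t * (u * p) + s * (v * n)) ^ 2 - a =
        n * (v * (s - t) * (t * (u * p) + s * (v * n) + t)) + (t ^ 2 - a) := by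
        linear_combination (t * (t * (u * p) + s * (v * n) + t)) * huv
      rw [this]
      exact dvd_add (dvd_mul_right _ _) ht

theorem exists_small_root {a b : ℤ} (hb : b ≠ 0) {t : ℤ} (ht : b ∣ t ^ 2 - a) :
    ∃ s : ℤ, b ∣ s ^ 2 - a ∧ 2 * |s| ≤ |b| := by
  have hb' : 0 < b.natAbs := by omega
  refine ⟨Int.bmod t b.natAbs, ?_, ?_⟩
  · have h1 : b ∣ Int.bmod t b.natAbs - t := by
      have := Int.ModEq.dvd (Int.bmod_emod (x := t) (m := b.natAbs)).symm
      exact Int.natAbs_dvd.1 this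
    have : Int.bmod t b.natAbs ^ 2 - a =
      (Int.bmod t b.natAbs - t) * (Int.bmod t b.natAbs + t) + (t ^ 2 - a) := by ring
    rw [this]
    exact dvd_add (Dvd.dvd.mul_right h1 _) ht
  · have h1 := Int.le_bmod (x := t) hb'
    have h2 := Int.bmod_lt (x := t) hb'
    rw [Int.abs_eq_natAbs b]
    rcases abs_cases (Int.bmod t b.natAbs) with h | h <;> omega

/-- The Hasse principle for the conic `x² = a y² + b z²`. -/
theorem hilbert_rat {a b : ℤ} (ha : a ≠ 0) (hb : b ≠ 0)
    (h : ∀ (p : ℕ) [Fact p.Prime], Hilbert ℚ_[p] a b) (hreal : Hilbert ℝ a b) :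
    Hilbert ℚ a b := by
  obtain ⟨N, hN⟩ : ∃ N, a.natAbs + b.natAbs = N := ⟨_, rfl⟩
  induction N using Nat.strong_induction_on generalizing a b with
  | _ N ih =>
    wlog hab : a.natAbs ≤ b.natAbs generalizing a b
    · exact (this hb ha (fun p _ => (h p).symm) hreal.symm (by omega) (by omega)).symm
    by_cases hsq : Squarefree b
    · by_cases hb1 : b.natAbs = 1
      · have ha1 : a.natAbs = 1 := by omega
        rcases Int.natAbs_eq_iff.1 ha1 with rfl | rfl
        · exact .of_isSquare (by simp)
        rcases Int.natAbs_eq_iff.1 hb1 with rfl | rfl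
        · exact (Hilbert.of_isSquare (by simp)).symm
        obtain ⟨x, y, z, h0, hxyz⟩ := hreal
        push_cast at hxyz
        exfalso
        have hx : x ^ 2 = 0 := by nlinarith [sq_nonneg x, sq_nonneg y, sq_nonneg z]
        have hy : y ^ 2 = 0 := by nlinarith [sq_nonneg x, sq_nonneg y, sq_nonneg z]
        have hz : z ^ 2 = 0 := by nlinarith [sq_nonneg x, sq_nonneg y, sq_nonneg z]
        simp_all
      · obtain ⟨t, ht⟩ : ∃ t : ℤ, (b.natAbs : ℤ) ∣ t ^ 2 - a := by
          refine exists_dvd_sq_sub (Int.squarefree_natAbs.2 hsq) fun p hp hpb => ?_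
          have := Fact.mk hp
          obtain ⟨v, hv⟩ := Int.natCast_dvd.2 hpb
          refine isSquare_zmod_of_hilbert (v := v) ?_ (hv ▸ h p)
          rintro ⟨w, rfl⟩
          have := hsq p ⟨w, by rw [hv]; ring⟩
          exact (Nat.prime_iff_prime_int.1 hp).not_isUnit this
        obtain ⟨t, ⟨c, hc⟩, htb⟩ := exists_small_root hb (Int.natAbs_dvd.1 ht)
        by_cases hc0 : c = 0
        · refine .of_isSquare ⟨(t : ℚ), ?_⟩
          have : a = t * t := by subst hc0; linarith
          exact_mod_cast this
        have key : ∀ (K : Type) [Field K] [CharZero K], Hilbert K a b ↔ Hilbert K a c := by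
          intro K _ _
          have hne : (t : K) ^ 2 - a * 1 ^ 2 ≠ 0 := by
            have : t ^ 2 - a * 1 ^ 2 ≠ 0 := by
              rw [one_pow, mul_one, hc]; exact mul_ne_zero hb hc0
            exact_mod_cast this
          have hK : (t : K) ^ 2 - a = b * c := by exact_mod_cast congrArg (Int.cast : ℤ → K) hc
          have hb' : (b : K) ≠ 0 := by exact_mod_cast hb
          have hc' : (c : K) ≠ 0 := by exact_mod_cast hc0
          constructor
          · intro h1
            have h2 := h1.mul_norm hne
            refine Hilbert.of_mul_sq hb' ?_
            convert h2 using 1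
            linear_combination -(b : K) * hK
          · intro h1
            have h2 := h1.mul_norm hne
            refine Hilbert.of_mul_sq hc' ?_
            convert h2 using 1
            linear_combination -(c : K) * hK
        rw [key ℚ]
        refine ih _ ?_ ha hc0 (fun p _ => (key _).1 (h p)) ((key _).1 hreal) rfl
        suffices c.natAbs < b.natAbs by omega
        have hb2 : 2 ≤ |b| := by rw [Int.abs_eq_natAbs]; omega
        have hab' : |a| ≤ |b| := by rw [Int.abs_eq_natAbs, Int.abs_eq_natAbs]; exact_mod_cast hab
        have hbc : |b| * |c| ≤ |t| ^ 2 + |a| := by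
          rw [← abs_mul, ← hc, ← abs_pow]
          exact abs_sub _ _
        zify
        by_contra! hcb
        nlinarith [abs_nonneg t]
    · simp only [Squarefree, not_forall] at hsq
      obtain ⟨k, ⟨c, hc⟩, hk⟩ := hsq
      have hk0 : k ≠ 0 := by rintro rfl; simp at hc; exact hb hc
      have hc0 : c ≠ 0 := by rintro rfl; simp at hc; exact hb hc
      have hk2 : 2 ≤ k.natAbs := by
        rw [Int.isUnit_iff_natAbs_eq] at hk
        omega
      have e : ∀ (K : Type) [Field K], ((b : ℤ) : K) = c * (k : K) ^ 2 := fun K _ => by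
        rw [hc]; push_cast; ring
      have key : ∀ (K : Type) [Field K] [CharZero K], Hilbert K a b ↔ Hilbert K a c := by
        intro K _ _
        have hk' : (k : K) ≠ 0 := by exact_mod_cast hk0
        rw [e K]
        exact ⟨.of_mul_sq hk', .mul_sq hk'⟩
      rw [key ℚ]
      refine ih _ ?_ ha hc0 (fun p _ => (key _).1 (h p)) ((key _).1 hreal) rfl
      have : 0 < c.natAbs := by omega
      have : b.natAbs = k.natAbs * k.natAbs * c.natAbs := by simp [hc, Int.natAbs_mul]
      nlinarith [Nat.mul_le_mul hk2 hk2]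

/-- The Hasse principle for squares. -/
theorem isSquare_rat {c : ℤ} (h : ∀ (p : ℕ) [Fact p.Prime], IsSquare (c : ℚ_[p]))
    (hreal : IsSquare (c : ℝ)) : IsSquare (c : ℚ) := by
  obtain ⟨n, rfl⟩ : ∃ n : ℕ, (n : ℤ) = c := by
    refine ⟨c.toNat, Int.toNat_of_nonneg ?_⟩
    exact_mod_cast hreal.nonneg
  obtain ⟨m, k, rfl, hm⟩ := Nat.sq_mul_squarefree n
  rcases eq_or_ne k 0 with rfl | hk
  · simp
  have hm1 : m = 1 := by
    by_contra hm1
    obtain ⟨p, hp, v, rfl⟩ := Nat.exists_prime_and_dvd hm1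
    have := Fact.mk hp
    have hv : ¬ p ∣ v := by
      rintro ⟨w, rfl⟩
      exact hp.not_isUnit (hm p ⟨w, by ring⟩)
    obtain ⟨x, hx⟩ := h p
    have hk' : (k : ℚ_[p]) ≠ 0 := by exact_mod_cast hk
    have hv' : (v : ℚ_[p]) ≠ 0 := by
      have : v ≠ 0 := by rintro rfl; simp at hv
      exact_mod_cast this
    have hp' : (p : ℚ_[p]) ≠ 0 := by exact_mod_cast hp.ne_zero
    have h1 : (p : ℚ_[p]) * v = (x / k) ^ 2 := by
      push_cast at hx
      field_simp
      linear_combination hx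
    have h2 := congrArg Padic.valuation h1
    rw [Padic.valuation_mul hp' hv', Padic.valuation_p, Padic.valuation_pow,
      Padic.valuation_natCast, padicValNat.eq_zero_of_not_dvd hv] at h2
    push_cast at h2
    omega
  subst hm1
  exact ⟨k, by push_cast; ring⟩

theorem isSquare_iff_binary {K : Type*} [Field K] {a b : K} (hb : b ≠ 0) :
    IsSquare (-a * b) ↔ ∃ x y : K, (x ≠ 0 ∨ y ≠ 0) ∧ a * x ^ 2 + b * y ^ 2 = 0 := by
  constructor
  · rintro ⟨s, hs⟩
    refine ⟨b, s, by simp [hb], ?_⟩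
    linear_combination -b * hs
  · rintro ⟨x, y, h0, h⟩
    have hx : x ≠ 0 := by
      rintro rfl
      have : y = 0 := by simpa [hb] using h
      simp_all
    refine ⟨b * y / x, ?_⟩
    field_simp
    linear_combination -h

open Filter Topology

instance fact_prime_of_primes (p : Nat.Primes) : Fact (p : ℕ).Prime := ⟨p.2⟩

theorem padic_not_isEquiv {p q : ℕ} [hp : Fact p.Prime] [hq : Fact q.Prime] (h : p ≠ q) :
    ¬ (Rat.AbsoluteValue.padic p).IsEquiv (Rat.AbsoluteValue.padic q) := by
  intro he
  have h1 : Rat.AbsoluteValue.padic p (p : ℚ) < 1 := by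
    rw [Rat.AbsoluteValue.padic_eq_padicNorm, padicNorm.padicNorm_p_of_prime]
    have : (1 : ℝ) < p := by exact_mod_cast hp.out.one_lt
    push_cast
    exact inv_lt_one_of_one_lt₀ this
  rw [he.lt_one_iff, Rat.AbsoluteValue.padic_eq_padicNorm,
    padicNorm.padicNorm_of_prime_of_ne h.symm] at h1
  simp at h1

theorem padic_isNontrivial (p : ℕ) [hp : Fact p.Prime] :
    (Rat.AbsoluteValue.padic p).IsNontrivial := by
  refine ⟨p, by exact_mod_cast hp.out.ne_zero, ?_⟩
  rw [Rat.AbsoluteValue.padic_eq_padicNorm, padicNorm.padicNorm_p_of_prime]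
  have : (1 : ℝ) < p := by exact_mod_cast hp.out.one_lt
  push_cast
  exact (inv_lt_one_of_one_lt₀ this).ne

/-- Weak approximation over `ℚ`. -/
theorem weak_approximation (S : Finset Nat.Primes) (x : ∀ p : Nat.Primes, ℚ_[p]) (y : ℝ)
    {U : ∀ p : Nat.Primes, Set ℚ_[p]} (hU : ∀ p ∈ S, U p ∈ 𝓝 (x p)) {V : Set ℝ} (hV : V ∈ 𝓝 y) :
    ∃ r : ℚ, (∀ p ∈ S, (r : ℚ_[p]) ∈ U p) ∧ (r : ℝ) ∈ V := by
  let v : Option S → AbsoluteValue ℚ ℝ := fun i =>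
    i.elim Rat.AbsoluteValue.real fun p => Rat.AbsoluteValue.padic p.1
  have hnt : ∀ i, (v i).IsNontrivial := by
    rintro (_ | p)
    · exact ⟨2, by simp, by simp [v]⟩
    · exact padic_isNontrivial _
  have hne : Pairwise fun i j => ¬ (v i).IsEquiv (v j) := by
    rintro (_ | p) (_ | q) hpq
    · simp at hpq
    · exact Rat.AbsoluteValue.not_real_isEquiv_padic _
    · exact fun h => Rat.AbsoluteValue.not_real_isEquiv_padic _ h.symm
    · refine padic_not_isEquiv fun h => hpq ?_
      rw [Subtype.ext (Subtype.ext h)]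
  have hloc : ∀ p : S, ∃ (c : ℚ) (ε : ℝ), 0 < ε ∧ ∀ r : ℚ, v (some p) (r - c) < ε →
      (r : ℚ_[p.1]) ∈ U p := by
    intro p
    obtain ⟨ε, hε, hball⟩ := Metric.mem_nhds_iff.1 (hU p p.2)
    obtain ⟨c, hc⟩ := Padic.rat_dense p.1 (x p) (half_pos hε)
    refine ⟨c, ε / 2, half_pos hε, fun r hr => hball ?_⟩
    have h1 : ‖((r - c : ℚ) : ℚ_[p.1])‖ < ε / 2 := by
      rw [Padic.eq_padicNorm]; exact hr
    rw [mem_ball_iff_norm]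
    calc ‖(r : ℚ_[p.1]) - x p‖ = ‖((r - c : ℚ) : ℚ_[p.1]) - (x p - c)‖ := by
          congr 1; push_cast; ring
      _ ≤ _ := norm_sub_le _ _
      _ < ε := by linarith
  have hinf : ∃ (c : ℚ) (ε : ℝ), 0 < ε ∧ ∀ r : ℚ, v none (r - c) < ε → (r : ℝ) ∈ V := by
    obtain ⟨ε, hε, hball⟩ := Metric.mem_nhds_iff.1 hV
    obtain ⟨c, hc1, hc2⟩ := exists_rat_btwn (show y < y + ε / 2 by linarith)
    refine ⟨c, ε / 2, half_pos hε, fun r hr => hball ?_⟩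
    have hr : |((r - c : ℚ) : ℝ)| < ε / 2 := by
      simpa [v] using hr
    push_cast at hr
    rw [Metric.mem_ball, Real.dist_eq]
    rw [abs_lt] at hr ⊢
    constructor <;> linarith
  have hloc' : ∀ i : Option S, ∃ (c : ℚ) (ε : ℝ), 0 < ε ∧ ∀ r : ℚ, v i (r - c) < ε →
      i.elim ((r : ℝ) ∈ V) fun p => (r : ℚ_[p.1]) ∈ U p := by
    rintro (_ | p)
    · exact hinf
    · exact hloc p
  choose c ε hε hc using hloc'
  obtain ⟨r, hr⟩ := (AbsoluteValue.denseRange_algebraMap_pi hnt hne).exists_mem_open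
    (s := Set.pi Set.univ fun i => Metric.ball (WithAbs.toAbs (v i) (c i)) (ε i))
    (isOpen_set_pi Set.finite_univ fun i _ => Metric.isOpen_ball)
    ⟨fun i => WithAbs.toAbs (v i) (c i), fun i _ => Metric.mem_ball_self (hε i)⟩
  have h : ∀ i, v i (r - c i) < ε i := fun i => by
    have := hr i trivial
    rw [mem_ball_iff_norm] at this
    exact this
  exact ⟨r, fun p hp => hc _ r (h (some ⟨p, hp⟩)), hc _ r (h none)⟩

/-- The primes dividing `N`, as elements of `Nat.Primes`. -/
def primesDividing (N : ℕ) : Finset Nat.Primes := N.primeFactors.subtype Nat.Prime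

theorem mem_primesDividing {N : ℕ} (hN : N ≠ 0) {p : Nat.Primes} :
    p ∈ primesDividing N ↔ (p : ℕ) ∣ N :=
  Finset.mem_subtype.trans
    (Nat.mem_primeFactors.trans ⟨fun h => h.2.1, fun h => ⟨p.2, h, hN⟩⟩)

/-- A value of `a x² + b y²` at integers, in prescribed nonzero square classes at the real place
and at the primes dividing `N`. -/
theorem exists_int_value {N : ℕ} (hN : N ≠ 0) (a b : ℤ) (x y : ∀ p : Nat.Primes, ℚ_[p])
    (x' y' : ℝ) (h : ∀ p, a * x p ^ 2 + b * y p ^ 2 ≠ 0) (h' : a * x' ^ 2 + b * y' ^ 2 ≠ 0) :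
    ∃ X Y : ℤ, (∀ p : Nat.Primes, (p : ℕ) ∣ N → ∃ s : ℚ_[p], s ≠ 0 ∧
        ((a * X ^ 2 + b * Y ^ 2 : ℤ) : ℚ_[p]) = (a * x p ^ 2 + b * y p ^ 2) * s ^ 2) ∧
      ∃ s : ℝ, s ≠ 0 ∧
        ((a * X ^ 2 + b * Y ^ 2 : ℤ) : ℝ) = (a * x' ^ 2 + b * y' ^ 2) * s ^ 2 := by
  have key : ∀ (K : Type) [NontriviallyNormedField K] [CompleteSpace K] [CharZero K] (x y : K),
      a * x ^ 2 + b * y ^ 2 ≠ 0 → ∃ U ∈ 𝓝 x, ∃ V ∈ 𝓝 y, ∀ u ∈ U, ∀ v ∈ V,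
        ∃ s : K, s ≠ 0 ∧ a * u ^ 2 + b * v ^ 2 = (a * x ^ 2 + b * y ^ 2) * s ^ 2 := by
    intro K _ _ _ x y h
    have hc : Continuous fun w : K × K => (a : K) * w.1 ^ 2 + b * w.2 ^ 2 := by fun_prop
    have h1 := (hc.tendsto (x, y)).eventually (eventually_eq_mul_sq two_ne_zero h)
    rw [nhds_prod_eq] at h1
    obtain ⟨U, hU, V, hV, hUV⟩ := Filter.mem_prod_iff.1 h1
    exact ⟨U, hU, V, hV, fun u hu v hv => hUV (Set.mk_mem_prod hu hv)⟩
  choose U hU V hV hUV using fun p : Nat.Primes => key _ _ _ (h p)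
  obtain ⟨U', hU', V', hV', hUV'⟩ := key _ _ _ h'
  obtain ⟨r, hr, hr'⟩ := weak_approximation (primesDividing N) x x'
    (fun p _ => hU p) hU'
  obtain ⟨s, hs, hs'⟩ := weak_approximation (primesDividing N) y y'
    (fun p _ => hV p) hV'
  have hrn : (r.num : ℚ) = r * r.den := (Rat.mul_den_eq_num r).symm
  have hsn : (s.num : ℚ) = s * s.den := (Rat.mul_den_eq_num s).symm
  have fin : ∀ (K : Type) [Field K] [CharZero K] (t : K),
      (∃ c : K, c ≠ 0 ∧ a * (r : K) ^ 2 + b * (s : K) ^ 2 = t * c ^ 2) →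
      ∃ c : K, c ≠ 0 ∧ ((a * (r.num * s.den) ^ 2 + b * (s.num * r.den) ^ 2 : ℤ) : K) =
        t * c ^ 2 := by
    rintro K _ _ t ⟨c, hc, h⟩
    refine ⟨c * (r.den * s.den), mul_ne_zero hc (by simp), ?_⟩
    have h1 : (r.num : K) = r * r.den := by exact_mod_cast congrArg (Rat.cast : ℚ → K) hrn
    have h2 : (s.num : K) = s * s.den := by exact_mod_cast congrArg (Rat.cast : ℚ → K) hsn
    push_cast
    rw [h1, h2]
    linear_combination ((r.den : K) * s.den) ^ 2 * h
  exact ⟨r.num * s.den, s.num * r.den, fun p hp => fin _ _ (hUV p _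
    (hr p ((mem_primesDividing hN).2 hp)) _ (hs p ((mem_primesDividing hN).2 hp))),
    fin _ _ (hUV' _ hr' _ hs')⟩

theorem exists_coprime_factor (N : ℕ) {n : ℕ} (hn : n ≠ 0) :
    ∃ m u : ℕ, n = m * u ∧ u.Coprime N ∧ ∀ p : ℕ, p.Prime → p ∣ m → p ∣ N := by
  induction n using Nat.strong_induction_on with
  | _ n ih =>
    by_cases h : n.Coprime N
    · exact ⟨1, n, by simp, h, fun p hp h1 => absurd (Nat.dvd_one.1 h1) hp.one_lt.ne'⟩
    · obtain ⟨k, hk⟩ := Nat.gcd_dvd_left n N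
      have hk0 : k ≠ 0 := by rintro rfl; simp at hk; exact hn hk
      have hg : n.gcd N ≠ 0 := Nat.gcd_ne_zero_left hn
      have hg1 : n.gcd N ≠ 1 := h
      have hlt : k < n := by
        have : 2 ≤ n.gcd N := by omega
        have := Nat.mul_le_mul_right k this
        omega
      obtain ⟨m, u, hmu, hu, hm⟩ := ih k hlt hk0
      refine ⟨n.gcd N * m, u, by rw [mul_assoc, ← hmu, ← hk], hu, fun p hp hpm => ?_⟩
      rcases hp.dvd_mul.1 hpm with h1 | h1
      · exact h1.trans (Nat.gcd_dvd_right _ _)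
      · exact hm p hp h1

/-- Prescribed nonzero square classes at the real place and at the primes dividing `N` are
realized by an integer `q * m` where `q` is a prime not dividing `N` and all prime factors of `m`
divide `N`. -/
theorem exists_prime_mul {N : ℕ} (hN : N ≠ 0) (t : ∀ p : Nat.Primes, ℚ_[p]) (t' : ℝ)
    (ht : ∀ p, t p ≠ 0) (ht' : t' ≠ 0) :
    ∃ (q : ℕ) (m : ℤ), q.Prime ∧ ¬ q ∣ N ∧ (∀ p : ℕ, p.Prime → (p : ℤ) ∣ m → p ∣ N) ∧
      (∀ p : Nat.Primes, (p : ℕ) ∣ N → ∃ s : ℚ_[p], s ≠ 0 ∧ ((q * m : ℤ) : ℚ_[p]) = t p * s ^ 2) ∧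
      ∃ s : ℝ, s ≠ 0 ∧ ((q * m : ℤ) : ℝ) = t' * s ^ 2 := by
  obtain ⟨r, hr, hr'⟩ := weak_approximation (primesDividing N) t t'
    (fun p _ => eventually_eq_mul_sq two_ne_zero (ht p))
    (eventually_eq_mul_sq two_ne_zero ht')
  have hr0 : r ≠ 0 := by
    rintro rfl
    obtain ⟨s, hs, h⟩ := hr'
    rw [Rat.cast_zero, eq_comm, mul_eq_zero] at h
    exact h.elim ht' (pow_ne_zero 2 hs)
  obtain ⟨R, hR0, hR, hR'⟩ : ∃ R : ℤ, R ≠ 0 ∧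
      (∀ p : Nat.Primes, (p : ℕ) ∣ N → ∃ s : ℚ_[p], s ≠ 0 ∧ (R : ℚ_[p]) = t p * s ^ 2) ∧
      ∃ s : ℝ, s ≠ 0 ∧ (R : ℝ) = t' * s ^ 2 := by
    have fin : ∀ (K : Type) [Field K] [CharZero K] (t : K),
        (∃ c : K, c ≠ 0 ∧ (r : K) = t * c ^ 2) →
        ∃ c : K, c ≠ 0 ∧ ((r.num * r.den : ℤ) : K) = t * c ^ 2 := by
      rintro K _ _ t ⟨c, hc, h⟩
      refine ⟨c * r.den, mul_ne_zero hc (by simp), ?_⟩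
      have h1 : (r.num : K) = r * r.den := by
        exact_mod_cast congrArg (Rat.cast : ℚ → K) (Rat.mul_den_eq_num r).symm
      push_cast
      rw [h1, h]
      ring
    exact ⟨r.num * r.den, by simpa using hr0,
      fun p hp => fin _ _ (hr p ((mem_primesDividing hN).2 hp)), fin _ _ hr'⟩
  obtain ⟨m, u, hmu, hu, hm⟩ := exists_coprime_factor N (Int.natAbs_ne_zero.2 hR0)
  have hu0 : u ≠ 0 := by rintro rfl; simp at hmu; exact hR0 hmu
  obtain ⟨c, hRc, hc⟩ : ∃ c : ℤ, R = c * u ∧ ∀ p : ℕ, p.Prime → (p : ℤ) ∣ c → p ∣ N := by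
    refine ⟨R.sign * m, ?_, fun p hp hpm => hm p hp ?_⟩
    · conv_lhs => rw [← Int.sign_mul_natAbs R, hmu]
      push_cast; ring
    · have := Int.natAbs_dvd_natAbs.2 hpm
      rwa [Int.natAbs_mul, Int.natAbs_sign_of_ne_zero hR0, one_mul, Int.natAbs_natCast,
        Int.natAbs_natCast] at this
  obtain ⟨k, hk⟩ : ∃ k : ℕ, ∀ p ∈ primesDividing N, ∀ j : ℤ,
      ∃ s : ℚ_[p], s ≠ 0 ∧ ((R + c * N ^ k * j : ℤ) : ℚ_[p]) = R * s ^ 2 := by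
    refine Eventually.exists (f := atTop) ?_
    rw [Filter.eventually_all_finset]
    intro p hp
    have hp := (mem_primesDividing hN).1 hp
    obtain ⟨ε, hε, hball⟩ := Metric.eventually_nhds_iff.1
      (eventually_eq_mul_sq (K := ℚ_[p]) two_ne_zero (t := R) (by exact_mod_cast hR0))
    have hlt : ‖(N : ℚ_[p])‖ < 1 := by
      have := (Padic.norm_intCast_lt_one_iff (p := p) (k := N)).2 (by exact_mod_cast hp)
      exact_mod_cast this
    filter_upwards [(tendsto_pow_atTop_nhds_zero_of_lt_one (norm_nonneg _) hlt).eventually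
      (gt_mem_nhds hε)] with k hk j
    refine hball ?_
    rw [dist_eq_norm]
    have h1 : ((R + c * N ^ k * j : ℤ) : ℚ_[p]) - R =
        ((c * j : ℤ) : ℚ_[p]) * (N : ℚ_[p]) ^ k := by push_cast; ring
    rw [h1, norm_mul, norm_pow]
    refine lt_of_le_of_lt ?_ hk
    exact mul_le_of_le_one_left (by positivity) (Padic.norm_int_le_one _)
  obtain ⟨q, hqN, hq, hqu⟩ := Nat.forall_exists_prime_gt_and_modEq N (pow_ne_zero k hN)
    (hu.pow_right k)
  refine ⟨q, c, hq, fun h => ?_, hc, fun p hp => ?_, ?_⟩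
  · exact absurd (Nat.le_of_dvd (Nat.pos_of_ne_zero hN) h) (not_le.2 hqN)
  · obtain ⟨j, hj⟩ := (Nat.modEq_iff_dvd.1 hqu.symm)
    obtain ⟨s, hs, h⟩ := hk p ((mem_primesDividing hN).2 hp) j
    obtain ⟨s', hs', h'⟩ := hR p hp
    refine ⟨s' * s, mul_ne_zero hs' hs, ?_⟩
    have e : (q * c : ℤ) = R + c * N ^ k * j := by
      push_cast at hj
      linear_combination c * hj - hRc
    rw [e, h, h']
    ring
  · obtain ⟨s, hs, h⟩ := hR'
    have hpos : (0 : ℝ) < q / u := by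
      have := hq.pos
      have := Nat.pos_of_ne_zero hu0
      positivity
    refine ⟨s * √(q / u), mul_ne_zero hs (Real.sqrt_ne_zero'.2 hpos), ?_⟩
    rw [mul_pow, Real.sq_sqrt hpos.le]
    have h1 : (R : ℝ) = c * u := by exact_mod_cast congrArg (Int.cast : ℤ → ℝ) hRc
    have h2 : (u : ℝ) ≠ 0 := by exact_mod_cast hu0
    push_cast
    field_simp
    linear_combination (q : ℝ) * (h - h1)

/-- Everywhere locally isotropic. -/
def LocallyIsotropic {n : ℕ} (d : Fin n → ℤ) : Prop :=
  (∀ (p : ℕ) [Fact p.Prime], DiagIsotropic ℚ_[p] d) ∧ DiagIsotropic ℝ d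

section Field

variable {K : Type*} [Field K]

theorem diagIsotropic_cons_iff {n : ℕ} {a : ℤ} {d : Fin n → ℤ} :
    DiagIsotropic K (Fin.cons a d : Fin (n + 1) → ℤ) ↔
      ∃ (x : K) (v : Fin n → K), (x ≠ 0 ∨ v ≠ 0) ∧ a * x ^ 2 + ∑ i, (d i : K) * v i ^ 2 = 0 := by
  constructor
  · rintro ⟨v, hv0, hv⟩
    refine ⟨v 0, Fin.tail v, ?_, ?_⟩
    · by_contra! h
      apply hv0
      rw [← Fin.cons_self_tail v, h.1, h.2]
      exact Matrix.cons_zero_zero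
    · rw [Fin.sum_univ_succ] at hv
      exact hv
  · rintro ⟨x, v, h0, h⟩
    refine ⟨Fin.cons x v, ?_, ?_⟩
    · intro h1
      have e0 := congrFun h1 0
      have e1 : v = 0 := funext fun i => congrFun h1 i.succ
      rw [Fin.cons_zero] at e0
      exact h0.elim (fun h => h e0) (fun h => h e1)
    · rw [Fin.sum_univ_succ]
      simpa using h

theorem DiagIsotropic.cons {n : ℕ} {d : Fin n → ℤ} (h : DiagIsotropic K d) (a : ℤ) :
    DiagIsotropic K (Fin.cons a d : Fin (n + 1) → ℤ) := by
  obtain ⟨v, hv0, hv⟩ := h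
  exact diagIsotropic_cons_iff.2 ⟨0, v, .inr hv0, by simpa using hv⟩

/-- If `t` is a value of `⟨a, b⟩` and `⟨t⟩ ⊥ d` is isotropic, then so is `⟨a, b⟩ ⊥ d`. -/
theorem DiagIsotropic.of_value {n : ℕ} {a b t : ℤ} {d : Fin n → ℤ} (ht : (t : K) ≠ 0) {x y : K}
    (hxy : a * x ^ 2 + b * y ^ 2 = (t : K))
    (h : DiagIsotropic K (Fin.cons t d : Fin (n + 1) → ℤ)) :
    DiagIsotropic K (Fin.cons a (Fin.cons b d : Fin (n + 1) → ℤ) : Fin (n + 2) → ℤ) := by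
  obtain ⟨z, v, h0, h⟩ := diagIsotropic_cons_iff.1 h
  refine diagIsotropic_cons_iff.2 ⟨x * z, Fin.cons (y * z) v, ?_, ?_⟩
  · by_contra! h1
    have e1 : v = 0 := funext fun i => congrFun h1.2 i.succ
    have e0 := congrFun h1.2 0
    rw [Fin.cons_zero] at e0
    have hz : z ≠ 0 := h0.resolve_right (not_not.2 e1)
    have hx : x = 0 := by simpa [hz] using h1.1
    have hy : y = 0 := by simpa [hz] using e0
    apply ht
    rw [← hxy, hx, hy]
    simp
  · rw [Fin.sum_univ_succ]
    simp only [Fin.cons_zero, Fin.cons_succ]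
    linear_combination h + z ^ 2 * hxy

end Field

theorem diagIsotropic_of_not_dvd {n p : ℕ} [Fact p.Prime] {d : Fin (n + 3) → ℤ} (hp2 : p ≠ 2)
    (h0 : ¬ (p : ℤ) ∣ d 0) (h1 : ¬ (p : ℤ) ∣ d 1) (h2 : ¬ (p : ℤ) ∣ d 2) :
    DiagIsotropic ℚ_[p] d := by
  have hd0 : (d 0 : ℚ_[p]) ≠ 0 := by
    intro h
    rw [Int.cast_eq_zero] at h
    exact h0 (h ▸ dvd_zero _)
  have h := hilbert_units hp2 (not_dvd_mul (by rwa [dvd_neg]) h1 : ¬ (p : ℤ) ∣ -d 0 * d 1)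
    (not_dvd_mul (by rwa [dvd_neg]) h2 : ¬ (p : ℤ) ∣ -d 0 * d 2)
  push_cast at h
  obtain ⟨x, y, z, hne, h⟩ := (hilbert_iff_ternary hd0).1 h
  refine ⟨Fin.cons x (Fin.cons y (Fin.cons z 0)), ?_, ?_⟩
  · intro h3
    have e0 : x = 0 := congrFun h3 0
    have e1 : y = 0 := congrFun h3 1
    have e2 : z = 0 := congrFun h3 2
    simp_all
  · rw [Fin.sum_univ_succ, Fin.sum_univ_succ, Fin.sum_univ_succ]
    simp only [Fin.cons_zero, Fin.cons_succ]
    rw [← h]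
    simp [add_assoc]

/-- The Hasse principle passes from `n + 4` to `n + 5` variables. -/
theorem diagIsotropic_rat_succ {n : ℕ}
    (ih : ∀ d : Fin (n + 4) → ℤ, (∀ i, d i ≠ 0) → LocallyIsotropic d → DiagIsotropic ℚ d)
    {d : Fin (n + 5) → ℤ} (hd : ∀ i, d i ≠ 0) (h : LocallyIsotropic d) : DiagIsotropic ℚ d := by
  obtain ⟨a, d, rfl⟩ : ∃ a d', d = Fin.cons a d' := ⟨d 0, Fin.tail d, (Fin.cons_self_tail d).symm⟩
  obtain ⟨b, d, rfl⟩ : ∃ a d', d = Fin.cons a d' := ⟨d 0, Fin.tail d, (Fin.cons_self_tail d).symm⟩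
  have ha : a ≠ 0 := hd 0
  have hb : b ≠ 0 := hd 1
  have hd : ∀ i, d i ≠ 0 := fun i => hd i.succ.succ
  obtain ⟨h, hreal⟩ := h
  have common : ∀ (K : Type) [Field K] [CharZero K],
      DiagIsotropic K (Fin.cons a (Fin.cons b d) : Fin (n + 5) → ℤ) →
      ∃ (x y : K) (w : Fin (n + 3) → K), (a : K) * x ^ 2 + b * y ^ 2 ≠ 0 ∧
        (a : K) * x ^ 2 + b * y ^ 2 + ∑ i, (d i : K) * w i ^ 2 = 0 := fun K _ _ h =>
    exists_common_value two_ne_zero (by exact_mod_cast ha) (by exact_mod_cast hb)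
      (fun i => by exact_mod_cast hd i) h
  choose x y w hne hw using fun p : Nat.Primes => common ℚ_[p] (h p)
  obtain ⟨x', y', w', hne', hw'⟩ := common ℝ hreal
  let N : ℕ := 2 * (d 0 * d 1 * d 2).natAbs
  have hN : N ≠ 0 := by simp [N, hd]
  obtain ⟨X, Y, hXY, hXY'⟩ := exists_int_value hN a b x y x' y' hne hne'
  set T : ℤ := a * X ^ 2 + b * Y ^ 2 with hT
  have hT0 : T ≠ 0 := by
    obtain ⟨s, hs, h⟩ := hXY'
    have : (T : ℝ) ≠ 0 := by rw [h]; exact mul_ne_zero hne' (pow_ne_zero 2 hs)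
    exact_mod_cast this
  have loc : ∀ (K : Type) [Field K] (t : K) (w : Fin (n + 3) → K),
      t + ∑ i, (d i : K) * w i ^ 2 = 0 → (∃ s : K, s ≠ 0 ∧ (T : K) = t * s ^ 2) →
      DiagIsotropic K (Fin.cons T d : Fin (n + 4) → ℤ) := by
    rintro K _ t w hw ⟨s, hs, h⟩
    refine diagIsotropic_cons_iff.2 ⟨1, fun i => w i * s, .inl one_ne_zero, ?_⟩
    simp_rw [mul_pow, ← mul_assoc]
    rw [← Finset.sum_mul, h]
    linear_combination s ^ 2 * hw
  have hglob : DiagIsotropic ℚ (Fin.cons T d : Fin (n + 4) → ℤ) := by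
    refine ih _ (fun i => Fin.cases hT0 hd i) ⟨fun p hp => ?_, loc ℝ _ w' hw' hXY'⟩
    by_cases hpN : p ∣ N
    · exact loc _ _ _ (hw ⟨p, hp.out⟩) (hXY ⟨p, hp.out⟩ hpN)
    · have hp2 : p ≠ 2 := by rintro rfl; exact hpN (dvd_mul_right _ _)
      have hpd : ¬ (p : ℤ) ∣ d 0 * d 1 * d 2 := fun h =>
        hpN (Dvd.dvd.mul_left (Int.natCast_dvd.1 h) _)
      refine (diagIsotropic_of_not_dvd hp2 (fun h => hpd ?_) (fun h => hpd ?_)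
        fun h => hpd ?_).cons T
      · exact (h.mul_right _).mul_right _
      · exact (h.mul_left _).mul_right _
      · exact h.mul_left _
  exact hglob.of_value (by exact_mod_cast hT0) (x := X) (y := Y) (by rw [hT]; push_cast; ring)

theorem ternary_of_eq_mul_sq {K : Type*} [Field K] {a b u t x y s : K} (ha : a ≠ 0)
    (hu : u = t * s ^ 2) (hxy : a * x ^ 2 + b * y ^ 2 = t) : Hilbert K (-a * b) (a * u) := by
  have := (hilbert_iff_ternary (b := b) (c := -u) ha).2 ⟨x * s, y * s, 1, by simp, by
    linear_combination s ^ 2 * hxy - hu⟩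
  convert this using 1
  ring

theorem ternary_rat {a b m : ℤ} {q N : ℕ} (ha : a ≠ 0) (hb : b ≠ 0) (hq : q.Prime)
    (hqN : ¬ q ∣ N) (h2N : 2 ∣ N) (hN : ∀ p : ℕ, p.Prime → (p : ℤ) ∣ a * b * m → p ∣ N)
    (h : ∀ (p : ℕ) [Fact p.Prime], p ∣ N → Hilbert ℚ_[p] ((-a * b : ℤ) : ℚ_[p])
      ((q * (a * m) : ℤ) : ℚ_[p]))
    (hreal : Hilbert ℝ ((-a * b : ℤ) : ℝ) ((q * (a * m) : ℤ) : ℝ)) :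
    ∃ x y z : ℚ, (x ≠ 0 ∨ y ≠ 0 ∨ z ≠ 0) ∧ a * x ^ 2 + b * y ^ 2 = q * m * z ^ 2 := by
  have hq2 : q ≠ 2 := by rintro rfl; exact hqN h2N
  have hndvd : ∀ p : ℕ, p.Prime → ¬ p ∣ N → ¬ (p : ℤ) ∣ -a * b ∧ ¬ (p : ℤ) ∣ a * m := by
    refine fun p hp hpN => ⟨fun h => hpN (hN p hp ?_), fun h => hpN (hN p hp ?_)⟩
    · rw [neg_mul, dvd_neg] at h
      exact h.mul_right _
    · rw [mul_right_comm]
      exact h.mul_right _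
  have hab : -a * b ≠ 0 := mul_ne_zero (neg_ne_zero.2 ha) hb
  have hqm := hndvd q hq hqN
  have hm : q * (a * m) ≠ 0 :=
    mul_ne_zero (by exact_mod_cast hq.ne_zero) fun h => hqm.2 (h ▸ dvd_zero _)
  have hne : ∀ (p : ℕ) [Fact p.Prime], p ≠ q → Hilbert ℚ_[p] ((-a * b : ℤ) : ℚ_[p])
      ((q * (a * m) : ℤ) : ℚ_[p]) := by
    intro p hp hpq
    by_cases hpN : p ∣ N
    · exact h p hpN
    · have hp2 : p ≠ 2 := by rintro rfl; exact hpN h2N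
      obtain ⟨h1, h2⟩ := hndvd p hp.out hpN
      exact hilbert_units hp2 h1 (not_dvd_mul (not_dvd_prime hp.out hq hpq) h2)
  have hrat := hilbert_rat hab hm (fun p hp => by
    rcases eq_or_ne p q with rfl | hpq
    · exact hilbert_of_forall_ne hq2 hab hqm.1 hqm.2 hreal hne
    · exact hne p hpq) hreal
  have e : ((q * (a * m) : ℤ) : ℚ) = -a * (-(q * m) : ℚ) := by push_cast; ring
  rw [e] at hrat
  push_cast at hrat
  obtain ⟨x, y, z, h0, h⟩ := (hilbert_iff_ternary (by exact_mod_cast ha)).1 hrat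
  exact ⟨x, y, z, h0, by linear_combination h⟩

theorem binary_isotropic_or_value {a b t x y z : ℚ} (ha : a ≠ 0) (hb : b ≠ 0)
    (h0 : x ≠ 0 ∨ y ≠ 0 ∨ z ≠ 0) (h : a * x ^ 2 + b * y ^ 2 = t * z ^ 2) :
    ∃ x y : ℚ, a * x ^ 2 + b * y ^ 2 = t := by
  rcases eq_or_ne z 0 with rfl | hz
  · exact binary_universal two_ne_zero ha hb (by simpa using h0) (by simpa using h) t
  · refine ⟨x / z, y / z, ?_⟩
    field_simp
    linear_combination h

/-- The Hasse principle for quaternary diagonal forms. -/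
theorem diagIsotropic_rat_four {d : Fin 4 → ℤ} (hd : ∀ i, d i ≠ 0) (h : LocallyIsotropic d) :
    DiagIsotropic ℚ d := by
  obtain ⟨a, d, rfl⟩ : ∃ a d', d = Fin.cons a d' := ⟨d 0, Fin.tail d, (Fin.cons_self_tail d).symm⟩
  obtain ⟨b, d, rfl⟩ : ∃ a d', d = Fin.cons a d' := ⟨d 0, Fin.tail d, (Fin.cons_self_tail d).symm⟩
  have ha : a ≠ 0 := hd 0
  have hb : b ≠ 0 := hd 1
  have hd : ∀ i, d i ≠ 0 := fun i => hd i.succ.succ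
  obtain ⟨h, hreal⟩ := h
  have common : ∀ (K : Type) [Field K] [CharZero K],
      DiagIsotropic K (Fin.cons a (Fin.cons b d) : Fin 4 → ℤ) →
      ∃ t : K, t ≠ 0 ∧ (∃ x y : K, a * x ^ 2 + b * y ^ 2 = t) ∧
        ∃ x y : K, d 0 * x ^ 2 + d 1 * y ^ 2 = -t := by
    intro K _ _ h
    obtain ⟨x, y, w, h1, h2⟩ := exists_common_value two_ne_zero (by exact_mod_cast ha)
      (by exact_mod_cast hb) (fun i => by exact_mod_cast hd i) h
    refine ⟨_, h1, ⟨x, y, rfl⟩, w 0, w 1, ?_⟩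
    rw [Fin.sum_univ_two] at h2
    linear_combination h2
  choose t ht hab hcd using fun p : Nat.Primes => common ℚ_[p] (h p)
  obtain ⟨t', ht', hab', hcd'⟩ := common ℝ hreal
  let N : ℕ := 2 * (a * b * (d 0 * d 1)).natAbs
  have hN : N ≠ 0 := by simp [N, hd, ha, hb]
  obtain ⟨q, m, hq, hqN, hmN, hqm, hqm'⟩ := exists_prime_mul hN t t' ht ht'
  have loc : ∀ (K : Type) [Field K] [CharZero K] (a b ε m : ℤ) (t : K), a ≠ 0 →
      (∃ x y : K, a * x ^ 2 + b * y ^ 2 = ε * t) →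
      (∃ s : K, s ≠ 0 ∧ ((q * m : ℤ) : K) = t * s ^ 2) →
      Hilbert K ((-a * b : ℤ) : K) ((q * (a * (ε * m)) : ℤ) : K) := by
    rintro K _ _ a b ε m t ha ⟨x, y, hxy⟩ ⟨s, -, h⟩
    have := ternary_of_eq_mul_sq (u := ((ε * (q * m) : ℤ) : K)) (by exact_mod_cast ha)
      (by rw [Int.cast_mul, h, mul_assoc]) hxy
    convert this using 1 <;> (push_cast; ring)
  have hNdvd : ∀ p : ℕ, (p : ℤ) ∣ a * b * (d 0 * d 1) → p ∣ N := fun p hp =>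
    Dvd.dvd.mul_left (Int.natCast_dvd.1 hp) _
  have e1 : ∀ p : ℕ, p.Prime → (p : ℤ) ∣ a * b * (1 * m) → p ∣ N := fun p hp hpd => by
    rcases (Nat.prime_iff_prime_int.1 hp).dvd_or_dvd hpd with h1 | h1
    · exact hNdvd p (h1.mul_right _)
    · exact hmN p hp (by simpa using h1)
  have e2 : ∀ p : ℕ, p.Prime → (p : ℤ) ∣ d 0 * d 1 * (-1 * m) → p ∣ N := fun p hp hpd => by
    rcases (Nat.prime_iff_prime_int.1 hp).dvd_or_dvd hpd with h1 | h1
    · exact hNdvd p (h1.mul_left _)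
    · exact hmN p hp (by simpa using h1)
  obtain ⟨x, y, z, h0, hxyz⟩ := ternary_rat ha hb hq hqN (dvd_mul_right _ _) e1
    (fun p hp hpN => loc _ a b 1 m _ ha (by simpa using hab ⟨p, hp.out⟩)
      (hqm ⟨p, hp.out⟩ hpN)) (loc _ a b 1 m _ ha (by simpa using hab') hqm')
  obtain ⟨u, v, w, h0', huvw⟩ := ternary_rat (hd 0) (hd 1) hq hqN (dvd_mul_right _ _) e2
    (fun p hp hpN => loc _ (d 0) (d 1) (-1) m _ (hd 0) (by simpa using hcd ⟨p, hp.out⟩)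
      (hqm ⟨p, hp.out⟩ hpN)) (loc _ (d 0) (d 1) (-1) m _ (hd 0) (by simpa using hcd') hqm')
  obtain ⟨x, y, hxy⟩ := binary_isotropic_or_value (by exact_mod_cast ha) (by exact_mod_cast hb)
    h0 hxyz
  obtain ⟨u, v, huv⟩ := binary_isotropic_or_value (by exact_mod_cast hd 0)
    (by exact_mod_cast hd 1) h0' huvw
  have hm : (q * m : ℤ) ≠ 0 := by
    obtain ⟨s, hs, h⟩ := hqm'
    have : ((q * m : ℤ) : ℝ) ≠ 0 := by rw [h]; exact mul_ne_zero ht' (pow_ne_zero 2 hs)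
    exact_mod_cast this
  refine DiagIsotropic.of_value (t := q * m) (by exact_mod_cast hm) (x := x) (y := y)
    (by rw [hxy]; push_cast; ring) (diagIsotropic_cons_iff.2 ⟨1, ![u, v], by simp, ?_⟩)
  rw [Fin.sum_univ_two]
  simp only [Matrix.cons_val_zero, Matrix.cons_val_one]
  push_cast at huv ⊢
  linear_combination huv

/-- The Hasse principle for diagonal forms with nonzero integral coefficients. -/
theorem diagIsotropic_rat {n : ℕ} {d : Fin n → ℤ} (hd : ∀ i, d i ≠ 0) (h : LocallyIsotropic d) :
    DiagIsotropic ℚ d := by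
  match n with
  | 0 =>
    obtain ⟨v, hv, -⟩ := h.2
    exact absurd (Subsingleton.elim _ _) hv
  | 1 =>
    obtain ⟨v, hv, h⟩ := h.2
    refine absurd (funext fun i => ?_) hv
    rw [Fin.sum_univ_one, mul_eq_zero, Int.cast_eq_zero] at h
    rw [Subsingleton.elim i 0]
    simpa using h.resolve_left (hd 0)
  | 2 =>
    have key : ∀ (K : Type) [Field K] [CharZero K],
        DiagIsotropic K d ↔ IsSquare ((-d 0 * d 1 : ℤ) : K) := by
      intro K _ _
      have h1 : (d 1 : K) ≠ 0 := by exact_mod_cast hd 1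
      push_cast
      rw [isSquare_iff_binary h1]
      constructor
      · rintro ⟨v, hv, h⟩
        refine ⟨v 0, v 1, ?_, by rwa [Fin.sum_univ_two] at h⟩
        by_contra! h0
        exact hv (funext fun i => by fin_cases i <;> simp [h0])
      · rintro ⟨x, y, h0, h⟩
        refine ⟨![x, y], ?_, by simpa using h⟩
        intro h1
        have e0 := congrFun h1 0
        have e1 := congrFun h1 1
        simp at e0 e1
        simp_all
    rw [key]
    exact isSquare_rat (fun p _ => (key _).1 (h.1 p)) ((key _).1 h.2)
  | 3 =>
    obtain ⟨a, d, rfl⟩ : ∃ a d', d = Fin.cons a d' :=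
      ⟨d 0, Fin.tail d, (Fin.cons_self_tail d).symm⟩
    obtain ⟨b, d, rfl⟩ : ∃ a d', d = Fin.cons a d' :=
      ⟨d 0, Fin.tail d, (Fin.cons_self_tail d).symm⟩
    obtain ⟨c, d, rfl⟩ : ∃ a d', d = Fin.cons a d' :=
      ⟨d 0, Fin.tail d, (Fin.cons_self_tail d).symm⟩
    have ha : a ≠ 0 := hd 0
    have hb : b ≠ 0 := hd 1
    have hc : c ≠ 0 := hd 2
    have hd : d = Fin.elim0 := Subsingleton.elim _ _
    subst hd
    have key : ∀ (K : Type) [Field K] [CharZero K],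
        DiagIsotropic K (Fin.cons a (Fin.cons b (Fin.cons c Fin.elim0)) : Fin 3 → ℤ) ↔
          Hilbert K ((-a * b : ℤ) : K) ((-a * c : ℤ) : K) := fun K _ _ =>
      diagIsotropic_fin_three (by exact_mod_cast ha)
    rw [key]
    exact hilbert_rat (mul_ne_zero (neg_ne_zero.2 ha) hb) (mul_ne_zero (neg_ne_zero.2 ha) hc)
      (fun p _ => (key _).1 (h.1 p)) ((key _).1 h.2)
  | n + 4 =>
    induction n with
    | zero => exact diagIsotropic_rat_four hd h
    | succ n ih => exact diagIsotropic_rat_succ ih hd h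

open Matrix Module

theorem exists_diagonalization {n : ℕ} {M : Matrix (Fin n) (Fin n) ℚ} (hM : M.IsSymm) :
    ∃ (P P' : Matrix (Fin n) (Fin n) ℚ) (D : Fin n → ℚ), P' * P = 1 ∧ P * P' = 1 ∧
      Pᵀ * M * P = diagonal D := by
  have : Invertible (2 : ℚ) := invertibleOfNonzero two_ne_zero
  have hB : LinearMap.IsSymm (Matrix.toBilin' M) := ⟨fun x y => by
    rw [Matrix.toBilin'_apply', Matrix.toBilin'_apply', dotProduct_mulVec, dotProduct_comm,
      ← mulVec_transpose, hM.eq]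
    rfl⟩
  obtain ⟨v, hv⟩ := LinearMap.BilinForm.exists_orthogonal_basis hB
  let w := v.reindex (finCongr (Module.finrank_fin_fun ℚ))
  let e := Pi.basisFun ℚ (Fin n)
  refine ⟨e.toMatrix w, w.toMatrix e, fun i => Matrix.toBilin' M (w i) (w i),
    Basis.toMatrix_mul_toMatrix_flip _ _, Basis.toMatrix_mul_toMatrix_flip _ _, ?_⟩
  have h1 : LinearMap.BilinForm.toMatrix e (Matrix.toBilin' M) = M := by
    exact LinearMap.BilinForm.toMatrix'_toBilin' M
  have h2 := LinearMap.BilinForm.toMatrix_mul_basis_toMatrix e w (Matrix.toBilin' M)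
  rw [h1] at h2
  rw [h2]
  ext i j
  rw [LinearMap.BilinForm.toMatrix_apply]
  by_cases hij : i = j
  · subst hij; simp
  · rw [diagonal_apply_ne _ hij]
    simp only [w, Basis.reindex_apply]
    exact hv (by simpa using hij)

section Field

variable {K : Type*} [Field K] {n : ℕ}

/-- The quadratic form with Gram matrix `M` has a nonzero solution. -/
def MatIsotropic (M : Matrix (Fin n) (Fin n) K) : Prop :=
  ∃ x : Fin n → K, x ≠ 0 ∧ x ⬝ᵥ (M *ᵥ x) = 0

theorem MatIsotropic.of_congr {M P P' : Matrix (Fin n) (Fin n) K} (h1 : P' * P = 1)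
    (h : MatIsotropic (Pᵀ * M * P)) : MatIsotropic M := by
  obtain ⟨x, hx0, hx⟩ := h
  refine ⟨P *ᵥ x, fun h => hx0 ?_, ?_⟩
  · have := congrArg (P' *ᵥ ·) h
    simpa [mulVec_mulVec, h1] using this
  · rw [← hx, ← mulVec_mulVec, ← mulVec_mulVec, dotProduct_mulVec x, vecMul_transpose]

theorem matIsotropic_congr_iff {M P P' : Matrix (Fin n) (Fin n) K} (h1 : P' * P = 1)
    (h2 : P * P' = 1) : MatIsotropic (Pᵀ * M * P) ↔ MatIsotropic M := by
  refine ⟨.of_congr h1, fun h => .of_congr (P := P') (P' := P) h2 ?_⟩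
  have : P'ᵀ * (Pᵀ * M * P) * P' = M := by
    calc P'ᵀ * (Pᵀ * M * P) * P' = (P * P')ᵀ * M * (P * P') := by
          rw [transpose_mul]; simp only [Matrix.mul_assoc]
      _ = M := by simp [h2]
  rwa [this]

theorem matIsotropic_diagonal_iff {D : Fin n → K} {d : Fin n → ℤ} {c : Fin n → K}
    (hc : ∀ i, c i ≠ 0) (hd : ∀ i, (d i : K) = D i * c i ^ 2) :
    MatIsotropic (diagonal D) ↔ DiagIsotropic K d := by
  have e : ∀ x : Fin n → K, x ⬝ᵥ (diagonal D *ᵥ x) = ∑ i, D i * x i ^ 2 := fun x =>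
    Finset.sum_congr rfl fun i _ => by rw [mulVec_diagonal]; ring
  constructor
  · rintro ⟨x, hx0, hx⟩
    refine ⟨fun i => x i / c i, fun h => hx0 (funext fun i => ?_), ?_⟩
    · simpa [hc i] using congrFun h i
    · rw [← hx, e]
      refine Finset.sum_congr rfl fun i _ => ?_
      have := hc i
      rw [hd]
      field_simp
  · rintro ⟨x, hx0, hx⟩
    refine ⟨fun i => x i * c i, fun h => hx0 (funext fun i => ?_), ?_⟩
    · simpa [hc i] using congrFun h i
    · rw [← hx, e]
      refine Finset.sum_congr rfl fun i _ => ?_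
      rw [hd]
      ring

end Field

/-- The Gram matrix of the quadratic form `∑_{i ≤ j} a_{ij} x_i x_j`. -/
def gramMatrix {n : ℕ} (a : Fin n → Fin n → ℚ) : Matrix (Fin n) (Fin n) ℚ :=
  Matrix.of fun i j => ((if i ≤ j then a i j else 0) + if j ≤ i then a j i else 0) / 2

theorem gramMatrix_isSymm {n : ℕ} (a : Fin n → Fin n → ℚ) : (gramMatrix a).IsSymm := by
  ext i j
  simp [gramMatrix, add_comm]

theorem sum_eq_dotProduct {n : ℕ} (a : Fin n → Fin n → ℚ) {K : Type*} [Field K] [CharZero K]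
    (x : Fin n → K) :
    ∑ i, ∑ j, (if i ≤ j then (a i j : K) * x i * x j else 0) =
      x ⬝ᵥ ((gramMatrix a).map (Rat.castHom K) *ᵥ x) := by
  let A : Fin n → Fin n → K := fun i j => if i ≤ j then (a i j : K) * x i * x j else 0
  have h : x ⬝ᵥ ((gramMatrix a).map (Rat.castHom K) *ᵥ x) = ∑ i, ∑ j, (A i j + A j i) / 2 := by
    simp only [dotProduct, mulVec, Finset.mul_sum]
    refine Finset.sum_congr rfl fun i _ => Finset.sum_congr rfl fun j _ => ?_
    simp only [A, gramMatrix, map_apply, of_apply, Rat.coe_castHom]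
    split_ifs <;> push_cast <;> ring
  rw [h]
  simp_rw [add_div, Finset.sum_add_distrib]
  rw [Finset.sum_comm (f := fun i j => A j i / 2), ← Finset.sum_add_distrib]
  refine Finset.sum_congr rfl fun i _ => ?_
  rw [← Finset.sum_add_distrib]
  exact Finset.sum_congr rfl fun j _ => (add_halves _).symm

/-- A rational quadratic form is equivalent to a diagonal form with integral coefficients. -/
theorem exists_diagIsotropic_iff {n : ℕ} (a : Fin n → Fin n → ℚ) :
    ∃ d : Fin n → ℤ, ∀ (K : Type) [Field K] [CharZero K],
      (∃ x : Fin n → K, x ≠ 0 ∧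
        ∑ i, ∑ j, (if i ≤ j then (a i j : K) * x i * x j else 0) = 0) ↔ DiagIsotropic K d := by
  obtain ⟨P, P', D, h1, h2, hP⟩ := exists_diagonalization (gramMatrix_isSymm a)
  refine ⟨fun i => (D i).num * (D i).den, fun K _ _ => ?_⟩
  simp_rw [sum_eq_dotProduct]
  change MatIsotropic ((gramMatrix a).map (Rat.castHom K)) ↔ _
  have h1K : P'.map (Rat.castHom K) * P.map (Rat.castHom K) = 1 := by
    rw [← Matrix.map_mul, h1, Matrix.map_one _ (map_zero _) (map_one _)]
  have h2K : P.map (Rat.castHom K) * P'.map (Rat.castHom K) = 1 := by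
    rw [← Matrix.map_mul, h2, Matrix.map_one _ (map_zero _) (map_one _)]
  rw [← matIsotropic_congr_iff h1K h2K, ← transpose_map, ← Matrix.map_mul, ← Matrix.map_mul, hP,
    Matrix.diagonal_map (map_zero _)]
  refine matIsotropic_diagonal_iff (c := fun i => ((D i).den : K)) (by simp) fun i => ?_
  have h : (((D i).num : ℚ) : K) = ((D i * (D i).den : ℚ) : K) := by rw [Rat.mul_den_eq_num]
  push_cast at h ⊢
  rw [h, Rat.coe_castHom]
  ring

theorem diagIsotropic_of_eq_zero {K : Type*} [Field K] {n : ℕ} {d : Fin n → ℤ} {i : Fin n}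
    (h : d i = 0) : DiagIsotropic K d := by
  refine ⟨Pi.single i 1, by simp, Finset.sum_eq_zero fun j _ => ?_⟩
  by_cases hj : j = i
  · subst hj; simp [h]
  · simp [hj]

theorem DiagIsotropic.of_rat {n : ℕ} {d : Fin n → ℤ} (h : DiagIsotropic ℚ d) (K : Type*) [Field K]
    [CharZero K] : DiagIsotropic K d := by
  obtain ⟨x, hx0, hx⟩ := h
  refine ⟨fun i => x i, fun h => hx0 (funext fun i => ?_), ?_⟩
  · simpa using congrFun h i
  · have := congrArg (Rat.cast : ℚ → K) hx
    push_cast at this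
    exact this

theorem diagIsotropic_rat_iff {n : ℕ} {d : Fin n → ℤ} :
    DiagIsotropic ℚ d ↔ LocallyIsotropic d := by
  refine ⟨fun h => ⟨fun p _ => h.of_rat _, h.of_rat _⟩, fun h => ?_⟩
  by_cases hd : ∃ i, d i = 0
  · obtain ⟨i, hi⟩ := hd
    exact diagIsotropic_of_eq_zero hi
  · push Not at hd
    exact diagIsotropic_rat hd h

end HasseMinkowski

/-- Hasse–Minkowski theorem: a quadratic form
`Q(x₁,…,xₙ) = ∑_{i ≤ j} a_{ij} x_i x_j` with rational coefficients has a nonzero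
rational zero if and only if it has a nonzero zero over `ℚ_p` for every prime `p`
and a nonzero real zero. -/
theorem hasse_minkowski {n : ℕ} (a : Fin n → Fin n → ℚ) :
    (∃ x : Fin n → ℚ, x ≠ 0 ∧
        ∑ i : Fin n, ∑ j : Fin n, (if i ≤ j then a i j * x i * x j else 0) = 0) ↔
      ((∀ (p : ℕ) [Fact p.Prime], ∃ x : Fin n → ℚ_[p], x ≠ 0 ∧
          ∑ i : Fin n, ∑ j : Fin n,
            (if i ≤ j then (a i j : ℚ_[p]) * x i * x j else 0) = 0) ∧
        (∃ x : Fin n → ℝ, x ≠ 0 ∧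
          ∑ i : Fin n, ∑ j : Fin n,
            (if i ≤ j then (a i j : ℝ) * x i * x j else 0) = 0)) := by
  obtain ⟨d, hd⟩ := HasseMinkowski.exists_diagIsotropic_iff a
  rw [hd ℝ]
  simp only [hd ℚ_[_]]
  exact Iff.trans (by simpa using hd ℚ) HasseMinkowski.diagIsotropic_rat_iff
end

section
/- Let k be a field with algebraic closure k̄, and let A, A' ∈ M_{n×n}(k) be two n×n matrices with entries in k. If A and A' are conjugate by an element of GL(n, k̄), i.e. there exists an invertible matrix M over k̄ with A' = M A M⁻¹, then A and A' are conjugate by an element of GL(n, k), i.e. there exists an invertible matrix N over k with A' = N A N⁻¹. -/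
open Polynomial
open scoped Matrix

namespace Matrix

variable {m k K : Type*} [Fintype m] [DecidableEq m] [Field k] [Field K]

theorem rank_map_ringHom (φ : k →+* K) (A : Matrix m m k) : (A.map φ).rank = A.rank := by
  classical
  obtain ⟨L, L', D, rfl⟩ := Pivot.exists_list_transvec_mul_diagonal_mul_list_transvec A
  have hL (L : List (TransvectionStruct m k)) :
      IsUnit (L.map TransvectionStruct.toMatrix).prod.det := by
    simp [TransvectionStruct.det_toMatrix_prod]
  have hL' (L : List (TransvectionStruct m k)) :
      IsUnit ((L.map TransvectionStruct.toMatrix).prod.map φ).det := by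
    rw [← RingHom.mapMatrix_apply, ← RingHom.map_det]
    exact (hL L).map φ
  rw [Matrix.map_mul, Matrix.map_mul, rank_mul_eq_left_of_isUnit_det _ _ (hL' L'),
    rank_mul_eq_right_of_isUnit_det _ _ (hL' L), rank_mul_eq_left_of_isUnit_det _ _ (hL L'),
    rank_mul_eq_right_of_isUnit_det _ _ (hL L), diagonal_map (map_zero φ), rank_diagonal,
    rank_diagonal]
  exact Fintype.card_congr (Equiv.subtypeEquivRight fun i => by simp)

end Matrix

universe u

namespace Polynomial

variable {k : Type*} [Field k]

section Corank

variable (M : Type*) [AddCommGroup M] [Module k M] [Module k[X] M] [IsScalarTower k k[X] M]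

/-- The dimension over `k` of the cokernel of multiplication by `f` on a `k[X]`-module. -/
noncomputable def smulCorank (f : k[X]) : ℕ :=
  Module.finrank k (M ⧸ LinearMap.range (LinearMap.lsmul k[X] M f))

variable {M} {N : Type*} [AddCommGroup N] [Module k N] [Module k[X] N] [IsScalarTower k k[X] N]

theorem smulCorank_congr (e : M ≃ₗ[k[X]] N) (f : k[X]) : smulCorank M f = smulCorank N f := by
  refine LinearEquiv.finrank_eq ((Submodule.Quotient.equiv _ _ e ?_).restrictScalars k)
  ext x
  constructor
  · rintro ⟨_, ⟨y, rfl⟩, rfl⟩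
    exact ⟨e y, by simp⟩
  · rintro ⟨y, rfl⟩
    exact ⟨f • e.symm y, ⟨e.symm y, rfl⟩, by simp⟩

theorem smulCorank_pi {ι : Type*} [Fintype ι] (M : ι → Type*) [∀ i, AddCommGroup (M i)]
    [∀ i, Module k (M i)] [∀ i, Module k[X] (M i)] [∀ i, IsScalarTower k k[X] (M i)]
    [∀ i, Module.Finite k (M i)] (f : k[X]) :
    smulCorank (∀ i, M i) f = ∑ i, smulCorank (M i) f := by
  classical
  have h : LinearMap.range (LinearMap.lsmul k[X] (∀ i, M i) f) =
      Submodule.pi Set.univ fun i => LinearMap.range (LinearMap.lsmul k[X] (M i) f) := by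
    ext x
    constructor
    · rintro ⟨y, rfl⟩ i -
      exact ⟨y i, rfl⟩
    · intro hx
      choose y hy using fun i => hx i trivial
      exact ⟨y, by funext i; exact hy i⟩
  unfold smulCorank
  rw [h, ← Module.finrank_pi_fintype]
  exact LinearEquiv.finrank_eq ((Submodule.quotientPi _).restrictScalars k)

end Corank

theorem smulCorank_quotient (I : Ideal k[X]) (f : k[X]) :
    smulCorank (k[X] ⧸ I) f = Module.finrank k (k[X] ⧸ I ⊔ Ideal.span {f}) := by
  have h : LinearMap.range (LinearMap.lsmul k[X] (k[X] ⧸ I) f) =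
      Submodule.map (Submodule.mkQ I) (Ideal.span {f}) := by
    ext x
    constructor
    · rintro ⟨y, rfl⟩
      obtain ⟨y, rfl⟩ := Submodule.mkQ_surjective I y
      exact ⟨f * y, Ideal.mem_span_singleton.2 ⟨y, rfl⟩, rfl⟩
    · rintro ⟨y, hy, rfl⟩
      obtain ⟨y, rfl⟩ := Ideal.mem_span_singleton.1 hy
      exact ⟨Submodule.mkQ I y, rfl⟩
  unfold smulCorank
  rw [h]
  exact LinearEquiv.finrank_eq
    ((Submodule.quotientQuotientEquivQuotientSup I (Ideal.span {f})).restrictScalars k)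

open Classical in
theorem smulCorank_quotient_pow {p q : k[X]} (hp : Irreducible p) (hq : Irreducible q)
    (e m : ℕ) :
    smulCorank (k[X] ⧸ Ideal.span {q ^ e}) (p ^ m) =
      if Associated p q then min e m * p.natDegree else 0 := by
  rw [smulCorank_quotient]
  split_ifs with h
  · have hs : Ideal.span {q ^ e} ⊔ Ideal.span {p ^ m} = Ideal.span {p ^ min e m} := by
      rw [Ideal.span_singleton_eq_span_singleton.2 (h.symm.pow_pow (n := e))]
      rcases le_total e m with hem | hem
      · rw [min_eq_left hem, sup_eq_left]
        exact Ideal.span_singleton_le_span_singleton.2 (pow_dvd_pow p hem)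
      · rw [min_eq_right hem, sup_eq_right]
        exact Ideal.span_singleton_le_span_singleton.2 (pow_dvd_pow p hem)
    rw [hs, finrank_quotient_span_eq_natDegree, natDegree_pow]
  · have hs : Ideal.span {q ^ e} ⊔ Ideal.span {p ^ m} = Ideal.span {1} := by
      rw [Ideal.span_singleton_one, ← Ideal.isCoprime_iff_sup_eq,
        Ideal.isCoprime_span_singleton_iff]
      exact (hp.coprime_iff_not_dvd.2 fun hd => h (hp.associated_of_dvd hq hd)).symm.pow
    rw [hs, finrank_quotient_span_eq_natDegree, natDegree_one]

theorem span_pow_eq_span_pow_iff {p q : k[X]} (hp : Irreducible p) (hq : Irreducible q)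
    {e m : ℕ} (hm : m ≠ 0) :
    Ideal.span {q ^ e} = Ideal.span {p ^ m} ↔ Associated p q ∧ e = m := by
  rw [Ideal.span_singleton_eq_span_singleton]
  constructor
  · intro h
    have hpq : Associated p q :=
      hp.associated_of_dvd hq
        (hp.prime.dvd_of_dvd_pow ((dvd_pow_self p hm).trans h.symm.dvd))
    refine ⟨hpq, ?_⟩
    have := natDegree_eq_of_degree_eq (degree_eq_degree_of_associated
      ((hpq.pow_pow (n := e)).trans h))
    rw [natDegree_pow, natDegree_pow] at this
    exact Nat.eq_of_mul_eq_mul_right hp.natDegree_pos this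
  · rintro ⟨h, rfl⟩
    exact h.symm.pow_pow

open Classical in
/-- The multiplicity of a primary cyclic summand is a second difference of coranks. -/
theorem card_mul_natDegree_eq {ι : Type*} [Fintype ι] {p : ι → k[X]} (hp : ∀ i, Irreducible (p i))
    (e : ι → ℕ) {q : k[X]} (hq : Irreducible q) (m : ℕ) :
    Fintype.card {i // Ideal.span {p i ^ e i} = Ideal.span {q ^ (m + 1)}} * q.natDegree +
        smulCorank (∀ i, k[X] ⧸ Ideal.span {p i ^ e i}) (q ^ m) +
        smulCorank (∀ i, k[X] ⧸ Ideal.span {p i ^ e i}) (q ^ (m + 2)) =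
      2 * smulCorank (∀ i, k[X] ⧸ Ideal.span {p i ^ e i}) (q ^ (m + 1)) := by
  have hfin (i : ι) : Module.Finite k (k[X] ⧸ Ideal.span {p i ^ e i}) :=
    (AdjoinRoot.powerBasis (pow_ne_zero (e i) (hp i).ne_zero)).finite
  simp only [smulCorank_pi, smulCorank_quotient_pow hq (hp _)]
  rw [Fintype.card_subtype, Finset.card_filter, Finset.sum_mul, Finset.mul_sum,
    ← Finset.sum_add_distrib, ← Finset.sum_add_distrib]
  refine Finset.sum_congr rfl fun i _ => ?_
  simp only [span_pow_eq_span_pow_iff hq (hp i) m.succ_ne_zero]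
  by_cases h : Associated q (p i)
  · simp only [h, true_and, if_true]
    rw [← add_mul, ← add_mul, ← mul_assoc]
    congr 1
    split_ifs <;> omega
  · simp [h]

theorem exists_equiv_pi_quotient {k : Type u} [Field k] {M : Type*} [AddCommGroup M] [Module k[X] M]
    [Module.Finite k[X] M] (hM : Module.IsTorsion k[X] M) :
    ∃ (ι : Type u) (_ : Fintype ι) (p : ι → k[X]) (e : ι → ℕ), (∀ i, Irreducible (p i)) ∧
      (∀ i, e i ≠ 0) ∧ Nonempty (M ≃ₗ[k[X]] ∀ i, k[X] ⧸ Ideal.span {p i ^ e i}) := by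
  classical
  obtain ⟨ι, _, p, hp, e, ⟨φ⟩⟩ := Module.equiv_directSum_of_isTorsion hM
  let r : (∀ i, k[X] ⧸ Ideal.span {p i ^ e i}) →ₗ[k[X]]
      ∀ i : {i // e i ≠ 0}, k[X] ⧸ Ideal.span {p i ^ e i} :=
    LinearMap.pi fun i => LinearMap.proj i.1
  have hr : Function.Bijective r := by
    constructor
    · intro x y hxy
      funext i
      by_cases hi : e i = 0
      · have : Subsingleton (k[X] ⧸ Ideal.span {p i ^ e i}) := by
          rw [Ideal.Quotient.subsingleton_iff, hi, pow_zero, Ideal.span_singleton_one]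
        exact Subsingleton.elim _ _
      · exact congrFun hxy ⟨i, hi⟩
    · intro y
      refine ⟨fun i => if hi : e i ≠ 0 then y ⟨i, hi⟩ else 0, ?_⟩
      funext i
      exact dif_pos i.2
  exact ⟨{i // e i ≠ 0}, inferInstance, fun i => p i, fun i => e i, fun i => hp i, fun i => i.2,
    ⟨φ.trans ((DirectSum.linearEquivFunOnFintype k[X] ι _).trans (.ofBijective r hr))⟩⟩

/-- Finitely generated torsion `k[X]`-modules are classified by the coranks of the
multiplication maps. -/
theorem nonempty_linearEquiv_of_smulCorank_eq {M N : Type*}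
    [AddCommGroup M] [Module k M] [Module k[X] M] [IsScalarTower k k[X] M]
    [Module.Finite k[X] M] [AddCommGroup N] [Module k N] [Module k[X] N] [IsScalarTower k k[X] N]
    [Module.Finite k[X] N] (hM : Module.IsTorsion k[X] M) (hN : Module.IsTorsion k[X] N)
    (h : ∀ f : k[X], smulCorank M f = smulCorank N f) : Nonempty (M ≃ₗ[k[X]] N) := by
  classical
  obtain ⟨ι, _, p, e, hp, he, ⟨φ⟩⟩ := exists_equiv_pi_quotient hM
  obtain ⟨κ, _, q, d, hq, hd, ⟨ψ⟩⟩ := exists_equiv_pi_quotient hN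
  have key {r : k[X]} (hr : Irreducible r) {m : ℕ} (hm : m ≠ 0) :
      Fintype.card {i // Ideal.span {p i ^ e i} = Ideal.span {r ^ m}} =
        Fintype.card {j // Ideal.span {q j ^ d j} = Ideal.span {r ^ m}} := by
    obtain ⟨m, rfl⟩ := Nat.exists_eq_succ_of_ne_zero hm
    have h₁ := card_mul_natDegree_eq hp e hr m
    have h₂ := card_mul_natDegree_eq hq d hr m
    simp only [← smulCorank_congr φ, h] at h₁
    simp only [← smulCorank_congr ψ] at h₂
    exact Nat.eq_of_mul_eq_mul_right hr.natDegree_pos (by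
      simp only [Nat.succ_eq_add_one]; omega)
  have hcard (J : Ideal k[X]) : Nonempty
      ({i // Ideal.span {p i ^ e i} = J} ≃ {j // Ideal.span {q j ^ d j} = J}) := by
    by_cases hJ : ∃ r : k[X], Irreducible r ∧ ∃ m ≠ 0, J = Ideal.span {r ^ m}
    · obtain ⟨r, hr, m, hm, rfl⟩ := hJ
      exact ⟨Fintype.equivOfCardEq (key hr hm)⟩
    · have : IsEmpty {i // Ideal.span {p i ^ e i} = J} :=
        ⟨fun i => hJ ⟨_, hp i, _, he i, i.2.symm⟩⟩
      have : IsEmpty {j // Ideal.span {q j ^ d j} = J} :=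
        ⟨fun j => hJ ⟨_, hq j, _, hd j, j.2.symm⟩⟩
      exact ⟨Equiv.equivOfIsEmpty _ _⟩
  let σ : ι ≃ κ := Equiv.ofFiberEquiv fun J => (hcard J).some
  have hσ (i : ι) : Ideal.span {p i ^ e i} = Ideal.span {q (σ i) ^ d (σ i)} :=
    (Equiv.ofFiberEquiv_map (fun J => (hcard J).some) i).symm
  exact ⟨φ.trans ((LinearEquiv.piCongrRight fun i => Submodule.quotEquivOfEq _ _ (hσ i)).trans
    ((LinearEquiv.piCongrLeft k[X] (fun j => k[X] ⧸ Ideal.span {q j ^ d j}) σ).trans ψ.symm))⟩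

theorem smulCorank_aeval {n : ℕ} (A : Matrix (Fin n) (Fin n) k) (f : k[X]) :
    smulCorank (Module.AEval' (Matrix.toLin' A)) f = n - (aeval A f).rank := by
  let φ := Matrix.toLin' A
  have h : (LinearMap.range (LinearMap.lsmul k[X] (Module.AEval' φ) f)).restrictScalars k =
      (LinearMap.range (Matrix.toLin' (aeval A f))).map
        (Module.AEval'.of φ : (Fin n → k) →ₗ[k] Module.AEval' φ) := by
    have hf : Matrix.toLin' (aeval A f) = aeval φ f :=
      (aeval_algHom_apply (Matrix.toLinAlgEquiv' : _ ≃ₐ[k] _).toAlgHom A f).symm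
    rw [hf]
    ext x
    constructor
    · rintro ⟨y, rfl⟩
      exact ⟨_, ⟨(Module.AEval'.of φ).symm y, rfl⟩, rfl⟩
    · rintro ⟨_, ⟨y, rfl⟩, rfl⟩
      exact ⟨Module.AEval'.of φ y, rfl⟩
  have hr := Submodule.finrank_quotient_add_finrank
    ((LinearMap.range (LinearMap.lsmul k[X] (Module.AEval' φ) f)).restrictScalars k)
  have hdim : Module.finrank k (Module.AEval' φ) = n :=
    (Module.AEval'.of φ).finrank_eq.symm.trans (Module.finrank_fin_fun k)
  have hrank : Module.finrank k
      ((LinearMap.range (LinearMap.lsmul k[X] (Module.AEval' φ) f)).restrictScalars k) =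
      (aeval A f).rank := by
    rw [h, LinearEquiv.finrank_map_eq, Matrix.rank, Matrix.toLin'_apply']
  rw [hdim, hrank] at hr
  exact Nat.eq_sub_of_add_eq hr

end Polynomial

/-- Two square matrices over a field are similar if evaluating any polynomial at them gives
matrices of the same rank. -/
theorem Matrix.exists_conj_of_rank_aeval_eq {k : Type*} [Field k] {n : ℕ}
    {A B : Matrix (Fin n) (Fin n) k} (h : ∀ f : k[X], (aeval A f).rank = (aeval B f).rank) :
    ∃ N : GL (Fin n) k,
      B = (N : Matrix (Fin n) (Fin n) k) * A * (↑N⁻¹ : Matrix (Fin n) (Fin n) k) := by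
  obtain ⟨e⟩ := Polynomial.nonempty_linearEquiv_of_smulCorank_eq
    (M := Module.AEval' (Matrix.toLin' A)) (N := Module.AEval' (Matrix.toLin' B))
    (Module.AEval.isTorsion_of_finiteDimensional _ _ _)
    (Module.AEval.isTorsion_of_finiteDimensional _ _ _)
    fun f => by rw [smulCorank_aeval, smulCorank_aeval, h]
  let g : (Fin n → k) ≃ₗ[k] (Fin n → k) := (Module.AEval'.of (Matrix.toLin' A)).trans
    ((e.restrictScalars k).trans (Module.AEval'.of (Matrix.toLin' B)).symm)
  have hg (v : Fin n → k) : g (A *ᵥ v) = B *ᵥ g v := by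
    have := e.map_smul (X : k[X]) (Module.AEval'.of (Matrix.toLin' A) v)
    rw [Module.AEval'.X_smul_of] at this
    change (Module.AEval'.of (Matrix.toLin' B)).symm
      (e (Module.AEval'.of (Matrix.toLin' A) (Matrix.toLin' A v))) = _
    rw [this, Module.AEval'.of_symm_X_smul]
    rfl
  let N : GL (Fin n) k := ⟨LinearMap.toMatrix' g, LinearMap.toMatrix' g.symm,
    by rw [← LinearMap.toMatrix'_comp]; simp, by rw [← LinearMap.toMatrix'_comp]; simp⟩
  refine ⟨N, ?_⟩
  rw [Units.eq_mul_inv_iff_mul_eq]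
  apply Matrix.toLin'.injective
  refine LinearMap.ext fun v => ?_
  simpa [N, Matrix.toLin'_mul] using (hg v).symm

/-- If two `n × n` matrices over a field `k` are conjugate by an
invertible matrix over an algebraic closure `K` of `k`, then they are conjugate by
an invertible matrix over `k`. -/
theorem conjugate_over_closure_implies_conjugate {k K : Type*} [Field k] [Field K]
    [Algebra k K] [IsAlgClosure k K] {n : ℕ} (A A' : Matrix (Fin n) (Fin n) k)
    (h : ∃ M : GL (Fin n) K,
      A'.map (algebraMap k K) =
        (M : Matrix (Fin n) (Fin n) K) * A.map (algebraMap k K) *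
          (↑M⁻¹ : Matrix (Fin n) (Fin n) K)) :
    ∃ N : GL (Fin n) k,
      A' = (N : Matrix (Fin n) (Fin n) k) * A * (↑N⁻¹ : Matrix (Fin n) (Fin n) k) := by
  obtain ⟨M, hM⟩ := h
  refine Matrix.exists_conj_of_rank_aeval_eq fun f => ?_
  have hmap (B : Matrix (Fin n) (Fin n) k) :
      (aeval B f).map (algebraMap k K) = aeval (B.map (algebraMap k K)) f :=
    (aeval_algHom_apply (Algebra.ofId k K).mapMatrix B f).symm
  have hconj : aeval (A'.map (algebraMap k K)) f =
      (M : Matrix (Fin n) (Fin n) K) * aeval (A.map (algebraMap k K)) f *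
        (↑M⁻¹ : Matrix (Fin n) (Fin n) K) := by
    rw [hM]
    exact aeval_algHom_apply (MulSemiringAction.toAlgHom k (Matrix (Fin n) (Fin n) K)
      (ConjAct.toConjAct M)) (A.map (algebraMap k K)) f
  rw [← Matrix.rank_map_ringHom (algebraMap k K) (aeval A f),
    ← Matrix.rank_map_ringHom (algebraMap k K) (aeval A' f), hmap, hmap, hconj,
    Matrix.rank_mul_eq_left_of_isUnit_det _ _ ((Matrix.isUnit_iff_isUnit_det _).1 M⁻¹.isUnit),
    Matrix.rank_mul_eq_right_of_isUnit_det _ _ ((Matrix.isUnit_iff_isUnit_det _).1 M.isUnit)]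
end

section
/- Ax–Kochen–Ershov theorem: let φ be a first-order sentence (a formula with no free variables) in the language of rings. Then for all but finitely many prime numbers p, the sentence φ is true in the field ℚ_p of p-adic numbers if and only if φ is true in the field 𝔽_p((t)) of formal Laurent series over the finite field with p elements. -/
open Polynomial

/-- A valuation on a field `K` together with an angular component map to a field `k`,
such that leading terms are additive. -/
structure AngularValuation (K k Γ : Type*) [Field K] [Field k]
    [LinearOrderedCommGroupWithZero Γ] where
  /-- the valuation -/
  v : Valuation K Γ
  /-- the angular component -/
  ac : K →*₀ k
  lead_add' : ∀ (γ : Γ) (x y : K), v x ≤ γ → v y ≤ γ →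
    (if v (x + y) = γ then ac (x + y) else 0) =
      (if v x = γ then ac x else 0) + (if v y = γ then ac y else 0)
  exists_eq : ∀ (γ : Γ) (r : k), γ ≠ 0 → r ≠ 0 → ∃ x, v x = γ ∧ ac x = r

namespace AngularValuation

variable {K K' k Γ : Type*} [Field K] [Field K'] [Field k] [LinearOrderedCommGroupWithZero Γ]

/-- The coefficient of `x` at level `γ`. -/
def lead (V : AngularValuation K k Γ) (γ : Γ) (x : K) : k :=
  if V.v x = γ then V.ac x else 0

/-- Two elements have the same leading term. -/
def Same (V : AngularValuation K k Γ) (V' : AngularValuation K' k Γ) (x : K) (x' : K') : Prop :=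
  V.v x = V'.v x' ∧ V.ac x = V'.ac x'

/-- All nonzero Taylor terms of `Q` at `c`, evaluated at `a`, are bounded by `Q(a)`. -/
def Good (V : AngularValuation K k Γ) (a : K) (Q : K[X]) (c : K) : Prop :=
  ∀ i, V.v ((taylor c Q).coeff i) * V.v (a - c) ^ i ≤ V.v (Q.eval a)

/-- The Newton form of Hensel's lemma. -/
def Henselian (V : AngularValuation K k Γ) : Prop :=
  ∀ R : K[X], (∀ i, V.v (R.coeff i) ≤ 1) → V.v (R.coeff 0) < 1 → V.v (R.coeff 1) = 1 →
    ∃ t, R.eval t = 0 ∧ V.v t ≤ V.v (R.coeff 0)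

/-- Countable saturation for balls around centres, inside the zero set of a polynomial. -/
def Saturated (V : AngularValuation K k Γ) : Prop :=
  ∀ (γ : ℕ → Γ) (r : ℕ → k) (c : ℕ → K) (P : K[X]),
    (∀ n, ∃ x, P.eval x = 0 ∧ ∀ i < n, V.v (x - c i) = γ i ∧ V.ac (x - c i) = r i) →
    ∃ x, P.eval x = 0 ∧ ∀ i, V.v (x - c i) = γ i ∧ V.ac (x - c i) = r i

section Lead

variable (V : AngularValuation K k Γ)

theorem lead_add {γ : Γ} {x y : K} (hx : V.v x ≤ γ) (hy : V.v y ≤ γ) :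
    V.lead γ (x + y) = V.lead γ x + V.lead γ y :=
  V.lead_add' γ x y hx hy

theorem lead_eq_zero_iff {γ : Γ} (hγ : γ ≠ 0) {x : K} : V.lead γ x = 0 ↔ V.v x ≠ γ := by
  unfold lead
  split_ifs with h
  · have : x ≠ 0 := by rintro rfl; simp at h; exact hγ h.symm
    simp [h, this]
  · simp [h]

theorem lead_zero (γ : Γ) : V.lead γ 0 = 0 := by
  simp [lead]

theorem lead_sum {ι : Type*} (s : Finset ι) (t : ι → K) {γ : Γ} (h : ∀ i ∈ s, V.v (t i) ≤ γ) :
    V.lead γ (∑ i ∈ s, t i) = ∑ i ∈ s, V.lead γ (t i) := by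
  classical
  induction s using Finset.induction_on with
  | empty => simp [lead_zero]
  | insert j s hj ih =>
    rw [Finset.sum_insert hj, Finset.sum_insert hj, V.lead_add (h j (by simp)),
      ih fun i hi => h i (Finset.mem_insert_of_mem hi)]
    exact V.v.map_sum_le fun i hi => h i (Finset.mem_insert_of_mem hi)

end Lead

namespace Same

variable {V : AngularValuation K k Γ} {V' : AngularValuation K' k Γ}

theorem symm {x : K} {x' : K'} (h : Same V V' x x') : Same V' V x' x :=
  ⟨h.1.symm, h.2.symm⟩

theorem mul {x y : K} {x' y' : K'} (h : Same V V' x x') (h' : Same V V' y y') :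
    Same V V' (x * y) (x' * y') := by
  simp [Same, h.1, h.2, h'.1, h'.2]

theorem pow {x : K} {x' : K'} (h : Same V V' x x') (n : ℕ) : Same V V' (x ^ n) (x' ^ n) := by
  simp [Same, h.1, h.2]

theorem div {x y : K} {x' y' : K'} (h : Same V V' x x') (h' : Same V V' y y') :
    Same V V' (x / y) (x' / y') := by
  simp [Same, h.1, h.2, h'.1, h'.2]

theorem eq_zero_iff {x : K} {x' : K'} (h : Same V V' x x') : x = 0 ↔ x' = 0 := by
  rw [← V.v.zero_iff, h.1, V'.v.zero_iff]

theorem lead {x : K} {x' : K'} (h : Same V V' x x') (γ : Γ) : V.lead γ x = V'.lead γ x' := by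
  simp [AngularValuation.lead, h.1, h.2]

theorem of_lead {x : K} {x' : K'} (hx : V.v x ≠ 0)
    (h : V.lead (V.v x) x = V'.lead (V.v x) x') : Same V V' x x' := by
  have h1 : V'.v x' = V.v x := by
    by_contra h2
    rw [(V'.lead_eq_zero_iff hx).2 h2, V.lead_eq_zero_iff hx] at h
    exact h rfl
  refine ⟨h1.symm, ?_⟩
  simpa [AngularValuation.lead, h1] using h

theorem sum_lead {ι : Type*} {s : Finset ι} {t : ι → K} {t' : ι → K'} {γ : Γ}
    (h : ∀ i ∈ s, Same V V' (t i) (t' i)) (hb : ∀ i ∈ s, V.v (t i) ≤ γ) :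
    V.lead γ (∑ i ∈ s, t i) = V'.lead γ (∑ i ∈ s, t' i) := by
  rw [V.lead_sum s t hb, V'.lead_sum s t' fun i hi => (h i hi).1 ▸ hb i hi]
  exact Finset.sum_congr rfl fun i hi => (h i hi).lead γ

theorem sum {ι : Type*} {s : Finset ι} {t : ι → K} {t' : ι → K'}
    (h : ∀ i ∈ s, Same V V' (t i) (t' i)) (hb : ∀ i ∈ s, V.v (t i) ≤ V.v (∑ j ∈ s, t j)) :
    Same V V' (∑ i ∈ s, t i) (∑ i ∈ s, t' i) := by
  by_cases h0 : V.v (∑ i ∈ s, t i) = 0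
  · have h1 : ∀ i ∈ s, t i = 0 := fun i hi => by
      have := hb i hi
      rw [h0] at this
      simpa using this
    have h2 : ∀ i ∈ s, t' i = 0 := fun i hi => (h i hi).eq_zero_iff.1 (h1 i hi)
    rw [Finset.sum_eq_zero h1, Finset.sum_eq_zero h2]
    simp [Same]
  · exact of_lead h0 (sum_lead h hb)

theorem add {x y : K} {x' y' : K'} (hx : Same V V' x x') (hy : Same V V' y y')
    (hxb : V.v x ≤ V.v (x + y)) (hyb : V.v y ≤ V.v (x + y)) :
    Same V V' (x + y) (x' + y') := by
  have := sum (V := V) (V' := V') (s := Finset.univ) (t := ![x, y]) (t' := ![x', y'])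
  simp only [Finset.mem_univ, forall_const, Fin.forall_fin_two, Fin.sum_univ_two] at this
  exact this ⟨hx, hy⟩ ⟨hxb, hyb⟩

theorem add_of_lt {x : K} {x' y' : K'} (h : Same V V' x x') (hlt : V'.v y' < V'.v x') :
    Same V V' x (x' + y') := by
  have h0 : V'.v x' ≠ 0 := (zero_le.trans_lt hlt).ne'
  have h1 := V'.v.map_add_eq_of_lt_right hlt
  have h2 := V'.lead_add le_rfl hlt.le
  rw [(V'.lead_eq_zero_iff h0).2 hlt.ne] at h2
  refine ⟨by rw [add_comm, h1, h.1], ?_⟩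
  simp only [AngularValuation.lead, add_comm x' y', h1, if_true, add_zero] at h2
  rw [h.2, add_comm, h2]

theorem natCast [CharZero k] (V : AngularValuation K k Γ) {n : ℕ} (hn : n ≠ 0) :
    V.v (n : K) = 1 ∧ V.ac (n : K) = n := by
  have h1 : V.lead 1 (n : K) = n := by
    have := V.lead_sum (Finset.range n) (fun _ => (1 : K)) (γ := 1) (by simp)
    simpa [AngularValuation.lead] using this
  have h2 : V.v (n : K) = 1 := by
    by_contra h
    rw [(V.lead_eq_zero_iff one_ne_zero).2 h] at h1
    exact hn (by exact_mod_cast h1.symm)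
  exact ⟨h2, by simpa [AngularValuation.lead, h2] using h1⟩

theorem intCast [CharZero k] (V : AngularValuation K k Γ) (V' : AngularValuation K' k Γ) (n : ℤ) :
    Same V V' (n : K) (n : K') := by
  have key : ∀ m : ℕ, Same V V' (m : K) (m : K') := fun m => by
    rcases eq_or_ne m 0 with rfl | h
    · simp [Same]
    · simp [Same, natCast V h, natCast V' h]
  have neg : Same V V' (-1 : K) (-1 : K') := by
    have h1 := fun W : AngularValuation K k Γ => W.lead_add (γ := 1) (x := 1) (y := -1)
      (by simp) (by simp)
    have h2 := fun W : AngularValuation K' k Γ => W.lead_add (γ := 1) (x := 1) (y := -1)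
      (by simp) (by simp)
    have h1 := h1 V
    have h2 := h2 V'
    simp [AngularValuation.lead] at h1 h2
    refine ⟨by simp, ?_⟩
    linear_combination h2 - h1
  obtain ⟨m, rfl | rfl⟩ := n.eq_nat_or_neg
  · simpa using key m
  · simpa using neg.mul (key m)

end Same

section Poly

variable (V : AngularValuation K k Γ)

theorem natCast_le_one (n : ℕ) : V.v (n : K) ≤ 1 := by
  induction n with
  | zero => simp
  | succ n ih => push_cast; exact V.v.map_add_le ih (by simp)

theorem taylor_bound {T : K[X]} {g γ : Γ} (h : ∀ i, V.v (T.coeff i) * g ^ i ≤ γ) {w : K}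
    (hw : V.v w ≤ g) (i : ℕ) : V.v ((taylor w T).coeff i) * g ^ i ≤ γ := by
  rcases eq_or_ne g 0 with rfl | hg
  · have hw0 : w = 0 := by simpa using hw
    simpa [hw0] using h i
  have hgi : 0 < g ^ i := pow_pos (zero_lt_iff.2 hg) i
  rw [taylor_coeff, eval_eq_sum_range, ← le_div_iff₀ hgi]
  refine V.v.map_sum_le fun j _ => ?_
  rw [le_div_iff₀ hgi, hasseDeriv_coeff]
  refine le_trans ?_ (h (j + i))
  simp only [map_mul, map_pow]
  calc V.v ((j + i).choose i : K) * V.v (T.coeff (j + i)) * V.v w ^ j * g ^ i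
      ≤ 1 * V.v (T.coeff (j + i)) * g ^ j * g ^ i := by
        gcongr
        exact V.natCast_le_one _
    _ = _ := by rw [one_mul, mul_assoc, ← pow_add]

theorem eval_eq_sum_taylor (Q : K[X]) (a c : K) :
    Q.eval a = ∑ i ∈ Finset.range (Q.natDegree + 1), (taylor c Q).coeff i * (a - c) ^ i := by
  have h := taylor_eval c Q (a - c)
  rw [sub_add_cancel, eval_eq_sum_range, natDegree_taylor] at h
  exact h.symm

theorem eval_le_of_taylor {Q : K[X]} {a c : K} {γ : Γ}
    (h : ∀ i, V.v ((taylor c Q).coeff i) * V.v (a - c) ^ i ≤ γ) : V.v (Q.eval a) ≤ γ := by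
  rw [eval_eq_sum_taylor Q a c]
  exact V.v.map_sum_le fun i _ => by simpa using h i

variable {V}

theorem Good.closer {a : K} {Q : K[X]} {c d : K} (h : V.Good a Q c)
    (hd : V.v (a - d) ≤ V.v (a - c)) : V.Good a Q d := by
  intro i
  have hw : V.v (d - c) ≤ V.v (a - c) := by
    have := V.v.map_sub_le (x := a - c) (y := a - d) le_rfl hd
    rwa [sub_sub_sub_cancel_left] at this
  have := V.taylor_bound h hw i
  rw [taylor_taylor, sub_add_cancel] at this
  refine le_trans ?_ this
  gcongr

theorem Henselian.newton (hV : V.Henselian) {Q : K[X]} {a y : K} {γ : Γ}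
    (hb : ∀ i, V.v ((taylor a Q).coeff i) * V.v y ^ i ≤ γ) (h0 : V.v (Q.eval a) < γ)
    (h1 : V.v (Q.derivative.eval a) * V.v y = γ) :
    ∃ z, Q.eval z = 0 ∧ V.v (z - a) < V.v y ∧
      V.v (z - a) * V.v (Q.derivative.eval a) ≤ V.v (Q.eval a) := by
  have hγ : γ ≠ 0 := (zero_le.trans_lt h0).ne'
  have hγ' : 0 < γ := zero_lt_iff.2 hγ
  set D := Q.derivative.eval a with hD
  have hDy : V.v (D * y) = γ := by simpa using h1
  have hDy0 : D * y ≠ 0 := by rw [← V.v.ne_zero_iff, hDy]; exact hγ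
  have hy0 : y ≠ 0 := right_ne_zero_of_mul hDy0
  let R : K[X] := C (D * y)⁻¹ * (taylor a Q).comp (C y * X)
  have hR : ∀ i, R.coeff i = (D * y)⁻¹ * ((taylor a Q).coeff i * y ^ i) := fun i => by
    simp only [R, coeff_C_mul, comp_C_mul_X_coeff]
  have hRv : ∀ i, V.v (R.coeff i) = γ⁻¹ * (V.v ((taylor a Q).coeff i) * V.v y ^ i) := fun i => by
    rw [hR, map_mul, map_inv₀, hDy, map_mul, map_pow]
  obtain ⟨t, ht, htv⟩ := hV R
    (fun i => by rw [hRv, inv_mul_le_iff₀ hγ', mul_one]; exact hb i)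
    (by rw [hRv, inv_mul_lt_iff₀ hγ', mul_one]; simpa using h0)
    (by rw [hRv, inv_mul_eq_one₀ hγ]; simp [taylor_coeff_one, ← hD, h1])
  have ht' : Q.eval (t * y + a) = 0 := by
    have : eval t R = (D * y)⁻¹ * Q.eval (y * t + a) := by
      simp [R, eval_comp, taylor_eval]
    rw [this] at ht
    rw [mul_comm t y]
    exact (mul_eq_zero.1 ht).resolve_left (inv_ne_zero hDy0)
  rw [hRv 0] at htv
  simp only [taylor_coeff_zero, pow_zero, mul_one] at htv
  have htv2 : V.v t * γ ≤ V.v (Q.eval a) := by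
    rwa [le_inv_mul_iff₀ hγ', mul_comm] at htv
  refine ⟨t * y + a, ht', ?_, ?_⟩
  · rw [add_sub_cancel_right, map_mul]
    have : V.v t < 1 := by
      by_contra hc
      push Not at hc
      exact absurd (htv2.trans_lt h0) (not_lt.2 (le_mul_of_one_le_left' hc))
    exact mul_lt_of_lt_one_left (zero_lt_iff.2 (V.v.ne_zero_iff.2 hy0)) this
  · rw [add_sub_cancel_right, map_mul, mul_assoc, mul_comm (V.v y), h1]
    exact htv2

end Poly

end AngularValuation

namespace AngularValuation

variable {K K' k Γ : Type*} [Field K] [Field K'] [Field k] [LinearOrderedCommGroupWithZero Γ]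
variable {V : AngularValuation K k Γ} {V' : AngularValuation K' k Γ}

theorem bound_of_good_derivative [CharZero k] {a c : K} {Q : K[X]} (h : V.Good a (derivative Q) c)
    {γ : Γ} (h0 : V.v (Q.eval a) ≤ γ) (h1 : V.v (a - c) * V.v ((derivative Q).eval a) ≤ γ)
    (j : ℕ) : V.v ((taylor c Q).coeff j) * V.v (a - c) ^ j ≤ γ := by
  have hder : ∀ n, (taylor c (derivative Q)).coeff n = (taylor c Q).coeff (n + 1) * (n + 1) := by
    intro n
    rw [← coeff_derivative, taylor_apply, taylor_apply, derivative_comp]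
    simp
  have hsucc : ∀ n, V.v ((taylor c Q).coeff (n + 1)) * V.v (a - c) ^ (n + 1) ≤ γ := by
    intro n
    have hn := h n
    have h2 := (Same.natCast V (Nat.succ_ne_zero n)).1
    push_cast at h2
    rw [hder, map_mul, h2, mul_one] at hn
    calc _ = V.v (a - c) * (V.v ((taylor c Q).coeff (n + 1)) * V.v (a - c) ^ n) := by
          rw [pow_succ]; ac_rfl
      _ ≤ _ := by gcongr
      _ ≤ γ := h1
  cases j with
  | succ n => exact hsucc n
  | zero =>
    have hs := eval_eq_sum_taylor Q a c
    rw [Finset.sum_range_succ', pow_zero, mul_one, ← sub_eq_iff_eq_add'] at hs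
    rw [pow_zero, mul_one, ← hs]
    exact V.v.map_sub_le h0 (V.v.map_sum_le fun i _ => by simpa using hsucc i)

section Embedding

variable {F : Type*} [Field F] {i : F →+* K} {i' : F →+* K'}

theorem exists_good [CharZero k] (hV : V.Henselian) {d : ℕ}
    (H : ∀ Q : F[X], Q ≠ 0 → Q.natDegree ≤ d → ∀ z, (Q.map i).eval z = 0 → z ∈ i.range)
    (a : K) (Q : F[X]) (hQ : Q.natDegree ≤ d) : ∃ c, V.Good a (Q.map i) (i c) := by
  induction hn : Q.natDegree using Nat.strong_induction_on generalizing Q with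
  | _ n ih =>
    rcases Nat.eq_zero_or_pos n with rfl | hpos
    · obtain ⟨q, rfl⟩ := natDegree_eq_zero.1 hn
      refine ⟨0, fun j => ?_⟩
      cases j <;> simp
    · have hlt : (derivative Q).natDegree < n := hn ▸ natDegree_derivative_lt (by omega)
      obtain ⟨c, hc⟩ := ih _ hlt _ (by omega) rfl
      rw [← derivative_map] at hc
      set y := a - i c
      set γ := V.v y * V.v ((derivative (Q.map i)).eval a) with hγ
      by_cases hle : γ ≤ V.v ((Q.map i).eval a)
      · exact ⟨c, bound_of_good_derivative hc le_rfl hle⟩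
      · push Not at hle
        have hb := V.taylor_bound (w := y) (bound_of_good_derivative hc hle.le hγ.ge) le_rfl
        simp only [taylor_taylor, y, sub_add_cancel] at hb
        obtain ⟨z, hz, hzy, hz'⟩ := hV.newton hb hle (by rw [hγ, mul_comm])
        have hQ0 : Q ≠ 0 := by rintro rfl; simp at hn; omega
        obtain ⟨e, rfl⟩ := H Q hQ0 hQ z hz
        rw [V.v.map_sub_swap] at hzy hz'
        exact ⟨e, bound_of_good_derivative (hc.closer hzy.le) le_rfl hz'⟩

theorem Good.same_eval (hS : ∀ f, Same V V' (i f) (i' f)) {a : K} {a' : K'} {c : F} {Q : F[X]}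
    (hc : V.Good a (Q.map i) (i c)) (h : Same V V' (a - i c) (a' - i' c)) :
    Same V V' ((Q.map i).eval a) ((Q.map i').eval a') := by
  have e := eval_eq_sum_taylor (Q.map i) a (i c)
  have e' := eval_eq_sum_taylor (Q.map i') a' (i' c)
  simp only [natDegree_map, ← map_taylor, coeff_map] at e e'
  have hg := hc
  simp only [Good, ← map_taylor, coeff_map] at hg
  rw [e] at hg
  rw [e, e']
  refine Same.sum (fun j _ => (hS _).mul (h.pow j)) fun j _ => ?_
  simpa using hg j

theorem Same.of_closer (hS : ∀ f, Same V V' (i f) (i' f)) {a : K} {a' : K'} {c d : F}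
    (h : Same V V' (a - i c) (a' - i' c)) (hd : V.v (a - i c) ≤ V.v (a - i d)) :
    Same V V' (a - i d) (a' - i' d) := by
  have e : a - i d = (a - i c) + i (c - d) := by rw [map_sub]; ring
  have e' : a' - i' d = (a' - i' c) + i' (c - d) := by rw [map_sub]; ring
  rw [e, e']
  refine h.add (hS _) (e ▸ hd) ?_
  rw [← e]
  have : i (c - d) = (a - i d) - (a - i c) := by rw [map_sub]; ring
  rw [this]
  exact V.v.map_sub_le le_rfl hd

theorem exists_same (V : AngularValuation K k Γ) (V' : AngularValuation K' k Γ) {y : K}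
    (hy : y ≠ 0) : ∃ y', Same V V' y y' := by
  obtain ⟨y', h1, h2⟩ := V'.exists_eq (V.v y) (V.ac y) (by simpa) (by simpa)
  exact ⟨y', h1.symm, h2.symm⟩

theorem exists_ball (hS : ∀ f, Same V V' (i f) (i' f)) {a : K} (ha : a ∉ i.range)
    (S : Finset F) : ∃ a', ∀ c ∈ S, Same V V' (a - i c) (a' - i' c) := by
  rcases S.eq_empty_or_nonempty with rfl | hne
  · simp
  obtain ⟨c, -, hmin⟩ := S.exists_min_image (fun c => V.v (a - i c)) hne
  have hy : a - i c ≠ 0 := fun h => ha ⟨c, (sub_eq_zero.1 h).symm⟩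
  obtain ⟨y', hy'⟩ := exists_same V V' hy
  refine ⟨y' + i' c, fun d hd => Same.of_closer hS (c := c) ?_ (hmin d hd)⟩
  rwa [add_sub_cancel_right]

theorem exists_root_ball [CharZero k] (hV : V.Henselian) (hV' : V'.Henselian)
    (hS : ∀ f, Same V V' (i f) (i' f)) {a : K} (ha : a ∉ i.range) {P : F[X]} (hP : P ≠ 0)
    (haP : (P.map i).eval a = 0)
    (H : ∀ Q : F[X], Q ≠ 0 → Q.natDegree < P.natDegree → ∀ z, (Q.map i).eval z = 0 → z ∈ i.range)
    (S : Finset F) :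
    ∃ a', (P.map i').eval a' = 0 ∧ ∀ c ∈ S, Same V V' (a - i c) (a' - i' c) := by
  classical
  have hpos : P.natDegree ≠ 0 := by
    intro h0
    obtain ⟨q, rfl⟩ := natDegree_eq_zero.1 h0
    simp at haP hP
    exact hP haP
  have hdlt : (derivative P).natDegree < P.natDegree := natDegree_derivative_lt hpos
  obtain ⟨c₀, hc₀⟩ := exists_good hV (d := P.natDegree - 1)
    (fun Q hQ hd => H Q hQ (by omega)) a (derivative P) (by omega)
  obtain ⟨c, -, hmin⟩ := (insert c₀ S).exists_min_image (fun c => V.v (a - i c)) (by simp)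
  have hc := hc₀.closer (hmin c₀ (by simp))
  have hy : a - i c ≠ 0 := fun h => ha ⟨c, (sub_eq_zero.1 h).symm⟩
  obtain ⟨y', hy'⟩ := exists_same V V' hy
  set b := y' + i' c with hb
  have hbc : Same V V' (a - i c) (b - i' c) := by rwa [hb, add_sub_cancel_right]
  have hder : (derivative P) ≠ 0 := by
    have : CharZero F := charZero_of_inj_zero fun n hn => by
      by_contra hne
      have h1 := (Same.natCast V hne).1
      rw [← map_natCast i, hn, map_zero, map_zero] at h1
      exact zero_ne_one h1
    intro h0
    exact hpos (derivative_eq_zero.1 h0)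
  have hD0 : ((derivative P).map i).eval a ≠ 0 := fun h0 => ha (H _ hder hdlt a h0)
  have hsame := hc.same_eval hS hbc
  rw [← derivative_map] at hc
  rw [← derivative_map, ← derivative_map] at hsame
  rw [← derivative_map] at hD0
  set γ := V.v (a - i c) * V.v ((derivative (P.map i)).eval a) with hγ
  have hγ0 : γ ≠ 0 := by rw [hγ]; exact mul_ne_zero (by simpa using hy) (V.v.ne_zero_iff.2 hD0)
  have hbd := bound_of_good_derivative hc (γ := γ) (by simp [haP]) hγ.ge
  have hbd' : ∀ j, V'.v ((taylor (i' c) (P.map i')).coeff j) * V'.v (b - i' c) ^ j ≤ γ := by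
    intro j
    have := hbd j
    rw [← map_taylor, coeff_map, (hS _).1, hbc.1] at this
    rwa [← map_taylor, coeff_map]
  have hPb : V'.v ((P.map i').eval b) < γ := by
    refine lt_of_le_of_ne (V'.eval_le_of_taylor hbd') ?_
    rw [← V'.lead_eq_zero_iff hγ0, ← V.lead_zero γ, ← haP]
    have e := eval_eq_sum_taylor (P.map i) a (i c)
    have e' := eval_eq_sum_taylor (P.map i') b (i' c)
    simp only [natDegree_map, ← map_taylor, coeff_map] at e e' hbd
    rw [e, e']
    refine (Same.sum_lead (fun j _ => (hS _).mul (hbc.pow j)) fun j _ => ?_).symm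
    simpa using hbd j
  have hbd2 := V'.taylor_bound (w := b - i' c) hbd' le_rfl
  simp only [taylor_taylor, sub_add_cancel] at hbd2
  obtain ⟨z, hz, hzb, -⟩ := hV'.newton hbd2 hPb (by rw [← hsame.1, ← hbc.1, hγ, mul_comm])
  refine ⟨z, hz, fun d hd => Same.of_closer hS (c := c) ?_ (hmin d (by simp [hd]))⟩
  have := hbc.add_of_lt hzb
  rwa [sub_add_sub_cancel'] at this

theorem exists_same_eval [Countable F] (hsat : V'.Saturated) (hS : ∀ f, Same V V' (i f) (i' f))
    {a : K} {P : F[X]} (haP : (P.map i).eval a = 0)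
    (hgood : ∀ Q : F[X], ∃ c, V.Good a ((Q % P).map i) (i c))
    (hfin : ∀ S : Finset F, ∃ a', (P.map i').eval a' = 0 ∧
      ∀ c ∈ S, Same V V' (a - i c) (a' - i' c)) :
    ∃ a', ∀ Q : F[X], Same V V' ((Q.map i).eval a) ((Q.map i').eval a') := by
  classical
  obtain ⟨e, he⟩ := exists_surjective_nat F
  obtain ⟨a', ha', hball⟩ := hsat (fun n => V.v (a - i (e n))) (fun n => V.ac (a - i (e n)))
    (fun n => i' (e n)) (P.map i') fun n => by
      obtain ⟨x, hx, hx'⟩ := hfin ((Finset.range n).image e)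
      refine ⟨x, hx, fun j hj => ?_⟩
      have := hx' (e j) (Finset.mem_image_of_mem _ (by simpa))
      exact ⟨this.1.symm, this.2.symm⟩
  refine ⟨a', fun Q => ?_⟩
  obtain ⟨c, hc⟩ := hgood Q
  obtain ⟨n, rfl⟩ := he c
  have h := hc.same_eval hS (a' := a') ⟨(hball n).1.symm, (hball n).2.symm⟩
  have hQ := EuclideanDomain.div_add_mod Q P
  have h1 : (Q.map i).eval a = ((Q % P).map i).eval a := by
    conv_lhs => rw [← hQ]
    rw [Polynomial.map_add, Polynomial.map_mul, eval_add, eval_mul, haP, zero_mul, zero_add]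
  have h2 : (Q.map i').eval a' = ((Q % P).map i').eval a' := by
    conv_lhs => rw [← hQ]
    rw [Polynomial.map_add, Polynomial.map_mul, eval_add, eval_mul, ha', zero_mul, zero_add]
  rwa [h1, h2]

end Embedding

end AngularValuation

namespace AngularValuation

universe u w

variable {K : Type u} {K' : Type w} {k Γ : Type*} [Field K] [Field K'] [Field k]
  [LinearOrderedCommGroupWithZero Γ]
variable {V : AngularValuation K k Γ} {V' : AngularValuation K' k Γ}

/-- A subring of `K × K'` that is the graph of a partial isomorphism preserving leading terms. -/
def IsPartialIso (V : AngularValuation K k Γ) (V' : AngularValuation K' k Γ)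
    (G : Subring (K × K')) : Prop :=
  ∀ z ∈ G, Same V V' z.1 z.2

theorem IsPartialIso.exists_field {G : Subring (K × K')} (hG : IsPartialIso V V' G)
    (hc : (G : Set (K × K')).Countable) :
    ∃ (F : Type (max u w)) (_ : Field F) (i : F →+* K) (i' : F →+* K'), Countable F ∧
      (∀ f, Same V V' (i f) (i' f)) ∧ (∀ z ∈ G, ∃ f, i f = z.1 ∧ i' f = z.2) ∧
      ∀ f, ∃ x ∈ G, ∃ y ∈ G, i f = x.1 / y.1 := by
  let p : G →+* K := (RingHom.fst K K').comp G.subtype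
  let p' : G →+* K' := (RingHom.snd K K').comp G.subtype
  have hp : Function.Injective p := by
    rw [injective_iff_map_eq_zero]
    rintro ⟨⟨x, x'⟩, hz⟩ (h : x = 0)
    have : x' = 0 := (hG _ hz).eq_zero_iff.1 h
    subst h this
    rfl
  have hp' : Function.Injective p' := by
    rw [injective_iff_map_eq_zero]
    rintro ⟨⟨x, x'⟩, hz⟩ (h : x' = 0)
    have : x = 0 := (hG _ hz).eq_zero_iff.2 h
    subst h this
    rfl
  have : IsDomain G := hp.isDomain p
  have : Countable G := hc
  have hdiv : ∀ f : FractionRing G, ∃ x y : G,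
      f = algebraMap G (FractionRing G) x / algebraMap G (FractionRing G) y := fun f => by
    obtain ⟨x, y, -, h⟩ := IsFractionRing.div_surjective (A := G) f
    exact ⟨x, y, h.symm⟩
  have hl : ∀ x y : G, IsFractionRing.lift hp (algebraMap G (FractionRing G) x /
      algebraMap G (FractionRing G) y) = p x / p y := fun x y => by
    rw [map_div₀, IsFractionRing.lift_algebraMap, IsFractionRing.lift_algebraMap]
  have hl' : ∀ x y : G, IsFractionRing.lift hp' (algebraMap G (FractionRing G) x /
      algebraMap G (FractionRing G) y) = p' x / p' y := fun x y => by
    rw [map_div₀, IsFractionRing.lift_algebraMap, IsFractionRing.lift_algebraMap]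
  refine ⟨FractionRing G, inferInstance, IsFractionRing.lift hp, IsFractionRing.lift hp', ?_,
    ?_, ?_, ?_⟩
  · refine Function.Surjective.countable (f := fun z : G × G =>
      algebraMap G (FractionRing G) z.1 / algebraMap G (FractionRing G) z.2) fun f => ?_
    obtain ⟨x, y, h⟩ := hdiv f
    exact ⟨(x, y), h.symm⟩
  · intro f
    obtain ⟨x, y, rfl⟩ := hdiv f
    rw [hl, hl']
    exact (hG _ x.2).div (hG _ y.2)
  · intro z hz
    exact ⟨algebraMap G _ ⟨z, hz⟩, IsFractionRing.lift_algebraMap hp _,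
      IsFractionRing.lift_algebraMap hp' _⟩
  · intro f
    obtain ⟨x, y, rfl⟩ := hdiv f
    exact ⟨x, x.2, y, y.2, hl x y⟩

/-- The subring of `K × K'` generated by a common subfield and a pair of elements. -/
noncomputable def adjoinPair {F : Type*} [Field F] (i : F →+* K) (i' : F →+* K') (a : K) (a' : K') :
    Subring (K × K') :=
  ((eval₂RingHom i a).prod (eval₂RingHom i' a')).range

section Adjoin

variable {F : Type*} [Field F] {i : F →+* K} {i' : F →+* K'} {a : K} {a' : K'}

theorem isPartialIso_adjoinPair
    (h : ∀ Q : F[X], Same V V' ((Q.map i).eval a) ((Q.map i').eval a')) :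
    IsPartialIso V V' (adjoinPair i i' a a') := by
  rintro _ ⟨Q, rfl⟩
  simpa [eval_map] using h Q

theorem mk_mem_adjoinPair (f : F) : (i f, i' f) ∈ adjoinPair i i' a a' :=
  ⟨C f, by simp⟩

theorem self_mem_adjoinPair : (a, a') ∈ adjoinPair i i' a a' :=
  ⟨X, by simp⟩

theorem le_adjoinPair {G : Subring (K × K')} (hG : ∀ z ∈ G, ∃ f, i f = z.1 ∧ i' f = z.2) :
    G ≤ adjoinPair i i' a a' := by
  intro z hz
  obtain ⟨f, h1, h2⟩ := hG z hz
  have : z = (i f, i' f) := Prod.ext h1.symm h2.symm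
  exact this ▸ mk_mem_adjoinPair f

theorem fst_mem_of_mem_adjoinPair {B : Subfield K} (hB : ∀ f, i f ∈ B) (ha : a ∈ B)
    {z : K × K'} (hz : z ∈ adjoinPair i i' a a') : z.1 ∈ B := by
  obtain ⟨Q, rfl⟩ := hz
  simp only [RingHom.prod_apply, coe_eval₂RingHom]
  rw [eval₂_eq_sum_range]
  exact sum_mem fun j _ => mul_mem (hB _) (pow_mem ha j)

theorem countable_adjoinPair [Countable F] :
    (adjoinPair i i' a a' : Set (K × K')).Countable := by
  have : Countable F[X] := by
    rw [← Cardinal.mk_le_aleph0_iff]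
    exact Polynomial.cardinalMk_le_max.trans (by simp)
  rw [adjoinPair, RingHom.coe_range]
  exact Set.countable_range _

end Adjoin

theorem countable_algebraicClosure (F E : Type*) [Field F] [Field E] [Algebra F E] [Countable F] :
    ((algebraicClosure F E).toSubfield : Set E).Countable :=
  (Algebraic.countable F E).mono fun _ hx => mem_algebraicClosure_iff.1 hx

theorem IsPartialIso.exists_algebraicClosure {G : Subring (K × K')} (hG : IsPartialIso V V' G)
    (hc : (G : Set (K × K')).Countable) :
    ∃ B : Subfield K, (B : Set K).Countable ∧ (∀ z ∈ G, z.1 ∈ B) ∧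
      ∀ Q : B[X], Q ≠ 0 → ∀ x, (Q.map B.subtype).eval x = 0 → x ∈ B := by
  obtain ⟨F, _, i, i', _, -, hz, -⟩ := hG.exists_field hc
  let := i.toAlgebra
  refine ⟨(algebraicClosure F K).toSubfield, countable_algebraicClosure F K, ?_, ?_⟩
  · intro z h
    obtain ⟨f, hf, -⟩ := hz z h
    rw [← hf]
    exact (algebraicClosure F K).algebraMap_mem f
  · intro Q hQ x hx
    have : IsAlgebraic (algebraicClosure F K) x := ⟨Q, hQ, by
      rw [← hx, eval_map, aeval_def]; rfl⟩
    exact mem_algebraicClosure_iff.2 (this.restrictScalars F)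

/-- A countable partial isomorphism extends to one whose domain is relatively algebraically
closed. -/
theorem IsPartialIso.exists_algClosed [CharZero k] (hV : V.Henselian) (hV' : V'.Henselian)
    (hsat : V'.Saturated) {G₀ : Subring (K × K')} (hG₀ : IsPartialIso V V' G₀)
    (hc₀ : (G₀ : Set (K × K')).Countable) :
    ∃ (F : Type (max u w)) (_ : Field F) (i : F →+* K) (i' : F →+* K'), Countable F ∧
      (∀ f, Same V V' (i f) (i' f)) ∧ (∀ z ∈ G₀, ∃ f, i f = z.1 ∧ i' f = z.2) ∧
      ∀ Q : F[X], Q ≠ 0 → ∀ a, (Q.map i).eval a = 0 → a ∈ i.range := by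
  obtain ⟨B, hBc, hBG, hBalg⟩ := hG₀.exists_algebraicClosure hc₀
  obtain ⟨G, hle, hmax⟩ := zorn_le_nonempty₀
    {G : Subring (K × K') | IsPartialIso V V' G ∧ ∀ z ∈ G, z.1 ∈ B} (by
      intro c hcs hch y hy
      have hdir : DirectedOn (· ≤ ·) c := hch.directedOn
      have hmem : ∀ z, z ∈ sSup c → ∃ s ∈ c, z ∈ s := fun z hz =>
        (Subring.mem_sSup_of_directedOn ⟨y, hy⟩ hdir).1 hz
      refine ⟨sSup c, ⟨fun z hz => ?_, fun z hz => ?_⟩, fun z hz => le_sSup hz⟩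
      · obtain ⟨s, hs, hzs⟩ := hmem z hz
        exact (hcs hs).1 z hzs
      · obtain ⟨s, hs, hzs⟩ := hmem z hz
        exact (hcs hs).2 z hzs) G₀ ⟨hG₀, hBG⟩
  obtain ⟨hG, hGB⟩ := hmax.prop
  have hinj : Set.InjOn Prod.fst (G : Set (K × K')) := by
    intro x hx y hy hxy
    have h := (hG _ (G.sub_mem hx hy)).eq_zero_iff.1 (sub_eq_zero.2 hxy)
    exact Prod.ext hxy (sub_eq_zero.1 h)
  have hc : (G : Set (K × K')).Countable :=
    Set.MapsTo.countable_of_injOn (f := Prod.fst) (t := (B : Set K)) hGB hinj hBc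
  obtain ⟨F, _, i, i', _, hS, hz, hdiv⟩ := hG.exists_field hc
  refine ⟨F, inferInstance, i, i', inferInstance, hS, fun z h => hz z (hle h), ?_⟩
  have hiB : ∀ f, i f ∈ B := fun f => by
    obtain ⟨x, hx, y, hy, h⟩ := hdiv f
    rw [h]
    exact div_mem (hGB x hx) (hGB y hy)
  intro Q
  induction hn : Q.natDegree using Nat.strong_induction_on generalizing Q with
  | _ n ih =>
    intro hQ a ha
    by_contra hna
    have H : ∀ R : F[X], R ≠ 0 → R.natDegree < Q.natDegree → ∀ z, (R.map i).eval z = 0 →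
        z ∈ i.range := fun R hR hlt => ih _ (hn ▸ hlt) R rfl hR
    have hdeg : Q.natDegree ≠ 0 := by
      intro h0
      obtain ⟨q, rfl⟩ := natDegree_eq_zero.1 h0
      simp at ha hQ
      exact hQ ha
    obtain ⟨a', ha'⟩ := exists_same_eval hsat hS ha
      (fun R => exists_good hV (d := Q.natDegree - 1)
        (fun R hR hd => H R hR (by omega)) a (R % Q)
        (by have := natDegree_mod_lt R hdeg; omega))
      (exists_root_ball hV hV' hS hna hQ ha H)
    have haB : a ∈ B := by
      let j : F →+* B := i.codRestrict B hiB
      refine hBalg (Q.map j) ((Polynomial.map_ne_zero_iff j.injective).2 hQ) a ?_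
      rw [Polynomial.map_map]
      exact ha
    have hle2 : adjoinPair i i' a a' ≤ G := hmax.le_of_ge
      ⟨isPartialIso_adjoinPair ha', fun z h => fst_mem_of_mem_adjoinPair hiB haB h⟩
      (le_adjoinPair hz)
    obtain ⟨f, hf, -⟩ := hz _ (hle2 self_mem_adjoinPair)
    exact hna ⟨f, hf⟩

theorem IsPartialIso.forth [CharZero k] (hV : V.Henselian) (hV' : V'.Henselian)
    (hsat : V'.Saturated) {G₀ : Subring (K × K')} (hG₀ : IsPartialIso V V' G₀)
    (hc₀ : (G₀ : Set (K × K')).Countable) (a : K) :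
    ∃ G : Subring (K × K'), IsPartialIso V V' G ∧ (G : Set (K × K')).Countable ∧ G₀ ≤ G ∧
      ∃ a', (a, a') ∈ G := by
  obtain ⟨F, _, i, i', _, hS, hz, halg⟩ := hG₀.exists_algClosed hV hV' hsat hc₀
  suffices h : ∃ a', ∀ Q : F[X], Same V V' ((Q.map i).eval a) ((Q.map i').eval a') by
    obtain ⟨a', ha'⟩ := h
    exact ⟨adjoinPair i i' a a', isPartialIso_adjoinPair ha', countable_adjoinPair,
      le_adjoinPair hz, a', self_mem_adjoinPair⟩
  by_cases ha : a ∈ i.range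
  · obtain ⟨f, rfl⟩ := ha
    refine ⟨i' f, fun Q => ?_⟩
    simpa using hS (Q.eval f)
  · refine exists_same_eval hsat hS (P := 0) (by simp) (fun Q => ?_) fun S => ?_
    · exact exists_good hV (fun R hR _ => halg R hR) a _ le_rfl
    · obtain ⟨a', h⟩ := exists_ball hS ha S
      exact ⟨a', by simp, h⟩

theorem IsPartialIso.back [CharZero k] (hV : V.Henselian) (hV' : V'.Henselian)
    (hsat : V.Saturated) {G₀ : Subring (K × K')} (hG₀ : IsPartialIso V V' G₀)
    (hc₀ : (G₀ : Set (K × K')).Countable) (a' : K') :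
    ∃ G : Subring (K × K'), IsPartialIso V V' G ∧ (G : Set (K × K')).Countable ∧ G₀ ≤ G ∧
      ∃ a, (a, a') ∈ G := by
  let e : K × K' ≃+* K' × K := RingEquiv.prodComm
  obtain ⟨G, hG, hc, hle, a, ha⟩ := IsPartialIso.forth (V := V') (V' := V) hV' hV hsat
    (G₀ := G₀.comap e.symm.toRingHom) (fun z hz => (hG₀ _ hz).symm)
    (hc₀.preimage e.symm.injective) a'
  exact ⟨G.comap e.toRingHom, fun z hz => (hG _ hz).symm, hc.preimage e.injective,
    fun z hz => hle (show e.symm (e z) ∈ G₀ by simpa using hz), a, ha⟩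

theorem isPartialIso_bot [CharZero k] (V : AngularValuation K k Γ)
    (V' : AngularValuation K' k Γ) :
    IsPartialIso V V' ⊥ ∧ ((⊥ : Subring (K × K')) : Set (K × K')).Countable := by
  constructor
  · intro z hz
    obtain ⟨n, rfl⟩ := Subring.mem_bot.1 hz
    simpa using Same.intCast V V' n
  · rw [Subring.coe_bot]
    exact Set.countable_range _

end AngularValuation

section ElementaryEquivalence

open FirstOrder Language Ring

variable {K K' k Γ : Type*} [Field K] [Field K'] [Field k] [LinearOrderedCommGroupWithZero Γ]
variable [CompatibleRing K] [CompatibleRing K']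
variable {V : AngularValuation K k Γ} {V' : AngularValuation K' k Γ}

theorem term_realize_mem_subring {α : Type*} (G : Subring (K × K')) (t : Language.ring.Term α)
    {x : α → K} {x' : α → K'} (h : ∀ j, (x j, x' j) ∈ G) :
    (t.realize x, t.realize x') ∈ G := by
  induction t with
  | var j => exact h j
  | func f ts ih =>
    cases f with
    | add => simpa [Term.realize] using! G.add_mem (ih 0) (ih 1)
    | mul => simpa [Term.realize] using! G.mul_mem (ih 0) (ih 1)
    | neg => simpa [Term.realize] using! G.neg_mem (ih 0)
    | zero => simp only [Term.realize, CompatibleRing.funMap_zero]; exact G.zero_mem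
    | one => simp only [Term.realize, CompatibleRing.funMap_one]; exact G.one_mem

namespace AngularValuation

theorem IsPartialIso.realize_iff [CharZero k] (hV : V.Henselian) (hV' : V'.Henselian)
    (hsat : V.Saturated) (hsat' : V'.Saturated) {α : Type*} {n : ℕ}
    (φ : Language.ring.BoundedFormula α n) (G : Subring (K × K')) (hG : IsPartialIso V V' G)
    (hc : (G : Set (K × K')).Countable) {x : α → K} {x' : α → K'} (h : ∀ j, (x j, x' j) ∈ G)
    {y : Fin n → K} {y' : Fin n → K'} (hy : ∀ j, (y j, y' j) ∈ G) :
    φ.Realize x y ↔ φ.Realize x' y' := by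
  induction φ generalizing G with
  | falsum => rfl
  | equal t₁ t₂ =>
    have hxy : ∀ j, (Sum.elim x y j, Sum.elim x' y' j) ∈ G := by
      rintro (j | j)
      exacts [h j, hy j]
    have := (hG _ (G.sub_mem (term_realize_mem_subring G t₁ hxy)
      (term_realize_mem_subring G t₂ hxy))).eq_zero_iff
    simpa [BoundedFormula.Realize, sub_eq_zero] using this
  | rel R => cases R
  | imp _ _ ih₁ ih₂ => simp only [BoundedFormula.realize_imp, ih₁ G hG hc h hy, ih₂ G hG hc h hy]
  | all φ ih =>
    simp only [BoundedFormula.realize_all]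
    have snoc : ∀ {G₂ : Subring (K × K')} {a : K} {a' : K'}, G ≤ G₂ → (a, a') ∈ G₂ →
        ∀ j, (Fin.snoc (α := fun _ => K) y a j, Fin.snoc (α := fun _ => K') y' a' j) ∈ G₂ := by
      intro G₂ a a' hle ha j
      refine Fin.lastCases ?_ (fun j => ?_) j
      · simpa using ha
      · simpa using hle (hy j)
    constructor
    · intro hall a'
      obtain ⟨G₂, hG₂, hc₂, hle, a, ha⟩ := hG.back hV hV' hsat hc a'
      exact (ih G₂ hG₂ hc₂ (fun j => hle (h j)) (snoc hle ha)).1 (hall a)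
    · intro hall a
      obtain ⟨G₂, hG₂, hc₂, hle, a', ha⟩ := hG.forth hV hV' hsat' hc a
      exact (ih G₂ hG₂ hc₂ (fun j => hle (h j)) (snoc hle ha)).2 (hall a')

/-- Henselian, countably saturated fields with the same residue field of characteristic zero
and the same value group are elementarily equivalent. -/
theorem realize_sentence_iff [CharZero k] (hV : V.Henselian) (hV' : V'.Henselian)
    (hsat : V.Saturated) (hsat' : V'.Saturated) (φ : Language.ring.Sentence) :
    K ⊨ φ ↔ K' ⊨ φ := by
  obtain ⟨h1, h2⟩ := isPartialIso_bot V V'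
  exact IsPartialIso.realize_iff hV hV' hsat hsat' φ ⊥ h1 h2 (fun j => j.elim) fun j => j.elim0

end AngularValuation

end ElementaryEquivalence

namespace Filter.Germ

variable {α Γ : Type*} {u : Ultrafilter α} [LinearOrderedCommGroupWithZero Γ]

noncomputable instance instLinearOrderedCommGroupWithZero :
    LinearOrderedCommGroupWithZero (Germ (u : Filter α) Γ) where
  __ := instGroupWithZero
  __ := instLinearOrder
  mul_comm := mul_comm
  mul_lt_mul_of_pos_left x hx y z := by
    induction x using inductionOn with | _ f =>
    induction y using inductionOn with | _ g =>
    induction z using inductionOn with | _ h =>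
    intro hgh
    refine coe_lt.2 ((coe_lt.1 hx).mp ((coe_lt.1 hgh).mono fun a h1 h2 => ?_))
    exact mul_lt_mul_of_pos_left h1 h2
  bot := 0
  bot_le x := by
    induction x using inductionOn with | _ f =>
    exact coe_le.2 (Eventually.of_forall fun a => zero_le)
  isBot_zero x := by
    induction x using inductionOn with | _ f =>
    exact coe_le.2 (Eventually.of_forall fun a => zero_le)

end Filter.Germ

open Filter

/-- A ring homomorphism from a product of rings that exhibits its codomain as the ultraproduct. -/
structure IsUltraproduct {α : Type*} (u : Ultrafilter α) {M : α → Type*} [∀ a, Ring (M a)]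
    {K : Type*} [Ring K] (π : (∀ a, M a) →+* K) : Prop where
  surjective : Function.Surjective π
  eq_zero_iff : ∀ f, π f = 0 ↔ ∀ᶠ a in u, f a = 0

namespace IsUltraproduct

variable {α : Type*} {u : Ultrafilter α} {M : α → Type*}

section Ring

variable [∀ a, CommRing (M a)] {K : Type*} [CommRing K] {π : (∀ a, M a) →+* K}

theorem eq_iff (h : IsUltraproduct u π) {f g : ∀ a, M a} : π f = π g ↔ ∀ᶠ a in u, f a = g a := by
  rw [← sub_eq_zero, ← map_sub, h.eq_zero_iff]
  simp [sub_eq_zero]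

theorem charZero (h : IsUltraproduct u π) (hM : ∀ n : ℕ, n ≠ 0 → ∀ᶠ a in u, (n : M a) ≠ 0) :
    CharZero K := by
  refine charZero_of_inj_zero fun n hn => ?_
  by_contra h0
  rw [← map_natCast π, h.eq_zero_iff] at hn
  obtain ⟨a, h1, h2⟩ := (hn.and (hM n h0)).exists
  exact h2 h1

/-- A representative of an element of an ultraproduct. -/
noncomputable def rep (h : IsUltraproduct u π) (x : K) : ∀ a, M a :=
  Function.surjInv h.surjective x

theorem map_rep (h : IsUltraproduct u π) (x : K) : π (h.rep x) = x :=
  Function.surjInv_eq h.surjective x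

theorem rep_map (h : IsUltraproduct u π) (f : ∀ a, M a) : ∀ᶠ a in u, h.rep (π f) a = f a :=
  h.eq_iff.1 (h.map_rep _)

theorem eval_map_eq (π : (∀ a, M a) →+* K) (Q : (∀ a, M a)[X]) (f : ∀ a, M a) :
    (Q.map π).eval (π f) = π fun a => (Q.map (Pi.evalRingHom M a)).eval (f a) := by
  rw [eval_map, eval₂_hom]
  congr 1
  funext a
  rw [eval_map]
  exact hom_eval₂ Q (RingHom.id _) (Pi.evalRingHom M a) f

end Ring

variable {m : α → Type*} {K k Γ : Type*} [∀ a, Field (M a)] [∀ a, Field (m a)] [Field K] [Field k]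
  [LinearOrderedCommGroupWithZero Γ] {π : (∀ a, M a) →+* K} {ρ : (∀ a, m a) →+* k}

/-- The value of an element of an ultraproduct. -/
noncomputable def value (h : IsUltraproduct u π) (V : ∀ a, AngularValuation (M a) (m a) Γ)
    (x : K) : Germ (u : Filter α) Γ :=
  ((fun a => (V a).v (h.rep x a) : α → Γ) : Germ (u : Filter α) Γ)

/-- The angular component of an element of an ultraproduct. -/
noncomputable def angle (h : IsUltraproduct u π) (ρ : (∀ a, m a) →+* k)
    (V : ∀ a, AngularValuation (M a) (m a) Γ) (x : K) : k :=
  ρ fun a => (V a).ac (h.rep x a)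

variable (h : IsUltraproduct u π) (V : ∀ a, AngularValuation (M a) (m a) Γ)

theorem value_map (f : ∀ a, M a) :
    h.value V (π f) = ((fun a => (V a).v (f a) : α → Γ) : Germ (u : Filter α) Γ) :=
  Germ.coe_eq.2 ((h.rep_map f).mono fun a ha => by simp [ha])

theorem angle_map (h' : IsUltraproduct u ρ) (f : ∀ a, M a) :
    h.angle ρ V (π f) = ρ fun a => (V a).ac (f a) :=
  h'.eq_iff.2 ((h.rep_map f).mono fun a ha => by simp [ha])

theorem ite_angle_map (h' : IsUltraproduct u ρ) (f : ∀ a, M a) (g : α → Γ) :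
    (if h.value V (π f) = (g : Germ (u : Filter α) Γ) then h.angle ρ V (π f) else 0) =
      ρ fun a => if (V a).v (f a) = g a then (V a).ac (f a) else 0 := by
  rw [h.value_map, h.angle_map V h']
  split_ifs with hfg
  · exact h'.eq_iff.2 ((Germ.coe_eq.1 hfg).mono fun a ha => by simp [ha])
  · symm
    rw [h'.eq_zero_iff]
    exact (Ultrafilter.eventually_not.2 fun hh => hfg (Germ.coe_eq.2 hh)).mono fun a ha => by
      simp [ha]

/-- The ultraproduct of a family of angular valuations with the same value group. -/
noncomputable def angularValuation (h' : IsUltraproduct u ρ) :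
    AngularValuation K k (Germ (u : Filter α) Γ) where
  v :=
    { toFun := h.value V
      map_zero' := by
        rw [← map_zero π, value_map]
        exact Germ.coe_eq.2 (Eventually.of_forall fun a => by simp)
      map_one' := by
        rw [← map_one π, value_map]
        exact Germ.coe_eq.2 (Eventually.of_forall fun a => by simp)
      map_mul' := fun x y => by
        obtain ⟨f, rfl⟩ := h.surjective x
        obtain ⟨g, rfl⟩ := h.surjective y
        rw [← map_mul π, value_map, value_map, value_map, ← Germ.coe_mul]
        exact Germ.coe_eq.2 (Eventually.of_forall fun a => by simp)
      map_add_le_max' := fun x y => by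
        obtain ⟨f, rfl⟩ := h.surjective x
        obtain ⟨g, rfl⟩ := h.surjective y
        rw [← map_add π, value_map, value_map, value_map, Germ.max_def]
        exact Germ.coe_le.2 (Eventually.of_forall fun a => (V a).v.map_add _ _) }
  ac :=
    { toFun := h.angle ρ V
      map_zero' := by
        rw [← map_zero π, angle_map h V h', ← map_zero ρ]
        congr 1
        funext a
        simp
      map_one' := by
        rw [← map_one π, angle_map h V h', ← map_one ρ]
        congr 1
        funext a
        simp
      map_mul' := fun x y => by
        obtain ⟨f, rfl⟩ := h.surjective x
        obtain ⟨g, rfl⟩ := h.surjective y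
        rw [← map_mul π, angle_map h V h', angle_map h V h', angle_map h V h', ← map_mul ρ]
        congr 1
        funext a
        simp }
  lead_add' γ x y := by
    obtain ⟨f, rfl⟩ := h.surjective x
    obtain ⟨f', rfl⟩ := h.surjective y
    induction γ using Germ.inductionOn with | _ g =>
    change h.value V _ ≤ _ → h.value V _ ≤ _ → (if h.value V _ = _ then h.angle ρ V _ else 0) =
      (if h.value V _ = _ then h.angle ρ V _ else 0) +
      (if h.value V _ = _ then h.angle ρ V _ else 0)
    rw [← map_add π, ite_angle_map h V h', ite_angle_map h V h', ite_angle_map h V h',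
      ← map_add ρ, value_map, value_map, Germ.coe_le, Germ.coe_le]
    intro h1 h2
    exact h'.eq_iff.2 ((h1.and h2).mono fun a ha => (V a).lead_add' _ _ _ ha.1 ha.2)
  exists_eq γ r := by
    obtain ⟨s, rfl⟩ := h'.surjective r
    induction γ using Germ.inductionOn with | _ g =>
    intro hg hs
    have h1 : ∀ᶠ a in u, g a ≠ 0 :=
      Ultrafilter.eventually_not.2 fun hh => hg (Germ.coe_eq.2 hh)
    have h2 : ∀ᶠ a in u, s a ≠ 0 :=
      Ultrafilter.eventually_not.2 fun hh => hs ((h'.eq_zero_iff s).2 hh)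
    obtain ⟨x, hx⟩ := Filter.skolem.1
      ((h1.and h2).mono fun a ha => (V a).exists_eq _ _ ha.1 ha.2)
    refine ⟨π x, (h.value_map V x).trans (Germ.coe_eq.2 ?_),
      (h.angle_map V h' x).trans (h'.eq_iff.2 ?_)⟩
    · exact hx.mono fun a ha => ha.1
    · exact hx.mono fun a ha => ha.2

theorem angularValuation_v (h' : IsUltraproduct u ρ) (f : ∀ a, M a) :
    (h.angularValuation V h').v (π f) =
      ((fun a => (V a).v (f a) : α → Γ) : Germ (u : Filter α) Γ) :=
  h.value_map V f

theorem angularValuation_ac (h' : IsUltraproduct u ρ) (f : ∀ a, M a) :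
    (h.angularValuation V h').ac (π f) = ρ fun a => (V a).ac (f a) :=
  h.angle_map V h' f

variable {V}

theorem henselian (h' : IsUltraproduct u ρ) (hV : ∀ a, (V a).Henselian) :
    (h.angularValuation V h').Henselian := by
  intro R hR h0 h1
  obtain ⟨Q, rfl⟩ := Polynomial.map_surjective π h.surjective R
  simp only [coeff_map, angularValuation_v] at hR h0 h1
  have hall : ∀ᶠ a in u, ∀ i, (V a).v (Q.coeff i a) ≤ 1 := by
    have : ∀ᶠ a in u, ∀ i ∈ Finset.range (Q.natDegree + 1), (V a).v (Q.coeff i a) ≤ 1 :=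
      (Filter.eventually_all_finset _).2 fun i _ => Germ.coe_le.1 (hR i)
    refine this.mono fun a ha i => ?_
    by_cases hi : i ≤ Q.natDegree
    · exact ha i (Finset.mem_range.2 (by omega))
    · simp [coeff_eq_zero_of_natDegree_lt (not_le.1 hi)]
  let T : ∀ a, (M a)[X] := fun a => Q.map (Pi.evalRingHom M a)
  have key : ∀ᶠ a in u, ∃ t, (T a).eval t = 0 ∧ (V a).v t ≤ (V a).v (Q.coeff 0 a) := by
    refine (hall.and ((Germ.coe_lt.1 h0).and (Germ.coe_eq.1 h1))).mono fun a ha => ?_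
    simpa [T] using hV a (T a) (by simpa [T] using ha.1) (by simpa [T] using ha.2.1)
      (by simpa [T] using ha.2.2)
  obtain ⟨t, ht⟩ := Filter.skolem.1 key
  refine ⟨π t, ?_, ?_⟩
  · rw [eval_map_eq, h.eq_zero_iff]
    exact ht.mono fun a ha => ha.1
  · rw [coeff_map, angularValuation_v, angularValuation_v]
    exact Germ.coe_le.2 (ht.mono fun a ha => ha.2)

theorem saturated (h' : IsUltraproduct u ρ) {ν : α → ℕ} (hν : ∀ n, ∀ᶠ a in u, n ≤ ν a) :
    (h.angularValuation V h').Saturated := by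
  intro γ r c P H
  obtain ⟨Q, rfl⟩ := Polynomial.map_surjective π h.surjective P
  obtain ⟨e, rfl⟩ : ∃ e : ℕ → ∀ a, M a, (fun n => π (e n)) = c :=
    ⟨fun n => h.rep (c n), funext fun n => h.map_rep _⟩
  obtain ⟨s, rfl⟩ : ∃ s : ℕ → ∀ a, m a, (fun n => ρ (s n)) = r :=
    ⟨fun n => h'.rep (r n), funext fun n => h'.map_rep _⟩
  obtain ⟨g, rfl⟩ : ∃ g : ℕ → α → Γ, (fun n => (g n : Germ (u : Filter α) Γ)) = γ :=
    ⟨fun n => Quotient.out (γ n), funext fun n => Quotient.out_eq _⟩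
  let D : ℕ → ∀ a, M a → Prop := fun i a x =>
    (V a).v (x - e i a) = g i a ∧ (V a).ac (x - e i a) = s i a
  have hD : ∀ (x : ∀ a, M a) i, ((h.angularValuation V h').v (π x - π (e i)) = g i ∧
      (h.angularValuation V h').ac (π x - π (e i)) = ρ (s i)) ↔ ∀ᶠ a in u, D i a (x a) := by
    intro x i
    rw [← map_sub, angularValuation_v, angularValuation_ac, Germ.coe_eq, h'.eq_iff]
    exact eventually_and.symm
  have hQ : ∀ x : ∀ a, M a, (Q.map π).eval (π x) = 0 ↔
      ∀ᶠ a in u, (Q.map (Pi.evalRingHom M a)).eval (x a) = 0 := fun x => by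
    rw [eval_map_eq, h.eq_zero_iff]
  let S : ℕ → α → Prop := fun n a =>
    ∃ x, (Q.map (Pi.evalRingHom M a)).eval x = 0 ∧ ∀ i < n, D i a x
  have hS : ∀ n, ∀ᶠ a in u, S n a := by
    intro n
    obtain ⟨x, hx0, hx⟩ := H n
    obtain ⟨x, rfl⟩ := h.surjective x
    have h1 : ∀ᶠ a in u, ∀ i ∈ Finset.range n, D i a (x a) :=
      (Filter.eventually_all_finset _).2 fun i hi => (hD x i).1 (hx i (Finset.mem_range.1 hi))
    exact (((hQ x).1 hx0).and h1).mono fun a ha =>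
      ⟨x a, ha.1, fun i hi => ha.2 i (Finset.mem_range.2 hi)⟩
  classical
  let N : α → ℕ := fun a => Nat.findGreatest (fun n => S n a) (ν a)
  have hN : ∀ n, ∀ᶠ a in u, n ≤ N a ∧ S (N a) a := fun n =>
    ((hS n).and (hν n)).mono fun a ha =>
      ⟨Nat.le_findGreatest ha.2 ha.1, Nat.findGreatest_spec (P := fun n => S n a) ha.2 ha.1⟩
  obtain ⟨x, hx⟩ := Filter.skolem.1 ((hN 0).mono fun a ha => ha.2)
  refine ⟨π x, (hQ x).2 (hx.mono fun a ha => ha.1), fun i => (hD x i).2 ?_⟩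
  exact (hx.and (hN (i + 1))).mono fun a ha => ha.1.2 i ha.2.1

end IsUltraproduct

/-- In a Henselian local ring, a polynomial whose linear coefficient is a unit and whose constant
coefficient lies in the maximal ideal has a root divisible by the constant coefficient. -/
theorem HenselianRing.exists_root_dvd {A : Type*} [CommRing A] [IsLocalRing A]
    [HenselianRing A (IsLocalRing.maximalIdeal A)] (R : A[X])
    (h0 : R.coeff 0 ∈ IsLocalRing.maximalIdeal A) (h1 : IsUnit (R.coeff 1)) :
    ∃ s, R.eval (R.coeff 0 * s) = 0 := by
  nontriviality A
  set r₀ := R.coeff 0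
  set r₁ := R.coeff 1
  let Q := R.divX.divX
  let d := Q.natDegree
  have hR : R = X * (X * Q + C r₁) + C r₀ := by
    conv_lhs => rw [← divX_mul_X_add R, ← divX_mul_X_add R.divX]
    simp only [coeff_divX, Q, r₁, r₀]
    ring
  let h : A[X] := ∑ j ∈ Finset.range (d + 1), C (Q.coeff j * r₀ ^ j) * X ^ (d - j)
  let g : A[X] := X ^ (d + 1) * (X + C r₁) + C r₀ * h
  have hh : ∀ S s : A, S * s = 1 → h.eval S = S ^ d * Q.eval (r₀ * s) := by
    intro S s hs
    simp only [h, eval_finsetSum, eval_mul, eval_C, eval_pow, eval_X]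
    rw [eval_eq_sum_range, Finset.mul_sum]
    refine Finset.sum_congr rfl fun j hj => ?_
    have hj : j ≤ d := by simpa [Nat.lt_succ_iff] using hj
    obtain ⟨e, he⟩ := Nat.exists_eq_add_of_le hj
    have : S ^ d * s ^ j = S ^ (d - j) := by
      rw [he, Nat.add_sub_cancel_left, pow_add, mul_right_comm, ← mul_pow, hs, one_pow, one_mul]
    rw [← this]
    ring
  have hhd : h.natDegree ≤ d := natDegree_sum_le_of_forall_le _ _ fun j _ =>
    (natDegree_C_mul_X_pow_le _ _).trans (Nat.sub_le _ _)
  have hp : (X ^ (d + 1) * (X + C r₁) : A[X]).Monic := (monic_X_pow _).mul (monic_X_add_C _)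
  have hg : g.Monic := by
    refine hp.add_of_left (degree_lt_degree ?_)
    rw [(monic_X_pow _).natDegree_mul (monic_X_add_C _), natDegree_X_pow, natDegree_X_add_C]
    exact (natDegree_C_mul_le _ _).trans_lt (by omega)
  have hgS : g.eval (-r₁) ∈ IsLocalRing.maximalIdeal A := by
    simp only [g, eval_add, eval_mul, eval_pow, eval_X, eval_C, neg_add_cancel, mul_zero, zero_add]
    exact Ideal.mul_mem_right _ _ h0
  have hder : IsUnit (g.derivative.eval (-r₁)) := by
    have : g.derivative.eval (-r₁) = (-r₁) ^ (d + 1) + r₀ * h.derivative.eval (-r₁) := by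
      simp [g, derivative_mul]
    rw [this]
    by_contra hn
    have h2 : (-r₁) ^ (d + 1) ∈ IsLocalRing.maximalIdeal A := by
      rw [← Ideal.add_mem_iff_left _ (Ideal.mul_mem_right (h.derivative.eval (-r₁)) _ h0)]
      exact hn
    exact h2 (h1.neg.pow _)
  obtain ⟨S, hS, hSr⟩ := HenselianRing.is_henselian g hg (-r₁) hgS (hder.map _)
  have hSu : IsUnit S := by
    by_contra hn
    have h2 := Ideal.sub_mem _ hSr (show S ∈ IsLocalRing.maximalIdeal A from hn)
    rw [sub_neg_eq_add, add_sub_cancel_left] at h2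
    exact h2 h1
  obtain ⟨s, hs⟩ := hSu.exists_right_inv
  refine ⟨s, (hSu.pow (d + 2)).mul_left_cancel ?_⟩
  have hgs : S ^ (d + 1) * (S + r₁) + r₀ * (S ^ d * Q.eval (r₀ * s)) = 0 := by
    rw [← hh S s hs]
    simpa [g] using hS
  rw [hR]
  simp only [eval_add, eval_mul, eval_X, eval_C, mul_zero]
  linear_combination r₀ * hgs + (r₀ ^ 2 * s * S ^ d * S * Q.eval (r₀ * s) +
    r₀ ^ 2 * S ^ d * Q.eval (r₀ * s) + r₀ * r₁ * S ^ (d + 1)) * hs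

namespace IsDiscreteValuationRing

open IsDedekindDomain WithZero

section ResidueMap

variable {A K κ : Type*} [CommRing A] [Field K] [Algebra A K] [Field κ]

open scoped Classical in
/-- The residue of an integral element of the fraction field. -/
noncomputable def residueMap (res : A →+* κ) (x : K) : κ :=
  if h : ∃ a, algebraMap A K a = x then res h.choose else 0

theorem residueMap_algebraMap [IsFractionRing A K] (res : A →+* κ) (a : A) :
    residueMap res (algebraMap A K a) = res a := by
  have h : ∃ b, algebraMap A K b = algebraMap A K a := ⟨a, rfl⟩
  rw [residueMap, dif_pos h, IsFractionRing.injective A K h.choose_spec]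

theorem residueMap_zero [IsFractionRing A K] (res : A →+* κ) : residueMap res (0 : K) = 0 := by
  simpa using residueMap_algebraMap (K := K) res 0

theorem residueMap_one [IsFractionRing A K] (res : A →+* κ) : residueMap res (1 : K) = 1 := by
  simpa using residueMap_algebraMap (K := K) res 1

end ResidueMap

variable {A : Type*} (K : Type*) {κ : Type*} [CommRing A] [IsDomain A] [IsDiscreteValuationRing A]
  [Field K] [Algebra A K] [IsFractionRing A K] [Field κ]

local notation "vK" => HeightOneSpectrum.valuation K (maximalIdeal A)

theorem map_eq_zero_iff_valuation_lt_one {res : A →+* κ} (hres : Function.Surjective res) (a : A) :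
    res a = 0 ↔ vK (algebraMap A K a) < 1 := by
  rw [HeightOneSpectrum.valuation_lt_one_iff_mem, ← RingHom.mem_ker]
  have := RingHom.ker_isMaximal_of_surjective res hres
  rw [IsLocalRing.eq_maximalIdeal this]
  rfl

theorem exists_valuation_eq_exp_neg_one : ∃ ϖ : K, vK ϖ = exp (-1) := by
  obtain ⟨ϖ, hϖ⟩ := IsDiscreteValuationRing.exists_irreducible A
  refine ⟨algebraMap A K ϖ, ?_⟩
  rw [HeightOneSpectrum.valuation_of_algebraMap]
  exact HeightOneSpectrum.intValuation_singleton _ hϖ.ne_zero hϖ.maximalIdeal_eq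

/-- A uniformizer of the fraction field. -/
noncomputable def uniformizer (A K : Type*) [CommRing A] [IsDomain A] [IsDiscreteValuationRing A]
    [Field K] [Algebra A K] [IsFractionRing A K] : K :=
  (exists_valuation_eq_exp_neg_one (A := A) K).choose

theorem valuation_uniformizer : vK (uniformizer A K) = exp (-1) :=
  (exists_valuation_eq_exp_neg_one (A := A) K).choose_spec

theorem uniformizer_ne_zero : uniformizer A K ≠ 0 := fun h0 => by
  have := valuation_uniformizer (A := A) K
  rw [h0, map_zero] at this
  exact exp_ne_zero this.symm

theorem valuation_mul_uniformizer_zpow (x : K) (n : ℤ) :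
    vK (x * uniformizer A K ^ n) = vK x * exp (-n) := by
  rw [map_mul, map_zpow₀, valuation_uniformizer, ← exp_zsmul]
  simp

/-- The angular component map on the fraction field of a discrete valuation ring. -/
noncomputable def angularValuation {res : A →+* κ} (hres : Function.Surjective res) :
    AngularValuation K κ ℤᵐ⁰ where
  v := vK
  ac :=
    { toFun := fun x => residueMap res (x * uniformizer A K ^ log (vK x))
      map_zero' := by rw [zero_mul, residueMap_zero]
      map_one' := by rw [map_one, log_one, zpow_zero, one_mul, residueMap_one]
      map_mul' := fun x y => by
        rcases eq_or_ne x 0 with rfl | hx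
        · simp [residueMap_zero]
        rcases eq_or_ne y 0 with rfl | hy
        · simp [residueMap_zero]
        have hlift : ∀ z : K, z ≠ 0 →
            ∃ a, algebraMap A K a = z * uniformizer A K ^ log (vK z) := fun z hz => by
          refine exists_lift_of_le_one (le_of_eq ?_)
          have hz' : vK z ≠ 0 := by simpa using hz
          rw [valuation_mul_uniformizer_zpow, exp_neg, exp_log hz', mul_inv_cancel₀ hz']
        obtain ⟨a, ha⟩ := hlift x hx
        obtain ⟨b, hb⟩ := hlift y hy
        rw [map_mul, log_mul (by simpa using hx) (by simpa using hy),
          zpow_add₀ (uniformizer_ne_zero K), mul_mul_mul_comm, ← ha, ← hb, ← map_mul,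
          residueMap_algebraMap, residueMap_algebraMap,
          residueMap_algebraMap, map_mul] }
  lead_add' γ x y hx hy := by
    change (if _ then residueMap res _ else 0) =
      (if _ then residueMap res _ else 0) + (if _ then residueMap res _ else 0)
    rcases eq_or_ne γ 0 with rfl | hγ
    · obtain rfl : x = 0 := by simpa using hx
      obtain rfl : y = 0 := by simpa using hy
      simp [residueMap_zero]
    have key : ∀ z, vK z ≤ γ → ∃ a, algebraMap A K a = z * uniformizer A K ^ log γ ∧
        (if vK z = γ then residueMap res (z * uniformizer A K ^ log (vK z)) else 0) = res a := by
      intro z hz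
      have hv : vK (z * uniformizer A K ^ log γ) = vK z * γ⁻¹ := by
        rw [valuation_mul_uniformizer_zpow, exp_neg, exp_log hγ]
      obtain ⟨a, ha⟩ := exists_lift_of_le_one (A := A) (x := z * uniformizer A K ^ log γ) (by
        rw [hv, ← div_eq_mul_inv]
        exact div_le_one_of_le₀ hz zero_le)
      refine ⟨a, ha, ?_⟩
      split_ifs with h
      · rw [h, ← ha, residueMap_algebraMap]
      · symm
        rw [map_eq_zero_iff_valuation_lt_one K hres, ha, hv, ← div_eq_mul_inv,
          div_lt_one₀ (zero_lt_iff.2 hγ)]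
        exact lt_of_le_of_ne hz h
    obtain ⟨a, ha, ha'⟩ := key x hx
    obtain ⟨b, hb, hb'⟩ := key y hy
    obtain ⟨c, hc, hc'⟩ := key (x + y) ((Valuation.map_add_le _ hx hy))
    rw [ha', hb', hc', ← map_add]
    congr 1
    apply IsFractionRing.injective A K
    rw [map_add, ha, hb, hc, add_mul]
  exists_eq γ r hγ hr := by
    obtain ⟨a, rfl⟩ := hres r
    have ha : vK (algebraMap A K a) = 1 := le_antisymm (HeightOneSpectrum.valuation_le_one _ _)
      (not_lt.1 fun h => hr ((map_eq_zero_iff_valuation_lt_one K hres a).2 h))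
    have hv : vK (algebraMap A K a * uniformizer A K ^ (-log γ)) = γ := by
      rw [valuation_mul_uniformizer_zpow, ha, one_mul, neg_neg, exp_log hγ]
    refine ⟨_, hv, ?_⟩
    change residueMap res _ = _
    rw [hv, mul_assoc, ← zpow_add₀ (uniformizer_ne_zero K), neg_add_cancel, zpow_zero,
      mul_one, residueMap_algebraMap]

variable {K} in
theorem angularValuation_henselian [HenselianRing A (IsLocalRing.maximalIdeal A)] {res : A →+* κ}
    (hres : Function.Surjective res) : (angularValuation K hres).Henselian := by
  intro R hR h0 h1
  change vK _ < 1 at h0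
  change vK _ = 1 at h1
  obtain ⟨R, rfl⟩ := (lifts_iff_set_range (f := algebraMap A K) R).1 <|
    (lifts_iff_coeff_lifts R).2 fun n => exists_lift_of_le_one (hR n)
  rw [coeff_map] at h0 h1
  have hu : IsUnit (R.coeff 1) := by
    by_contra h
    exact ((HeightOneSpectrum.valuation_lt_one_iff_mem (maximalIdeal A) (R.coeff 1)).2 h).ne h1
  obtain ⟨s, hs⟩ := HenselianRing.exists_root_dvd R
    ((HeightOneSpectrum.valuation_lt_one_iff_mem (maximalIdeal A) (R.coeff 0)).1 h0) hu
  refine ⟨algebraMap A K (R.coeff 0 * s), ?_, ?_⟩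
  · rw [eval_map, eval₂_hom, hs, map_zero]
  · change vK _ ≤ vK _
    rw [coeff_map, map_mul, map_mul]
    exact mul_le_of_le_one_right' (HeightOneSpectrum.valuation_le_one _ _)

end IsDiscreteValuationRing

universe u v

open FirstOrder in
/-- Every family of fields has an ultraproduct that satisfies Łoś's theorem. -/
theorem exists_isUltraproduct {α : Type u} (U : Ultrafilter α) (M : α → Type v)
    [∀ a, Field (M a)] [∀ a, Ring.CompatibleRing (M a)] :
    ∃ (K : Type (max u v)) (_ : Field K) (_ : Ring.CompatibleRing K) (π : (∀ a, M a) →+* K),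
      IsUltraproduct U π ∧
      ∀ φ : Language.ring.Sentence, K ⊨ φ ↔ ∀ᶠ a in U, M a ⊨ φ := by
  have hmodel : Language.Theory.field.Model ((U : Filter α).Product M) := by
    rw [Language.Theory.model_iff]
    intro φ hφ
    rw [Language.Ultraproduct.sentence_realize]
    exact Eventually.of_forall fun a =>
      Language.Theory.realize_sentence_of_mem Language.Theory.field hφ
  let : Field ((U : Filter α).Product M) := Field.fieldOfModelField _
  let c : Ring.CompatibleRing ((U : Filter α).Product M) := Field.compatibleRingOfModelField _
  let ι : (∀ a, M a) → (U : Filter α).Product M := fun f => f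
  have hι : ∀ {n : ℕ} (F : Language.ring.Functions n) (x : Fin n → ∀ a, M a),
      c.funMap F (fun i => ι (x i)) = ι fun a => Language.Structure.funMap F fun i => x i a :=
    Language.Ultraproduct.funMap_cast
  have h0 : ι 0 = 0 := by
    change ι (fun _ => 0) = 0
    simpa using (hι Ring.zeroFunc ![]).symm
  refine ⟨(U : Filter α).Product M, inferInstance, c,
    { toFun := ι
      map_zero' := h0
      map_one' := ?_
      map_mul' := fun f g => ?_
      map_add' := fun f g => ?_ }, ⟨Quotient.mk_surjective, fun f => ?_⟩,
    Language.Ultraproduct.sentence_realize⟩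
  · change ι (fun _ => 1) = 1
    simpa using (hι Ring.oneFunc ![]).symm
  · change ι (fun a => f a * g a) = ι f * ι g
    simpa using (hι Ring.mulFunc ![f, g]).symm
  · change ι (fun a => f a + g a) = ι f + ι g
    simpa using (hι Ring.addFunc ![f, g]).symm
  · change ι f = 0 ↔ _
    rw [← h0]
    exact Quotient.eq''

open FirstOrder

attribute [local instance] FirstOrder.Ring.compatibleRingOfRing

theorem eventually_padic_realize_iff_laurentSeries_realize {u : Ultrafilter Nat.Primes}
    (hu : (u : Filter Nat.Primes) ≤ cofinite) [∀ p : Nat.Primes, Fact (p : ℕ).Prime]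
    (φ : FirstOrder.Language.ring.Sentence) :
    ∀ᶠ p : Nat.Primes in u, (ℚ_[p] ⊨ φ ↔ LaurentSeries (ZMod p) ⊨ φ) := by
  have (p : Nat.Primes) : HenselianRing (PowerSeries (ZMod p))
      (IsLocalRing.maximalIdeal (PowerSeries (ZMod p))) := by
    rw [PowerSeries.maximalIdeal_eq_span_X]
    infer_instance
  obtain ⟨K, _, _, π, hπ, hφ⟩ := exists_isUltraproduct u fun p : Nat.Primes => ℚ_[p]
  obtain ⟨K', _, _, π', hπ', hφ'⟩ :=
    exists_isUltraproduct u fun p : Nat.Primes => LaurentSeries (ZMod p)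
  obtain ⟨k, _, _, ρ, hρ, -⟩ := exists_isUltraproduct u fun p : Nat.Primes => ZMod p
  have hinj : ∀ n, ∀ᶠ p : Nat.Primes in u, n ≤ (p : ℕ) := fun n => hu <| by
    rw [Filter.mem_cofinite]
    exact ((Set.finite_lt_nat n).preimage (Subtype.val_injective.injOn)).subset fun p hp =>
      lt_of_not_ge (α := ℕ) hp
  have : CharZero k := hρ.charZero fun n hn => (hinj (n + 1)).mono fun p hp h0 => by
    rw [ZMod.natCast_eq_zero_iff] at h0
    exact absurd (Nat.le_of_dvd (Nat.pos_of_ne_zero hn) h0) (by omega)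
  have hiff := AngularValuation.realize_sentence_iff
    (hπ.henselian hρ fun p => IsDiscreteValuationRing.angularValuation_henselian (K := ℚ_[p])
      (ZMod.ringHom_surjective (PadicInt.toZMod (p := p))))
    (hπ'.henselian hρ fun p => IsDiscreteValuationRing.angularValuation_henselian
      (K := LaurentSeries (ZMod p))
      (ZMod.ringHom_surjective (PowerSeries.constantCoeff (R := ZMod p))))
    (hπ.saturated hρ hinj) (hπ'.saturated hρ hinj) φ
  rw [hφ, hφ'] at hiff
  rcases u.em fun p : Nat.Primes => ℚ_[p] ⊨ φ with h | h
  · exact (h.and (hiff.1 h)).mono fun p hp => iff_of_true hp.1 hp.2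
  · have h' := Ultrafilter.eventually_not.2 (mt hiff.2 (Ultrafilter.eventually_not.1 h))
    exact (h.and h').mono fun p hp => iff_of_false hp.1 hp.2

/-- Ax–Kochen–Ershov theorem: for every first-order sentence `φ` in
the language of rings, for all but finitely many primes `p`, the sentence `φ` holds
in the field `ℚ_p` of `p`-adic numbers if and only if it holds in the field
`𝔽_p((t))` of formal Laurent series over `ℤ/pℤ`. -/
theorem ax_kochen_ershov (φ : FirstOrder.Language.ring.Sentence) :
    ∃ S : Finset ℕ, ∀ (p : ℕ) [Fact p.Prime], p ∉ S →
      (ℚ_[p] ⊨ φ ↔ LaurentSeries (ZMod p) ⊨ φ) := by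
  have (p : Nat.Primes) : Fact (p : ℕ).Prime := ⟨p.2⟩
  let B : Set Nat.Primes := {p | ¬ (ℚ_[p] ⊨ φ ↔ LaurentSeries (ZMod p) ⊨ φ)}
  have hB : B.Finite := by
    by_contra hinf
    have : (cofinite ⊓ 𝓟 B).NeBot := Set.Infinite.cofinite_inf_principal_neBot hinf
    have hle := Ultrafilter.of_le (cofinite ⊓ 𝓟 B)
    have h1 := eventually_padic_realize_iff_laurentSeries_realize (hle.trans inf_le_left) φ
    have h2 : ∀ᶠ p in (Ultrafilter.of (cofinite ⊓ 𝓟 B) : Filter Nat.Primes), p ∈ B :=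
      hle (mem_inf_of_right (mem_principal_self B))
    obtain ⟨p, hp1, hp2⟩ := (h1.and h2).exists
    exact hp2 hp1
  refine ⟨hB.toFinset.map ⟨Subtype.val, Subtype.val_injective⟩, fun p hp hpB => ?_⟩
  by_contra h
  exact hpB (Finset.mem_map.2 ⟨⟨p, hp.out⟩, hB.mem_toFinset.2 h, rfl⟩)
end
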